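/- Let (Γ_λ)_{λ∈Λ} be a net of distance-regular graphs, indexed by an infinite directed set Λ, whose diameters satisfy d → ∞. If ξ ∈ ℝ is an accumulation point (cluster point) of the net λ ↦ 1/k(λ), whose values lie in (0, 1/2], then ξ ∈ {0, 1/2}. -/

import Mathlib

open Matrix Filter

/-- A (bundled) distance-regular graph: a finite connected simple graph of diameter `d`
with intersection numbers `a i`, `b i`, `c i` for `0 ≤ i ≤ d`; `b 0` is the valency `k`. -/
structure DRG where
  X : Type
  fin : Fintype X
  G : SimpleGraph X
  d : ℕ
  a : ℕ → ℕ
  b : ℕ → ℕ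
  c : ℕ → ℕ
  conn : G.Connected
  dist_le : ∀ x y : X, G.dist x y ≤ d
  dist_eq : ∃ x y : X, G.dist x y = d
  bd : b d = 0
  c0 : c 0 = 0
  count_c : ∀ i ≤ d, ∀ x y : X, G.dist x y = i →
      {z : X | G.Adj y z ∧ G.dist x z = i - 1}.ncard = c i
  count_a : ∀ i ≤ d, ∀ x y : X, G.dist x y = i →
      {z : X | G.Adj y z ∧ G.dist x z = i}.ncard = a i
  count_b : ∀ i ≤ d, ∀ x y : X, G.dist x y = i →
      {z : X | G.Adj y z ∧ G.dist x z = i + 1}.ncard = b i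

attribute [instance] DRG.fin

noncomputable instance (Γ : DRG) : DecidableEq Γ.X := Classical.decEq _

noncomputable instance (Γ : DRG) : DecidableRel Γ.G.Adj := fun _ _ => Classical.dec _

namespace DRG

variable (Γ : DRG)

/-- The `i`-th distance matrix (over `ℂ`). -/
noncomputable def Amat (i : ℕ) : Matrix Γ.X Γ.X ℂ :=
  Matrix.of fun x y => if Γ.G.dist x y = i then 1 else 0

/-- The adjacency algebra `A(Γ) = span_ℂ {A_0, …, A_d}`. -/
noncomputable def adjAlg : Submodule ℂ (Matrix Γ.X Γ.X ℂ) :=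
  Submodule.span ℂ {M | ∃ i ≤ Γ.d, M = Γ.Amat i}

/-- The matrix `K_t = (t^{∂(x,y)})_{x,y}` (over `ℝ`). -/
noncomputable def Kmat (t : ℝ) : Matrix Γ.X Γ.X ℝ :=
  Matrix.of fun x y => t ^ Γ.G.dist x y

/-- `t ∈ π(Γ)`, i.e. `K_t` is positive semidefinite. -/
def piMem (t : ℝ) : Prop := (Γ.Kmat t).PosSemidef

/-- The Gibbs functional `φ_t(B) = ∑_x t^{∂(x,o)} B_{x,o}` with base vertex `o`. -/
noncomputable def gibbs (t : ℝ) (o : Γ.X) (B : Matrix Γ.X Γ.X ℂ) : ℂ :=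
  ∑ x : Γ.X, (t : ℂ) ^ Γ.G.dist x o * B x o

end DRG

namespace DRG

theorem dist_succ_of_adj (Γ : DRG) {y z : Γ.X} (h : Γ.G.Adj y z) (x : Γ.X) :
    Γ.G.dist x z ≤ Γ.G.dist x y + 1 := by
  have h1 := Γ.conn.dist_triangle (u := x) (v := y) (w := z)
  have h2 : Γ.G.dist y z = 1 := SimpleGraph.dist_eq_one_iff_adj.2 h
  omega

theorem exists_adj_dist_pred (Γ : DRG) {x y : Γ.X} {n : ℕ} (h : Γ.G.dist x y = n + 1) :
    ∃ z, Γ.G.Adj y z ∧ Γ.G.dist x z = n := by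
  obtain ⟨p, hp⟩ := Γ.conn.exists_walk_length_eq_dist y x
  cases p with
  | nil => simp [SimpleGraph.dist_self] at h
  | cons hadj q =>
    rename_i v
    refine ⟨v, hadj, ?_⟩
    have h1 := SimpleGraph.dist_le q
    have h2 := Γ.dist_succ_of_adj hadj.symm x
    rw [SimpleGraph.Walk.length_cons, SimpleGraph.dist_comm, h] at hp
    rw [SimpleGraph.dist_comm] at h1
    omega

theorem exists_between (Γ : DRG) {x : Γ.X} (m : ℕ) : ∀ {y : Γ.X} (n : ℕ),
    Γ.G.dist x y = n + m → ∃ z, Γ.G.dist x z = n ∧ Γ.G.dist z y = m := by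
  induction m with
  | zero => exact fun {y} n h => ⟨y, h, SimpleGraph.dist_self⟩
  | succ m ih =>
    intro y n h
    obtain ⟨y', hy', h'⟩ := Γ.exists_adj_dist_pred (n := n + m) h
    obtain ⟨z, hz, hz'⟩ := ih n h'
    refine ⟨z, hz, ?_⟩
    have h1 := Γ.dist_succ_of_adj hy'.symm z
    have h2 := Γ.conn.dist_triangle (u := x) (v := z) (w := y)
    omega

theorem exists_dist_add (Γ : DRG) {m n : ℕ} (h : n + m ≤ Γ.d) :
    ∃ x z y, Γ.G.dist x z = n ∧ Γ.G.dist z y = m ∧ Γ.G.dist x y = n + m := by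
  obtain ⟨x, y, hxy⟩ := Γ.dist_eq
  obtain ⟨y', h1, -⟩ := Γ.exists_between (Γ.d - (n + m)) (x := x) (y := y) (n + m) (by omega)
  obtain ⟨z, h3, h4⟩ := Γ.exists_between m n h1
  exact ⟨x, z, y', h3, h4, h1⟩

theorem exists_dist (Γ : DRG) {n : ℕ} (h : n ≤ Γ.d) : ∃ x y, Γ.G.dist x y = n := by
  obtain ⟨x, -, y, -, -, h⟩ := Γ.exists_dist_add (n := n) (m := 0) h
  exact ⟨x, y, h⟩

theorem c_pos (Γ : DRG) {i : ℕ} (h1 : 1 ≤ i) (h : i ≤ Γ.d) : 1 ≤ Γ.c i := by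
  obtain ⟨x, y, hxy⟩ := Γ.exists_dist h
  obtain ⟨z, hz⟩ := Γ.exists_adj_dist_pred (x := x) (y := y) (n := i - 1) (by omega)
  rw [← Γ.count_c i h x y hxy]
  exact (Set.ncard_pos (Set.toFinite _)).2 ⟨z, hz⟩

theorem b_pos (Γ : DRG) {i : ℕ} (h : i < Γ.d) : 1 ≤ Γ.b i := by
  obtain ⟨x, z, y, h1, h2, h3⟩ := Γ.exists_dist_add (n := i) (m := 1) h
  rw [← Γ.count_b i h.le x z h1]
  exact (Set.ncard_pos (Set.toFinite _)).2 ⟨y, SimpleGraph.dist_eq_one_iff_adj.1 h2, h3⟩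

theorem a_zero (Γ : DRG) : Γ.a 0 = 0 := by
  obtain ⟨x, y, -⟩ := Γ.dist_eq
  rw [← Γ.count_a 0 (Nat.zero_le _) x x SimpleGraph.dist_self, Set.ncard_eq_zero (Set.toFinite _)]
  ext z
  simp only [Set.mem_ofPred_eq, Set.mem_empty_iff_false, iff_false, not_and]
  intro h h'
  have := SimpleGraph.dist_eq_one_iff_adj.2 h
  omega

theorem ncard_neighbors (Γ : DRG) (y : Γ.X) : {z | Γ.G.Adj y z}.ncard = Γ.b 0 := by
  rw [← Γ.count_b 0 (Nat.zero_le _) y y SimpleGraph.dist_self]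
  congr 1
  ext z
  simp [SimpleGraph.dist_eq_one_iff_adj]

theorem sum_eq (Γ : DRG) {i : ℕ} (h : i ≤ Γ.d) : Γ.c i + Γ.a i + Γ.b i = Γ.b 0 := by
  obtain rfl | hi := Nat.eq_zero_or_pos i
  · simp [Γ.c0, Γ.a_zero]
  obtain ⟨x, y, hxy⟩ := Γ.exists_dist h
  rw [← Γ.ncard_neighbors y, ← Γ.count_c i h x y hxy, ← Γ.count_a i h x y hxy,
    ← Γ.count_b i h x y hxy, ← Set.ncard_union_eq _ (Set.toFinite _) (Set.toFinite _),
    ← Set.ncard_union_eq _ (Set.toFinite _) (Set.toFinite _)]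
  · congr 1
    ext z
    simp only [Set.mem_union, Set.mem_ofPred_eq]
    constructor
    · tauto
    · intro hz
      have h1 := Γ.dist_succ_of_adj hz x
      have h2 := Γ.dist_succ_of_adj hz.symm x
      have : Γ.G.dist x z = i - 1 ∨ Γ.G.dist x z = i ∨ Γ.G.dist x z = i + 1 := by omega
      tauto
  · rw [Set.disjoint_left]
    simp only [Set.mem_union, Set.mem_ofPred_eq]
    rintro z (h | h) h' <;> omega
  · rw [Set.disjoint_left]
    simp only [Set.mem_ofPred_eq]
    intro z h h'
    omega

theorem c_one (Γ : DRG) (h : 1 ≤ Γ.d) : Γ.c 1 = 1 := by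
  obtain ⟨x, y, hxy⟩ := Γ.exists_dist h
  rw [← Γ.count_c 1 h x y hxy, Set.ncard_eq_one]
  refine ⟨x, ?_⟩
  ext z
  simp only [Set.mem_ofPred_eq, Set.mem_singleton_iff]
  have h0 : Γ.G.dist x z = 1 - 1 ↔ x = z := Γ.conn.dist_eq_zero_iff
  rw [h0]
  constructor
  · rintro ⟨-, h⟩
    exact h.symm
  · rintro rfl
    exact ⟨(SimpleGraph.dist_eq_one_iff_adj.1 hxy).symm, rfl⟩

/-- Two bases whose distances to `t` differ by one: the sets `C` grow and the sets `B` shrink. -/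
theorem closer_subset (Γ : DRG) {x x' t : Γ.X} {s : ℕ} (hx : Γ.G.Adj x x')
    (h1 : Γ.G.dist x' t = s) (h2 : Γ.G.dist x t = s + 1) :
    {z | Γ.G.Adj t z ∧ Γ.G.dist x' z = s - 1} ⊆ {z | Γ.G.Adj t z ∧ Γ.G.dist x z = s + 1 - 1} ∧
    {z | Γ.G.Adj t z ∧ Γ.G.dist x z = s + 1 + 1} ⊆ {z | Γ.G.Adj t z ∧ Γ.G.dist x' z = s + 1} := by
  constructor <;> intro z hz <;> simp only [Set.mem_ofPred_eq] at hz ⊢ <;> refine ⟨hz.1, ?_⟩ <;>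
    have h3 := Γ.dist_succ_of_adj hz.1 x <;> have h3' := Γ.dist_succ_of_adj hz.1.symm x <;>
    have h4 := Γ.dist_succ_of_adj hz.1 x' <;> have h4' := Γ.dist_succ_of_adj hz.1.symm x' <;>
    have h5 := Γ.dist_succ_of_adj hx z <;> have h6 := Γ.dist_succ_of_adj hx.symm z <;>
    rw [SimpleGraph.dist_comm, SimpleGraph.dist_comm (u := z)] at h5 h6
  · obtain rfl | hs := Nat.eq_zero_or_pos s
    · have h0 : Γ.G.dist x' z = 1 := by
        rw [Γ.conn.dist_eq_zero_iff] at h1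
        subst h1
        exact SimpleGraph.dist_eq_one_iff_adj.2 hz.1
      omega
    · omega
  · omega

theorem mono_step (Γ : DRG) {s : ℕ} (h : s + 1 ≤ Γ.d) :
    Γ.c s ≤ Γ.c (s + 1) ∧ Γ.b (s + 1) ≤ Γ.b s := by
  obtain ⟨t, x, h2⟩ := Γ.exists_dist h
  obtain ⟨x', hx, h1⟩ := Γ.exists_adj_dist_pred h2
  rw [SimpleGraph.dist_comm] at h1 h2
  obtain ⟨hc, hb⟩ := Γ.closer_subset hx h1 h2
  rw [← Γ.count_c s (by omega) x' t h1, ← Γ.count_c (s + 1) h x t h2,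
    ← Γ.count_b s (by omega) x' t h1, ← Γ.count_b (s + 1) h x t h2]
  exact ⟨Set.ncard_le_ncard hc (Set.toFinite _), Set.ncard_le_ncard hb (Set.toFinite _)⟩

theorem c_mono (Γ : DRG) {i j : ℕ} (hij : i ≤ j) (hj : j ≤ Γ.d) : Γ.c i ≤ Γ.c j := by
  induction j, hij using Nat.le_induction with
  | base => exact le_rfl
  | succ n _ ih => exact (ih (by omega)).trans (Γ.mono_step hj).1

theorem b_anti (Γ : DRG) {i j : ℕ} (hij : i ≤ j) (hj : j ≤ Γ.d) : Γ.b j ≤ Γ.b i := by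
  induction j, hij using Nat.le_induction with
  | base => exact le_rfl
  | succ n _ ih => exact (Γ.mono_step hj).2.trans (ih (by omega))

theorem dist_add_one_of_adj (Γ : DRG) {z z' t r : Γ.X} {s : ℕ} (htr : Γ.G.Adj t r)
    (hs : s + 1 ≤ Γ.d) (hc : Γ.c s = Γ.c (s + 1)) (hb : Γ.b s = Γ.b (s + 1))
    (h1 : Γ.G.dist z t = s) (h2 : Γ.G.dist z r = s + 1) (hz : Γ.G.Adj z z') :
    Γ.G.dist z' r = Γ.G.dist z' t + 1 := by
  rw [SimpleGraph.dist_comm] at h1 h2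
  obtain ⟨hC, hB⟩ := Γ.closer_subset htr.symm h1 h2
  have hs0 : s ≠ 0 := by
    rintro rfl
    have := Γ.c_pos le_rfl hs
    rw [← hc, Γ.c0] at this
    omega
  have eC := Set.eq_of_subset_of_ncard_le hC (by
    rw [Γ.count_c s (by omega) t z h1, Γ.count_c (s + 1) hs r z h2, hc]) (Set.toFinite _)
  have eB := Set.eq_of_subset_of_ncard_le hB (by
    rw [Γ.count_b s (by omega) t z h1, Γ.count_b (s + 1) hs r z h2, hb]) (Set.toFinite _)
  have hC' := Set.ext_iff.1 eC z'
  have hB' := Set.ext_iff.1 eB z'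
  simp only [Set.mem_ofPred_eq, hz, true_and] at hC' hB'
  have h3 := Γ.dist_succ_of_adj hz t
  have h4 := Γ.dist_succ_of_adj hz.symm t
  have h5 := Γ.dist_succ_of_adj hz r
  have h6 := Γ.dist_succ_of_adj hz.symm r
  rw [SimpleGraph.dist_comm, SimpleGraph.dist_comm (u := z')]
  omega

theorem zone_up (Γ : DRG) {i : ℕ} (h2i : 2 * i ≤ Γ.d)
    (hc : ∀ s, i ≤ s → s ≤ 2 * i → Γ.c s = Γ.c i)
    (hb : ∀ s, i ≤ s → s ≤ 2 * i → Γ.b s = Γ.b i)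
    {z z' t r : Γ.X} (htr : Γ.G.Adj t r) (h1 : i ≤ Γ.G.dist z t)
    (h2 : Γ.G.dist z r ≤ 2 * i) (h3 : Γ.G.dist z r = Γ.G.dist z t + 1) (hz : Γ.G.Adj z z') :
    Γ.G.dist z' r = Γ.G.dist z' t + 1 :=
  Γ.dist_add_one_of_adj htr (s := Γ.G.dist z t) (by omega)
    ((hc _ h1 (by omega)).trans (hc _ (by omega) (by omega)).symm)
    ((hb _ h1 (by omega)).trans (hb _ (by omega) (by omega)).symm) rfl h3 hz

theorem zone_far (Γ : DRG) {i : ℕ} (hi : 2 ≤ i) (h2i : 2 * i ≤ Γ.d)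
    (hc : ∀ s, i ≤ s → s ≤ 2 * i → Γ.c s = Γ.c i)
    (hb : ∀ s, i ≤ s → s ≤ 2 * i → Γ.b s = Γ.b i)
    {V w t r : Γ.X} (hVw : Γ.G.dist V w = i) (hwt : Γ.G.dist w t = i - 1)
    (hVt : Γ.G.dist V t = 2 * i - 1) (htr : Γ.G.Adj t r) (hwr : Γ.G.dist w r = i) :
    Γ.G.dist V r = 2 * i := by
  by_contra hne
  have key : ∀ n q, Γ.G.dist V q = n → n ≤ i → i ≤ Γ.G.dist q t → Γ.G.dist q t + n ≤ 2 * i →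
      Γ.G.dist q r = Γ.G.dist q t + 1 → Γ.G.dist V r = 2 * i := by
    intro n
    induction n with
    | zero =>
      intro q hq _ _ _ h
      rw [Γ.conn.dist_eq_zero_iff] at hq
      subst hq
      omega
    | succ n ih =>
      intro q hq hn h1 h2 h3
      obtain ⟨q', hq', hq2⟩ := Γ.exists_adj_dist_pred hq
      have h4 := Γ.zone_up h2i hc hb htr h1 (by omega) h3 hq'
      have h5 := Γ.conn.dist_triangle (u := V) (v := q') (w := t)
      have h6 := Γ.dist_succ_of_adj hq' t
      rw [SimpleGraph.dist_comm, SimpleGraph.dist_comm (u := t)] at h6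
      exact ih q' hq2 (by omega) (by omega) (by omega) h4
  have hBr := Γ.count_b i (by omega) r w (by rw [SimpleGraph.dist_comm, hwr])
  have hBV := Γ.count_b i (by omega) V w hVw
  have hCt := Γ.count_c (i - 1) (by omega) t w (by rw [SimpleGraph.dist_comm, hwt])
  have hpos := Γ.c_pos (i := i - 1) (by omega) (by omega)
  have hsub : {p | Γ.G.Adj w p ∧ Γ.G.dist r p = i + 1} ∪
      {p | Γ.G.Adj w p ∧ Γ.G.dist t p = i - 1 - 1} ⊆
      {p | Γ.G.Adj w p ∧ Γ.G.dist V p = i + 1} := by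
    rintro p (⟨hp, h⟩ | ⟨hp, h⟩)
    · refine ⟨hp, ?_⟩
      by_contra h'
      have h1 := Γ.dist_succ_of_adj hp V
      have h2 := Γ.dist_succ_of_adj hp t
      have h3 := Γ.dist_succ_of_adj htr p
      rw [SimpleGraph.dist_comm (u := t), SimpleGraph.dist_comm (u := t)] at h2
      rw [SimpleGraph.dist_comm (u := r)] at h
      exact hne (key _ p rfl (by omega) (by omega) (by omega) (by omega))
    · refine ⟨hp, ?_⟩
      have h1 := Γ.dist_succ_of_adj hp V
      have h2 := Γ.conn.dist_triangle (u := V) (v := p) (w := t)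
      rw [SimpleGraph.dist_comm (u := t)] at h
      omega
  have hdisj : Disjoint {p | Γ.G.Adj w p ∧ Γ.G.dist r p = i + 1}
      {p | Γ.G.Adj w p ∧ Γ.G.dist t p = i - 1 - 1} := by
    rw [Set.disjoint_left]
    rintro p ⟨hp, h⟩ ⟨-, h'⟩
    have h3 := Γ.dist_succ_of_adj htr p
    rw [SimpleGraph.dist_comm, SimpleGraph.dist_comm (u := p)] at h3
    omega
  have := Set.ncard_le_ncard hsub (Set.toFinite _)
  rw [Set.ncard_union_eq hdisj (Set.toFinite _) (Set.toFinite _)] at this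
  omega

theorem zone_near (Γ : DRG) {i : ℕ} (hi : 2 ≤ i) (h2i : 2 * i ≤ Γ.d)
    (hc : ∀ s, i ≤ s → s ≤ 2 * i → Γ.c s = Γ.c i)
    (hb : ∀ s, i ≤ s → s ≤ 2 * i → Γ.b s = Γ.b i)
    (hbi : Γ.b (i - 1) = Γ.b i) {V w t r : Γ.X} (hVw : Γ.G.dist V w = i)
    (hwt : Γ.G.dist w t = i - 1) (hVt : Γ.G.dist V t = 2 * i - 1) (htr : Γ.G.Adj t r)
    (hwr : Γ.G.dist w r = i - 1) : Γ.G.dist V r ≠ 2 * i - 2 := by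
  intro hVr
  have key : ∀ n q, Γ.G.dist V q = n → n + 1 ≤ i → Γ.G.dist q t + n ≤ 2 * i →
      Γ.G.dist q t = Γ.G.dist q r + 1 := by
    intro n
    induction n with
    | zero =>
      intro q hq _ _
      rw [Γ.conn.dist_eq_zero_iff] at hq
      subst hq
      omega
    | succ n ih =>
      intro q hq hn h1
      obtain ⟨q', hq', hq2⟩ := Γ.exists_adj_dist_pred hq
      have h6 := Γ.dist_succ_of_adj hq' t
      rw [SimpleGraph.dist_comm, SimpleGraph.dist_comm (u := t)] at h6
      have h7 := ih q' hq2 (by omega) (by omega)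
      have h5 := Γ.conn.dist_triangle (u := V) (v := q') (w := r)
      exact Γ.zone_up h2i hc hb htr.symm (by omega) (by omega) h7 hq'.symm
  have hBr := Γ.count_b (i - 1) (by omega) r w (by rw [SimpleGraph.dist_comm, hwr])
  have hBV := Γ.count_b i (by omega) V w hVw
  have hCt := Γ.count_c (i - 1) (by omega) t w (by rw [SimpleGraph.dist_comm, hwt])
  have hpos := Γ.c_pos (i := i - 1) (by omega) (by omega)
  rw [show i - 1 + 1 = i by omega] at hBr
  have hsub : {p | Γ.G.Adj w p ∧ Γ.G.dist r p = i} ∪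
      {p | Γ.G.Adj w p ∧ Γ.G.dist t p = i - 1 - 1} ⊆
      {p | Γ.G.Adj w p ∧ Γ.G.dist V p = i + 1} := by
    rintro p (⟨hp, h⟩ | ⟨hp, h⟩)
    · refine ⟨hp, ?_⟩
      by_contra h'
      have h1 := Γ.dist_succ_of_adj hp V
      have h1' := Γ.dist_succ_of_adj hp.symm V
      have h2 := Γ.dist_succ_of_adj hp t
      have h4 := Γ.conn.dist_triangle (u := V) (v := p) (w := t)
      rw [SimpleGraph.dist_comm (u := t), SimpleGraph.dist_comm (u := t)] at h2
      rw [SimpleGraph.dist_comm (u := r)] at h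
      rcases (show Γ.G.dist V p = i - 1 ∨ Γ.G.dist V p = i by omega) with hV | hV
      · have := key _ p hV (by omega) (by omega)
        omega
      rcases (show Γ.G.dist p t = i - 1 ∨ Γ.G.dist p t = i by omega) with ht | ht
      · have := Γ.zone_far hi h2i hc hb hV ht hVt htr h
        omega
      have hCV := Γ.count_c i (by omega) V p hV
      have hCr := Γ.count_c i (by omega) r p (by rw [SimpleGraph.dist_comm, h])
      have hss : {q | Γ.G.Adj p q ∧ Γ.G.dist V q = i - 1} ⊆
          {q | Γ.G.Adj p q ∧ Γ.G.dist r q = i - 1} := by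
        rintro q ⟨hq, hq'⟩
        refine ⟨hq, ?_⟩
        have h2 := Γ.dist_succ_of_adj hq t
        have h4 := Γ.conn.dist_triangle (u := V) (v := q) (w := t)
        rw [SimpleGraph.dist_comm (u := t), SimpleGraph.dist_comm (u := t)] at h2
        have h7 := key _ q hq' (by omega) (by omega)
        rw [SimpleGraph.dist_comm]
        by_contra h8
        have := Γ.zone_up h2i hc hb htr.symm (by omega) (by omega) h7 hq.symm
        omega
      have heq := Set.eq_of_subset_of_ncard_le hss (by omega) (Set.toFinite _)
      have hw : w ∈ {q | Γ.G.Adj p q ∧ Γ.G.dist r q = i - 1} :=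
        ⟨hp.symm, by rw [SimpleGraph.dist_comm, hwr]⟩
      rw [← heq] at hw
      have := hw.2
      omega
    · refine ⟨hp, ?_⟩
      have h1 := Γ.dist_succ_of_adj hp V
      have h2 := Γ.conn.dist_triangle (u := V) (v := p) (w := t)
      rw [SimpleGraph.dist_comm (u := t)] at h
      omega
  have hdisj : Disjoint {p | Γ.G.Adj w p ∧ Γ.G.dist r p = i}
      {p | Γ.G.Adj w p ∧ Γ.G.dist t p = i - 1 - 1} := by
    rw [Set.disjoint_left]
    rintro p ⟨hp, h⟩ ⟨-, h'⟩
    have h3 := Γ.dist_succ_of_adj htr p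
    rw [SimpleGraph.dist_comm, SimpleGraph.dist_comm (u := p)] at h3
    omega
  have := Set.ncard_le_ncard hsub (Set.toFinite _)
  rw [Set.ncard_union_eq hdisj (Set.toFinite _) (Set.toFinite _)] at this
  omega

/-- A constant stretch `[i, 2i]` of the intersection numbers extends to `i - 1`. -/
theorem zone_extend (Γ : DRG) {i : ℕ} (hi : 2 ≤ i) (h2i : 2 * i ≤ Γ.d)
    (hc : ∀ s, i ≤ s → s ≤ 2 * i → Γ.c s = Γ.c i)
    (hb : ∀ s, i ≤ s → s ≤ 2 * i → Γ.b s = Γ.b i) :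
    Γ.c (i - 1) = Γ.c i ∧ Γ.b (i - 1) = Γ.b i := by
  obtain ⟨V, w, t, hVw, hwt, hVt⟩ := Γ.exists_dist_add (n := i) (m := i - 1) (by omega)
  replace hVt : Γ.G.dist V t = 2 * i - 1 := by omega
  have hbi : Γ.b (i - 1) = Γ.b i := by
    refine le_antisymm ?_ (Γ.b_anti (by omega) (by omega))
    rw [← hb (2 * i - 1) (by omega) (by omega), ← Γ.count_b _ (by omega) V t hVt,
      ← Γ.count_b _ (by omega) w t hwt]
    refine Set.ncard_le_ncard ?_ (Set.toFinite _)
    rintro r ⟨hr, h⟩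
    refine ⟨hr, ?_⟩
    rw [Γ.zone_far hi h2i hc hb hVw hwt hVt hr (by omega)]
    omega
  refine ⟨le_antisymm (Γ.c_mono (by omega) (by omega)) ?_, hbi⟩
  rw [← hc (2 * i - 1) (by omega) (by omega), ← Γ.count_c _ (by omega) V t hVt,
      ← Γ.count_c _ (by omega) w t hwt]
  refine Set.ncard_le_ncard ?_ (Set.toFinite _)
  rintro r ⟨hr, h⟩
  refine ⟨hr, ?_⟩
  have h1 := Γ.dist_succ_of_adj hr w
  have h2 := Γ.conn.dist_triangle (u := V) (v := w) (w := r)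
  by_contra h'
  rcases (show Γ.G.dist w r = i - 1 ∨ Γ.G.dist w r = i by omega) with h3 | h3
  · exact Γ.zone_near hi h2i hc hb hbi hVw hwt hVt hr h3 (by omega)
  · have := Γ.zone_far hi h2i hc hb hVw hwt hVt hr h3
    omega

theorem a_one_le (Γ : DRG) {i : ℕ} (h1 : 1 ≤ i) (h : i < Γ.d) (hb : Γ.b i = 1) :
    Γ.a 1 ≤ Γ.a i := by
  obtain ⟨x, z, w, hxz, hzw, hxw⟩ := Γ.exists_dist_add (n := i) (m := 1) h
  rw [← Γ.count_a 1 (by omega) z w hzw, ← Γ.count_a i h.le x z hxz]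
  obtain ⟨q, hq⟩ := Set.ncard_eq_one.1 ((Γ.count_b i h.le x z hxz).trans hb)
  refine Set.ncard_le_ncard ?_ (Set.toFinite _)
  rintro p ⟨hp, hp'⟩
  have hzp := SimpleGraph.dist_eq_one_iff_adj.1 hp'
  refine ⟨hzp, ?_⟩
  have h2 := Γ.dist_succ_of_adj hp.symm x
  have h3 := Γ.dist_succ_of_adj hzp x
  by_contra h'
  have hw : w ∈ ({q} : Set Γ.X) := hq ▸ ⟨SimpleGraph.dist_eq_one_iff_adj.1 hzw, hxw⟩
  have hp2 : p ∈ ({q} : Set Γ.X) := hq ▸ ⟨hzp, by omega⟩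
  rw [Set.mem_singleton_iff] at hw hp2
  exact hp.ne (hw.trans hp2.symm)

theorem two_le_b_one (Γ : DRG) (hk : 3 ≤ Γ.b 0) (hd : 2 ≤ Γ.d) (hc : Γ.c 2 = 1) :
    2 ≤ Γ.b 1 := by
  by_contra hlt
  have hb1 : Γ.b 1 = 1 := by
    have := Γ.b_pos (i := 1) (by omega)
    omega
  obtain ⟨u, x, v, hux, hxv, huv⟩ := Γ.exists_dist_add (n := 1) (m := 1) hd
  obtain ⟨w, hw, hwu⟩ : ∃ w ∈ {z | Γ.G.Adj x z}, w ∉ ({u, v} : Set Γ.X) := by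
    refine Set.exists_mem_notMem_of_ncard_lt_ncard ?_ (Set.toFinite _)
    rw [Γ.ncard_neighbors]
    exact (Set.ncard_insert_le _ _).trans_lt (by rw [Set.ncard_singleton]; omega)
  simp only [Set.mem_insert_iff, Set.mem_singleton_iff, not_or] at hwu
  have aux : ∀ u v : Γ.X, Γ.G.dist u x = 1 → Γ.G.dist x v = 1 → Γ.G.dist u v = 1 + 1 →
      w ≠ u → w ≠ v → Γ.G.dist u w = 1 := by
    intro u v hux hxv huv h1 h2
    obtain ⟨q, hq⟩ := Set.ncard_eq_one.1 ((Γ.count_b 1 (by omega) u x hux).trans hb1)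
    have h3 := Γ.dist_succ_of_adj (show Γ.G.Adj x w from hw) u
    have h4 : Γ.G.dist u w ≠ 0 := by
      rw [Ne, Γ.conn.dist_eq_zero_iff]
      exact fun h => h1 h.symm
    by_contra h'
    have hv : v ∈ ({q} : Set Γ.X) := hq ▸ ⟨SimpleGraph.dist_eq_one_iff_adj.1 hxv, huv⟩
    have hw2 : w ∈ ({q} : Set Γ.X) := hq ▸ ⟨hw, by omega⟩
    rw [Set.mem_singleton_iff] at hv hw2
    exact h2 (hw2.trans hv.symm)
  have h1 := aux u v hux hxv huv hwu.1 hwu.2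
  have h2 := aux v u (by rw [SimpleGraph.dist_comm, hxv]) (by rw [SimpleGraph.dist_comm, hux])
    (by rw [SimpleGraph.dist_comm, huv]) hwu.2 hwu.1
  obtain ⟨q, hq⟩ := Set.ncard_eq_one.1 ((Γ.count_c 2 hd u v huv).trans hc)
  have hx2 : x ∈ ({q} : Set Γ.X) :=
    hq ▸ ⟨(SimpleGraph.dist_eq_one_iff_adj.1 hxv).symm, hux⟩
  have hw2 : w ∈ ({q} : Set Γ.X) := hq ▸ ⟨SimpleGraph.dist_eq_one_iff_adj.1 h2, h1⟩
  rw [Set.mem_singleton_iff] at hx2 hw2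
  exact (show Γ.G.Adj x w from hw).ne (hx2.trans hw2.symm)

end DRG

/-- The intersection numbers of a distance-regular graph, as bare data. -/
structure Arr where
  D : ℕ
  a : ℕ → ℕ
  b : ℕ → ℕ
  c : ℕ → ℕ

namespace Arr

/-- The squared off-diagonal entries of the symmetrised intersection matrix. -/
def bet (A : Arr) (i : ℕ) : ℕ := A.b i * A.c (i + 1)

/-- The monic orthogonal polynomials of the intersection array. -/
noncomputable def p (A : Arr) : ℕ → Polynomial ℤ
  | 0 => 1
  | 1 => Polynomial.X - Polynomial.C (A.a 0 : ℤ)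
  | n + 2 => (Polynomial.X - Polynomial.C (A.a (n + 1) : ℤ)) * A.p (n + 1) -
      Polynomial.C (A.bet n : ℤ) * A.p n

noncomputable def ev (A : Arr) (i : ℕ) (x : ℝ) : ℝ := Polynomial.aeval x (A.p i)

noncomputable def w (A : Arr) (i : ℕ) : ℝ := ∏ j ∈ Finset.range i, (A.bet j : ℝ)

noncomputable def F (A : Arr) (x : ℝ) : ℝ := ∑ i ∈ Finset.range (A.D + 1), A.ev i x ^ 2 / A.w i

theorem ev_zero (A : Arr) (x : ℝ) : A.ev 0 x = 1 := by simp [ev, p]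

theorem ev_one (A : Arr) (x : ℝ) : A.ev 1 x = x - A.a 0 := by simp [ev, p]

theorem ev_add_two (A : Arr) (n : ℕ) (x : ℝ) :
    A.ev (n + 2) x = (x - A.a (n + 1)) * A.ev (n + 1) x - A.bet n * A.ev n x := by
  simp [ev, p]

end Arr

namespace DRG

/-- The intersection array of a distance-regular graph. -/
def arr (Γ : DRG) : Arr := ⟨Γ.d, Γ.a, Γ.b, Γ.c⟩

theorem sum_adj (Γ : DRG) (g : ℕ → ℝ) (x y : Γ.X) :
    ∑ z, (if Γ.G.Adj y z then g (Γ.G.dist x z) else 0) =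
      Γ.c (Γ.G.dist x y) * g (Γ.G.dist x y - 1) + Γ.a (Γ.G.dist x y) * g (Γ.G.dist x y) +
      Γ.b (Γ.G.dist x y) * g (Γ.G.dist x y + 1) := by
  classical
  set j := Γ.G.dist x y with hj
  have key : ∀ m, ∑ z, (if Γ.G.Adj y z ∧ Γ.G.dist x z = m then g m else 0) =
      ({z | Γ.G.Adj y z ∧ Γ.G.dist x z = m}.ncard : ℝ) * g m := by
    intro m
    rw [← Finset.sum_filter, Finset.sum_const, nsmul_eq_mul, Set.ncard_eq_toFinset_card']
    congr 3
    ext z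
    simp
  rw [← Γ.count_c j (Γ.dist_le _ _) x y rfl, ← Γ.count_a j (Γ.dist_le _ _) x y rfl,
    ← Γ.count_b j (Γ.dist_le _ _) x y rfl, ← key, ← key, ← key, ← Finset.sum_add_distrib,
    ← Finset.sum_add_distrib]
  refine Finset.sum_congr rfl fun z _ => ?_
  by_cases hz : Γ.G.Adj y z
  · have h1 := Γ.dist_succ_of_adj hz x
    have h2 := Γ.dist_succ_of_adj hz.symm x
    simp only [hz, true_and, if_true]
    obtain h | h | h : (Γ.G.dist x z = j + 1) ∨ (Γ.G.dist x z = j ∧ 1 ≤ j) ∨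
        (Γ.G.dist x z = j - 1 ∧ 1 ≤ j) := by
      rcases Nat.eq_zero_or_pos j with h0 | h0
      · have hxy : x = y := Γ.conn.dist_eq_zero_iff.1 (hj ▸ h0)
        have := SimpleGraph.dist_eq_one_iff_adj.2 hz
        rw [← hxy] at this
        omega
      · omega
    · rw [h, if_neg (by omega), if_neg (by omega), if_pos rfl]
      ring
    · rw [h.1, if_neg (by omega), if_pos rfl, if_neg (by omega)]
      ring
    · rw [h.1, if_pos rfl, if_neg (by omega), if_neg (by omega)]
      ring
  · simp [hz]

section Rational

variable (Γ : DRG) (x : ℝ)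

noncomputable def kerU (i : ℕ) : ℝ := Γ.arr.ev i x / ∏ j ∈ Finset.range i, (Γ.b j : ℝ)

noncomputable def kerV (i : ℕ) : ℝ := Γ.arr.ev i x / ∏ j ∈ Finset.range i, (Γ.c (j + 1) : ℝ)

/-- A matrix in the adjacency algebra whose columns are eigenvectors for a root `x`. -/
noncomputable def kerM : Matrix Γ.X Γ.X ℝ := Matrix.of fun y z => Γ.kerU x (Γ.G.dist y z)

noncomputable def distMat (i : ℕ) : Matrix Γ.X Γ.X ℝ :=
  Matrix.of fun y z => if Γ.G.dist y z = i then 1 else 0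

theorem kerU_zero : Γ.kerU x 0 = 1 := by simp [kerU, Arr.ev_zero]

theorem kerU_rec (hx : Γ.arr.ev (Γ.d + 1) x = 0) {i : ℕ} (hi : i ≤ Γ.d) :
    Γ.c i * Γ.kerU x (i - 1) + Γ.a i * Γ.kerU x i + Γ.b i * Γ.kerU x (i + 1) =
      x * Γ.kerU x i := by
  have hb : ∀ j, j < Γ.d → (Γ.b j : ℝ) ≠ 0 := fun j hj => by
    have := Γ.b_pos hj
    positivity
  have hprod : ∀ i ≤ Γ.d, ∏ j ∈ Finset.range i, (Γ.b j : ℝ) ≠ 0 := fun i hi =>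
    Finset.prod_ne_zero_iff.2 fun j hj => hb j (by rw [Finset.mem_range] at hj; omega)
  have hlast : Γ.b i * Γ.kerU x (i + 1) =
      Γ.arr.ev (i + 1) x / ∏ j ∈ Finset.range i, (Γ.b j : ℝ) := by
    rcases hi.lt_or_eq with h | h
    · have h1 := hb i h
      have h2 := hprod i hi
      rw [kerU, Finset.prod_range_succ]
      field_simp
    · rw [h, hx, Γ.bd]
      simp
  rw [hlast]
  cases i with
  | zero =>
    have h1 := Γ.c0
    simp [kerU, Arr.ev_one, Arr.ev_zero, h1, arr]
  | succ n =>
    have h1 := hb n hi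
    have h2 := hprod n (by omega)
    rw [Arr.ev_add_two, Nat.add_sub_cancel, kerU, kerU, Finset.prod_range_succ, Arr.bet]
    simp only [arr]
    field_simp
    push_cast
    ring

theorem kerV_rec {i : ℕ} (hi : i < Γ.d) :
    Γ.c (i + 1) * Γ.kerV x (i + 1) =
      (x - Γ.a i) * Γ.kerV x i - (if i = 0 then 0 else Γ.b (i - 1) * Γ.kerV x (i - 1)) := by
  have hc : ∀ j, j < Γ.d → (Γ.c (j + 1) : ℝ) ≠ 0 := fun j hj => by
    have := Γ.c_pos (i := j + 1) (by omega) hj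
    positivity
  have hprod : ∀ i ≤ Γ.d, ∏ j ∈ Finset.range i, (Γ.c (j + 1) : ℝ) ≠ 0 := fun i hi =>
    Finset.prod_ne_zero_iff.2 fun j hj => hc j (by rw [Finset.mem_range] at hj; omega)
  cases i with
  | zero =>
    have h1 := hc 0 hi
    simp only [kerV, zero_add, Arr.ev_one, Arr.ev_zero, Finset.prod_range_one,
      Finset.prod_range_zero, if_true]
    simp only [arr]
    field_simp
    ring
  | succ n =>
    have h1 := hc n (by omega)
    have h2 := hprod n (by omega)
    have h3 := hc (n + 1) hi
    rw [kerV, kerV, kerV, Arr.ev_add_two, Nat.add_sub_cancel, Finset.prod_range_succ,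
      Finset.prod_range_succ, Arr.bet, if_neg (by omega)]
    simp only [arr]
    field_simp
    push_cast
    ring

theorem adj_mul_kerM (hx : Γ.arr.ev (Γ.d + 1) x = 0) :
    Γ.G.adjMatrix ℝ * Γ.kerM x = x • Γ.kerM x := by
  ext y z
  rw [Matrix.mul_apply, Matrix.smul_apply, smul_eq_mul, kerM, Matrix.of_apply,
    ← Γ.kerU_rec x hx (Γ.dist_le _ _), SimpleGraph.dist_comm, ← Γ.sum_adj]
  refine Finset.sum_congr rfl fun t _ => ?_
  rw [SimpleGraph.adjMatrix_apply, Matrix.of_apply, SimpleGraph.dist_comm, ite_mul, one_mul,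
    zero_mul]

theorem adj_mul_distMat (i : ℕ) : Γ.G.adjMatrix ℝ * Γ.distMat i =
    (Γ.c (i + 1) : ℝ) • Γ.distMat (i + 1) + (Γ.a i : ℝ) • Γ.distMat i +
      (if i = 0 then 0 else (Γ.b (i - 1) : ℝ) • Γ.distMat (i - 1)) := by
  ext y z
  have h := Γ.sum_adj (fun m => if m = i then 1 else 0) z y
  rw [Matrix.mul_apply]
  refine Eq.trans (Finset.sum_congr rfl fun t _ => ?_) (h.trans ?_)
  · rw [SimpleGraph.adjMatrix_apply, distMat, Matrix.of_apply, SimpleGraph.dist_comm, ite_mul,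
      one_mul, zero_mul]
  · rw [SimpleGraph.dist_comm]
    rcases Nat.eq_zero_or_pos i with rfl | hi
    · simp only [Matrix.add_apply, Matrix.smul_apply, distMat, Matrix.of_apply, smul_eq_mul]
      rcases Nat.lt_or_ge (Γ.G.dist y z) 1 with h0 | h0
      · have h0' : Γ.G.dist y z = 0 := by omega
        simp [h0', Γ.c0]
      · rcases h0.eq_or_lt with h1 | h1
        · simp [← h1]
        · simp [show Γ.G.dist y z ≠ 0 by omega, show Γ.G.dist y z ≠ 1 by omega,
            show Γ.G.dist y z - 1 ≠ 0 by omega]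
    · rw [if_neg hi.ne']
      simp only [Matrix.add_apply, Matrix.smul_apply, distMat, Matrix.of_apply, smul_eq_mul]
      set j := Γ.G.dist y z
      congr 1
      · congr 1
        · by_cases h1 : j = i + 1
          · simp [h1]
          · rw [if_neg h1, mul_zero]
            by_cases h2 : j - 1 = i
            · omega
            · simp [h2]
        · by_cases h1 : j = i
          · simp [h1]
          · simp [h1]
      · by_cases h1 : j = i - 1
        · rw [if_pos (by omega), if_pos h1, h1]
        · rw [if_neg (by omega), if_neg h1]
          simp

theorem distMat_mul_kerM (hx : Γ.arr.ev (Γ.d + 1) x = 0) (i : ℕ) (hi : i ≤ Γ.d) :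
    Γ.distMat i * Γ.kerM x = Γ.kerV x i • Γ.kerM x := by
  induction i using Nat.strong_induction_on with
  | _ i ih =>
    cases i with
    | zero =>
      have : Γ.distMat 0 = 1 := by
        ext y z
        simp [distMat, Matrix.one_apply, Γ.conn.dist_eq_zero_iff]
      rw [this, one_mul]
      simp [kerV, Arr.ev_zero]
    | succ n =>
      have hc : (Γ.c (n + 1) : ℝ) ≠ 0 := by
        have := Γ.c_pos (i := n + 1) (by omega) hi
        positivity
      have h1 := congrArg (· * Γ.kerM x) (Γ.adj_mul_distMat n)
      simp only [Matrix.mul_assoc, Matrix.add_mul, Matrix.smul_mul] at h1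
      rw [ih n (by omega) (by omega), Matrix.mul_smul, Γ.adj_mul_kerM x hx] at h1
      have h2 := Γ.kerV_rec x (i := n) (by omega)
      have h3 : (if n = 0 then 0 else (Γ.b (n - 1) : ℝ) • Γ.distMat (n - 1)) * Γ.kerM x =
          (if n = 0 then 0 else (Γ.b (n - 1) : ℝ) * Γ.kerV x (n - 1)) • Γ.kerM x := by
        split_ifs with h0
        · simp
        · rw [Matrix.smul_mul, ih (n - 1) (by omega) (by omega), smul_smul]
      rw [h3] at h1
      have h4 : (Γ.c (n + 1) : ℝ) • (Γ.distMat (n + 1) * Γ.kerM x) =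
          (Γ.c (n + 1) : ℝ) • (Γ.kerV x (n + 1) • Γ.kerM x) := by
        rw [smul_smul, h2, sub_smul, sub_mul, sub_smul, eq_sub_iff_add_eq, eq_sub_iff_add_eq,
          add_right_comm, mul_smul, mul_smul, ← h1, smul_comm]
      exact smul_right_injective _ hc h4

theorem kerM_sq (hx : Γ.arr.ev (Γ.d + 1) x = 0) :
    Γ.kerM x * Γ.kerM x = Γ.arr.F x • Γ.kerM x := by
  have hM : Γ.kerM x = ∑ i ∈ Finset.range (Γ.d + 1), Γ.kerU x i • Γ.distMat i := by
    ext y z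
    rw [Matrix.sum_apply]
    simp only [Matrix.smul_apply, distMat, Matrix.of_apply, smul_eq_mul, mul_ite, mul_one,
      mul_zero, kerM]
    rw [Finset.sum_ite_eq, if_pos]
    have := Γ.dist_le y z
    rw [Finset.mem_range]
    omega
  have h2 : Γ.kerM x * Γ.kerM x =
      (∑ i ∈ Finset.range (Γ.d + 1), Γ.kerU x i • Γ.distMat i) * Γ.kerM x := by rw [← hM]
  rw [h2, Finset.sum_mul, Arr.F, Finset.sum_smul]
  refine Finset.sum_congr rfl fun i hi => ?_
  rw [Finset.mem_range, show Γ.arr.D = Γ.d from rfl] at hi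
  rw [Matrix.smul_mul, Γ.distMat_mul_kerM x hx i (by omega), smul_smul, kerU, kerV, Arr.w,
    div_mul_div_comm, ← Finset.prod_mul_distrib, sq]
  simp [Arr.bet, arr]

end Rational

theorem F_rational (Γ : DRG) (x : ℝ) (hx : Γ.arr.ev (Γ.d + 1) x = 0) :
    ∃ q : ℚ, Γ.arr.F x = q := by
  obtain ⟨o, -⟩ := Γ.dist_eq
  have hF : Γ.arr.F x ≠ 0 := by
    have h0 : (0 : ℝ) < Γ.arr.F x := by
      rw [Arr.F]
      refine lt_of_lt_of_le one_pos ?_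
      refine le_trans ?_ (Finset.single_le_sum (f := fun i => Γ.arr.ev i x ^ 2 / Γ.arr.w i)
        (fun i _ => ?_) (Finset.mem_range.2 (Nat.succ_pos Γ.arr.D)))
      · simp [Arr.ev_zero, Arr.w]
      · exact div_nonneg (sq_nonneg _) (Finset.prod_nonneg fun j _ => by positivity)
    exact h0.ne'
  set e : Matrix Γ.X Γ.X ℝ := (Γ.arr.F x)⁻¹ • Γ.kerM x with he
  have hid : IsIdempotentElem e.toLin' := by
    rw [IsIdempotentElem, Module.End.mul_eq_comp, ← Matrix.toLin'_mul, he, Matrix.smul_mul,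
      Matrix.mul_smul, Γ.kerM_sq x hx, smul_smul (Γ.arr.F x)⁻¹ (Γ.arr.F x), inv_mul_cancel₀ hF,
      one_smul]
  have htr := (LinearMap.IsIdempotentElem.isProj_range _ hid).trace
  generalize (Module.finrank ℝ e.toLin'.range) = r at htr
  rw [Matrix.trace_toLin'_eq, he, Matrix.trace_smul] at htr
  have h1 : Matrix.trace (Γ.kerM x) = Fintype.card Γ.X := by
    simp [Matrix.trace, kerM, kerU_zero]
  rw [h1] at htr
  refine ⟨(Fintype.card Γ.X : ℚ) / r, ?_⟩
  have hX : (Fintype.card Γ.X : ℝ) ≠ 0 := by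
    have := Fintype.card_pos_iff.2 ⟨o⟩
    positivity
  rw [smul_eq_mul] at htr
  have hr : (r : ℝ) ≠ 0 := by
    rw [← htr]
    exact mul_ne_zero (inv_ne_zero hF) hX
  push_cast
  rw [← htr]
  field_simp

end DRG

namespace Arr

/-- The properties of the intersection array of a distance-regular graph of diameter at least
two and valency at least three that are used in the sequel. -/
structure Reg (A : Arr) : Prop where
  sum : ∀ i ≤ A.D, A.c i + A.a i + A.b i = A.b 0
  c_zero : A.c 0 = 0
  c_one : A.c 1 = 1
  b_last : A.b A.D = 0
  b_pos : ∀ i < A.D, 1 ≤ A.b i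
  c_pos : ∀ i, 1 ≤ i → i ≤ A.D → 1 ≤ A.c i
  c_mono : ∀ i j, i ≤ j → j ≤ A.D → A.c i ≤ A.c j
  b_anti : ∀ i j, i ≤ j → j ≤ A.D → A.b j ≤ A.b i
  zone : ∀ i, 2 ≤ i → 2 * i ≤ A.D → (∀ s, i ≤ s → s ≤ 2 * i → A.c s = A.c i) →
    (∀ s, i ≤ s → s ≤ 2 * i → A.b s = A.b i) → A.c (i - 1) = A.c i ∧ A.b (i - 1) = A.b i
  tail : ∀ i, 1 ≤ i → i < A.D → A.b i = 1 → A.a 1 ≤ A.a i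
  b_one : A.c 2 = 1 → 2 ≤ A.b 1
  rat : ∀ x, A.ev (A.D + 1) x = 0 → ∃ q : ℚ, A.F x = q
  three_le : 3 ≤ A.b 0
  two_le : 2 ≤ A.D

/-- `[1, h]` is the maximal initial stretch of constant intersection numbers. -/
structure Head (A : Arr) (h : ℕ) : Prop where
  one_le : 1 ≤ h
  lt : h < A.D
  c_eq : ∀ i, 1 ≤ i → i ≤ h → A.c i = 1
  b_eq : ∀ i, 1 ≤ i → i ≤ h → A.b i = A.b 1
  ne : ¬ (A.c (h + 1) = 1 ∧ A.b (h + 1) = A.b 1)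

theorem Reg.exists_head {A : Arr} (hA : A.Reg) : ∃ h, A.Head h := by
  classical
  have hD := hA.two_le
  have hb1 := hA.b_pos 1 (by omega)
  have hex : ∃ n, 1 ≤ n ∧ ¬ (A.c (n + 1) = 1 ∧ A.b (n + 1) = A.b 1) :=
    ⟨A.D - 1, by omega, by
      rw [show A.D - 1 + 1 = A.D by omega, hA.b_last]
      omega⟩
  refine ⟨Nat.find hex, (Nat.find_spec hex).1, ?_, ?_, ?_, (Nat.find_spec hex).2⟩
  · have := Nat.find_min' hex (m := A.D - 1) ⟨by omega, by
      rw [show A.D - 1 + 1 = A.D by omega, hA.b_last]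
      omega⟩
    omega
  all_goals
    intro i h1 h2
    obtain rfl | h3 := h1.eq_or_lt
    · first | exact hA.c_one | rfl
    have := Nat.find_min hex (m := i - 1) (by omega)
    rw [show i - 1 + 1 = i by omega] at this
    have h4 := not_not.1 (fun h => this ⟨by omega, h⟩)
    first | exact h4.1 | exact h4.2

theorem Reg.lt_two_pow {A : Arr} (hA : A.Reg) (n : ℕ) : ∀ i, 2 ≤ i → i ≤ A.D →
    2 * A.b 0 ≤ A.c i + (A.b 0 - A.b i) + n →
    ¬ (A.c (i - 1) = A.c i ∧ A.b (i - 1) = A.b i) → A.D < 2 ^ (n + 1) * i := by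
  induction n with
  | zero =>
    intro i h2 hi hn hne
    by_contra! hlt
    refine hne (hA.zone i h2 (by omega) ?_ ?_) <;> intro s hs hs2 <;>
      have h1 := hA.c_mono i s hs (by omega) <;> have h3 := hA.b_anti i s hs (by omega) <;>
      have h4 := hA.sum s (by omega) <;> have h5 := hA.sum i (by omega) <;> omega
  | succ n ih =>
    intro i h2 hi hn hne
    by_contra! hlt
    have h2i : 2 * i ≤ A.D := by
      refine le_trans ?_ hlt
      gcongr
      exact le_self_pow₀ (by norm_num) (by omega)
    have hex : ∃ s, i < s ∧ s ≤ 2 * i ∧ ¬ (A.c (s - 1) = A.c s ∧ A.b (s - 1) = A.b s) := by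
      by_contra! hall
      have key : ∀ s, i ≤ s → s ≤ 2 * i → A.c s = A.c i ∧ A.b s = A.b i := by
        intro s hs
        induction s, hs using Nat.le_induction with
        | base => exact fun _ => ⟨rfl, rfl⟩
        | succ s hs ih =>
          intro hs2
          have h1 := hall (s + 1) (by omega) hs2
          rw [Nat.add_sub_cancel] at h1
          obtain ⟨h3, h4⟩ := ih (by omega)
          exact ⟨h1.1.symm.trans h3, h1.2.symm.trans h4⟩
      exact hne (hA.zone i h2 h2i (fun s h3 h4 => (key s h3 h4).1) fun s h3 h4 => (key s h3 h4).2)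
    obtain ⟨s, h3, h4, h5⟩ := hex
    have h6 := hA.c_mono i (s - 1) (by omega) (by omega)
    have h7 := hA.b_anti i (s - 1) (by omega) (by omega)
    have h8 := hA.c_mono (s - 1) s (by omega) (by omega)
    have h9 := hA.b_anti (s - 1) s (by omega) (by omega)
    have h10 := hA.sum i hi
    have := ih s (by omega) (by omega) (by omega) h5
    have h11 : 2 ^ (n + 1) * s ≤ 2 ^ (n + 1) * (2 * i) := by gcongr
    rw [pow_succ 2 (n + 1), mul_assoc] at hlt
    omega

theorem Head.D_lt {A : Arr} {h : ℕ} (hh : A.Head h) (hA : A.Reg) :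
    A.D < 2 ^ (2 * A.b 0 + 1) * (h + 1) := by
  have h1 := hh.one_le
  have h2 := hh.lt
  refine hA.lt_two_pow _ (h + 1) (by omega) (by omega) (by omega) ?_
  rw [Nat.add_sub_cancel, hh.c_eq h h1 le_rfl, hh.b_eq h h1 le_rfl]
  exact fun h => hh.ne ⟨h.1.symm, h.2.symm⟩

end Arr

theorem DRG.reg (Γ : DRG) (hk : 3 ≤ Γ.b 0) (hd : 2 ≤ Γ.d) : Γ.arr.Reg where
  sum i hi := Γ.sum_eq hi
  c_zero := Γ.c0
  c_one := Γ.c_one (by omega)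
  b_last := Γ.bd
  b_pos i hi := Γ.b_pos hi
  c_pos i h1 hi := Γ.c_pos h1 hi
  c_mono i j h1 h2 := Γ.c_mono h1 h2
  b_anti i j h1 h2 := Γ.b_anti h1 h2
  zone i h1 h2 h3 h4 := Γ.zone_extend h1 h2 h3 h4
  tail i h1 h2 h3 := Γ.a_one_le h1 h2 h3
  b_one h := Γ.two_le_b_one hk hd h
  rat x hx := Γ.F_rational x hx
  three_le := hk
  two_le := hd

namespace Arr

/-- The orthonormal polynomials of the intersection array. -/
noncomputable def e (A : Arr) (i : ℕ) (x : ℝ) : ℝ := A.ev i x / √(A.w i)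

section Spectral

variable {A : Arr}

theorem Reg.bet_pos (hA : A.Reg) {i : ℕ} (hi : i < A.D) : 1 ≤ A.bet i := by
  have h1 := hA.b_pos i hi
  have h2 := hA.c_pos (i + 1) (by omega) (by omega)
  exact Nat.one_le_iff_ne_zero.2 (Nat.mul_ne_zero (by omega) (by omega))

theorem Reg.bet_last (hA : A.Reg) : A.bet A.D = 0 := by simp [bet, hA.b_last]

theorem Reg.w_pos (hA : A.Reg) {i : ℕ} (hi : i ≤ A.D) : 0 < A.w i := by
  refine Finset.prod_pos fun j hj => ?_
  have := hA.bet_pos (i := j) (by have := Finset.mem_range.1 hj; omega)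
  exact_mod_cast this

theorem w_succ (A : Arr) (i : ℕ) : A.w (i + 1) = A.w i * A.bet i := Finset.prod_range_succ _ _

theorem w_zero (A : Arr) : A.w 0 = 1 := Finset.prod_range_zero _

theorem w_nonneg (A : Arr) (i : ℕ) : 0 ≤ A.w i := Finset.prod_nonneg fun _ _ => Nat.cast_nonneg _

theorem e_zero (A : Arr) (x : ℝ) : A.e 0 x = 1 := by simp [e, ev_zero, w_zero]

theorem e_sq (A : Arr) (i : ℕ) (x : ℝ) : A.e i x ^ 2 = A.ev i x ^ 2 / A.w i := by
  rw [e, div_pow, Real.sq_sqrt (A.w_nonneg i)]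

theorem F_eq (A : Arr) (x : ℝ) : A.F x = ∑ i ∈ Finset.range (A.D + 1), A.e i x ^ 2 := by
  simp only [e_sq, F]

theorem one_le_F (A : Arr) (x : ℝ) : 1 ≤ A.F x := by
  rw [F_eq]
  refine le_trans ?_ (Finset.single_le_sum (f := fun i => A.e i x ^ 2)
    (fun i _ => sq_nonneg _) (Finset.mem_range.2 (Nat.succ_pos A.D)))
  simp [e_zero]

theorem sqrt_w_succ (A : Arr) (i : ℕ) : √(A.w (i + 1)) = √(A.w i) * √(A.bet i : ℝ) := by
  rw [w_succ, Real.sqrt_mul (A.w_nonneg i)]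

theorem Reg.sqrt_mul_e_one (hA : A.Reg) (x : ℝ) :
    √(A.bet 0 : ℝ) * A.e 1 x = (x - A.a 0) * A.e 0 x := by
  have h0 : (0 : ℝ) < √(A.bet 0 : ℝ) := Real.sqrt_pos.2 (by
    exact_mod_cast hA.bet_pos (by have := hA.two_le; omega))
  rw [e_zero, e, ev_one, sqrt_w_succ, w_zero, Real.sqrt_one]
  field_simp

theorem Reg.sqrt_mul_e (hA : A.Reg) (x : ℝ) {n : ℕ} (hn : n + 2 ≤ A.D) :
    √(A.bet (n + 1) : ℝ) * A.e (n + 2) x =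
      (x - A.a (n + 1)) * A.e (n + 1) x - √(A.bet n : ℝ) * A.e n x := by
  have h0 : (0 : ℝ) < √(A.bet n : ℝ) := Real.sqrt_pos.2 (by
    exact_mod_cast hA.bet_pos (by omega))
  have h1 : (0 : ℝ) < √(A.bet (n + 1) : ℝ) := Real.sqrt_pos.2 (by
    exact_mod_cast hA.bet_pos (by omega))
  have h2 : (0 : ℝ) < √(A.w n) := Real.sqrt_pos.2 (hA.w_pos (by omega))
  have h3 : (A.bet n : ℝ) = √(A.bet n : ℝ) ^ 2 := (Real.sq_sqrt (Nat.cast_nonneg _)).symm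
  rw [e, e, e, ev_add_two, sqrt_w_succ, sqrt_w_succ]
  nth_rw 1 [h3]
  field_simp

/-- An eigenvector of the symmetrised intersection matrix is a multiple of `e`. -/
theorem Reg.eq_mul_e (hA : A.Reg) {x : ℝ} {v : ℕ → ℝ}
    (h0 : √(A.bet 0 : ℝ) * v 1 + A.a 0 * v 0 = x * v 0)
    (h : ∀ n, n + 1 ≤ A.D → √(A.bet (n + 1) : ℝ) * v (n + 2) + A.a (n + 1) * v (n + 1) +
      √(A.bet n : ℝ) * v n = x * v (n + 1)) :
    (∀ i ≤ A.D, v i = v 0 * A.e i x) ∧ v 0 * A.ev (A.D + 1) x = 0 := by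
  have h1 : ∀ i, (i ≤ A.D → v i = v 0 * A.e i x) ∧ (i + 1 ≤ A.D → v (i + 1) = v 0 * A.e (i + 1) x) := by
    intro i
    induction i with
    | zero =>
      refine ⟨fun _ => by rw [e_zero, mul_one], fun h2 => ?_⟩
      have h3 : (0 : ℝ) < √(A.bet 0 : ℝ) := Real.sqrt_pos.2 (by
        exact_mod_cast hA.bet_pos (by omega))
      have h4 := hA.sqrt_mul_e_one x
      rw [e_zero] at h4
      refine mul_left_cancel₀ h3.ne' ?_
      linear_combination h0 - v 0 * h4
    | succ n ih =>
      refine ⟨ih.2, fun h2 => ?_⟩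
      have h3 : (0 : ℝ) < √(A.bet (n + 1) : ℝ) := Real.sqrt_pos.2 (by
        exact_mod_cast hA.bet_pos (by omega))
      have h4 := hA.sqrt_mul_e x h2
      have h5 := h n (by omega)
      rw [ih.1 (by omega), ih.2 (by omega)] at h5
      refine mul_left_cancel₀ h3.ne' ?_
      linear_combination h5 - v 0 * h4
  refine ⟨fun i => (h1 i).1, ?_⟩
  obtain ⟨n, hn⟩ : ∃ n, A.D = n + 1 := ⟨A.D - 1, by have := hA.two_le; omega⟩
  have h5 := h n (by omega)
  rw [(h1 n).1 (by omega), (h1 n).2 (by omega), ← hn, hA.bet_last, hn] at h5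
  have h2 : (0 : ℝ) < √(A.w n) := Real.sqrt_pos.2 (hA.w_pos (by omega))
  have h3 : (0 : ℝ) < √(A.bet n : ℝ) := Real.sqrt_pos.2 (by
    exact_mod_cast hA.bet_pos (by omega))
  have h4 : (A.bet n : ℝ) = √(A.bet n : ℝ) ^ 2 := (Real.sq_sqrt (Nat.cast_nonneg _)).symm
  rw [hn, ev_add_two]
  rw [e, e, sqrt_w_succ] at h5
  simp only [Nat.cast_zero, Real.sqrt_zero, zero_mul, zero_add] at h5
  field_simp at h5
  nth_rw 1 [h4]
  linear_combination -h5

/-- The symmetrised intersection matrix. -/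
noncomputable def jacobi (A : Arr) : Matrix (Fin (A.D + 1)) (Fin (A.D + 1)) ℝ :=
  Matrix.of fun i j => (if (j : ℕ) = i + 1 then √(A.bet i : ℝ) else 0) +
    (if (j : ℕ) = i then (A.a i : ℝ) else 0) + if (i : ℕ) = j + 1 then √(A.bet j : ℝ) else 0

theorem jacobi_isHermitian (A : Arr) : A.jacobi.IsHermitian := by
  ext i j
  simp only [jacobi, Matrix.conjTranspose_apply, Matrix.of_apply, star_trivial]
  by_cases h : (i : ℕ) = j
  · simp [h]
  · simp only [h, Ne.symm h, if_false, add_zero]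
    ring

theorem jacobi_mulVec (A : Arr) (v : ℕ → ℝ) (hv : v (A.D + 1) = 0) (i : Fin (A.D + 1)) :
    (A.jacobi *ᵥ fun j => v j) i = √(A.bet i : ℝ) * v (i + 1) + A.a i * v i +
      if (i : ℕ) = 0 then 0 else √(A.bet (i - 1) : ℝ) * v (i - 1) := by
  have hi := i.2
  rw [Matrix.mulVec, dotProduct]
  simp only [jacobi, Matrix.of_apply]
  rw [Fin.sum_univ_eq_sum_range (fun j => ((if j = (i : ℕ) + 1 then √(A.bet i : ℝ) else 0) +
    (if j = (i : ℕ) then (A.a i : ℝ) else 0) + if (i : ℕ) = j + 1 then √(A.bet j : ℝ) else 0) * v j)]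
  simp only [add_mul, Finset.sum_add_distrib, ite_mul, zero_mul, Finset.sum_ite_eq',
    Finset.mem_range]
  congr 1
  · congr 1
    · split_ifs with h
      · rfl
      · rw [show (i : ℕ) + 1 = A.D + 1 by omega, hv, mul_zero]
    · rw [if_pos hi]
  · split_ifs with h
    · exact Finset.sum_eq_zero fun j _ => if_neg (by omega)
    · rw [Finset.sum_eq_single ((i : ℕ) - 1)]
      · rw [if_pos (by omega)]
      · intro j _ hj
        exact if_neg (by omega)
      · intro h'
        exact absurd (Finset.mem_range.2 (by omega)) h'

/-- Parseval's identity for the orthonormal polynomials, together with the fact that the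
`D + 1` nodes are the roots of the characteristic polynomial. -/
theorem Reg.parseval (hA : A.Reg) : ∃ S : Finset ℝ, S.card = A.D + 1 ∧
    (∀ x ∈ S, A.ev (A.D + 1) x = 0) ∧ ∀ φ : ℕ → ℝ,
    ∑ x ∈ S, (∑ i ∈ Finset.range (A.D + 1), A.e i x * φ i) ^ 2 / A.F x =
      ∑ i ∈ Finset.range (A.D + 1), φ i ^ 2 := by
  classical
  set H := A.jacobi_isHermitian
  set B := H.eigenvectorBasis
  set l := H.eigenvalues
  have hext : ∀ j, ∃ v : ℕ → ℝ, v (A.D + 1) = 0 ∧ ∀ i : Fin (A.D + 1), (B j).ofLp i = v i := by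
    intro j
    refine ⟨fun i => if h : i < A.D + 1 then (B j).ofLp ⟨i, h⟩ else 0, by simp,
      fun i => by simp [i.2]⟩
  choose v hv0 hv using hext
  have hvec : ∀ j, (∀ i ≤ A.D, v j i = v j 0 * A.e i (l j)) ∧
      v j 0 * A.ev (A.D + 1) (l j) = 0 := by
    intro j
    have h1 := H.mulVec_eigenvectorBasis j
    have h2 : (B j).ofLp = fun i : Fin (A.D + 1) => v j i := funext (hv j)
    have h3 : ∀ i : Fin (A.D + 1), √(A.bet i : ℝ) * v j (i + 1) + A.a i * v j i +
        (if (i : ℕ) = 0 then 0 else √(A.bet (i - 1) : ℝ) * v j (i - 1)) = l j * v j i := by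
      intro i
      rw [← A.jacobi_mulVec (v j) (hv0 j) i, ← h2, h1, Pi.smul_apply, smul_eq_mul, hv]
    refine hA.eq_mul_e ?_ fun n hn => ?_
    · simpa using h3 0
    · simpa using h3 ⟨n + 1, by omega⟩
  have hin : ∀ j (φ : ℕ → ℝ), inner ℝ (B j) (WithLp.toLp 2 fun i : Fin (A.D + 1) => φ i) =
      v j 0 * ∑ i ∈ Finset.range (A.D + 1), A.e i (l j) * φ i := by
    intro j φ
    rw [EuclideanSpace.inner_eq_star_dotProduct, dotProduct, Finset.mul_sum,
      ← Fin.sum_univ_eq_sum_range (fun i => v j 0 * (A.e i (l j) * φ i))]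
    refine Finset.sum_congr rfl fun i _ => ?_
    rw [Pi.star_apply, star_trivial, hv, (hvec j).1 i (by omega)]
    ring
  have hnorm : ∀ j, v j 0 ^ 2 * A.F (l j) = 1 := by
    intro j
    have h1 := EuclideanSpace.real_norm_sq_eq (B j)
    rw [B.norm_eq_one, one_pow] at h1
    rw [h1, F_eq, Finset.mul_sum, ← Fin.sum_univ_eq_sum_range (fun i => v j 0 ^ 2 * A.e i (l j) ^ 2)]
    refine Finset.sum_congr rfl fun i _ => ?_
    rw [hv, (hvec j).1 i (by omega)]
    ring
  have hv00 : ∀ j, v j 0 ≠ 0 := fun j h => by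
    have := hnorm j
    rw [h] at this
    simp at this
  have hinj : Function.Injective l := by
    intro j j' hjj
    by_contra hne
    have h1 : inner ℝ (B j) (B j') = 0 := B.orthonormal.2 hne
    have h2 : B j' = WithLp.toLp 2 fun i : Fin (A.D + 1) => v j' i := by
      ext i
      exact hv j' i
    rw [h2, hin j (v j')] at h1
    have h3 : ∑ i ∈ Finset.range (A.D + 1), A.e i (l j) * v j' i = v j' 0 * A.F (l j') := by
      rw [F_eq, Finset.mul_sum]
      refine Finset.sum_congr rfl fun i hi => ?_
      rw [(hvec j').1 i (by have := Finset.mem_range.1 hi; omega), hjj]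
      ring
    rw [h3] at h1
    have := A.one_le_F (l j')
    exact mul_ne_zero (hv00 j) (mul_ne_zero (hv00 j') (by linarith)) h1
  refine ⟨Finset.univ.image l, ?_, ?_, fun φ => ?_⟩
  · rw [Finset.card_image_of_injective _ hinj, Finset.card_univ, Fintype.card_fin]
  · intro x hx
    obtain ⟨j, _, rfl⟩ := Finset.mem_image.1 hx
    exact (mul_eq_zero.1 (hvec j).2).resolve_left (hv00 j)
  · rw [Finset.sum_image fun _ _ _ _ h => hinj h]
    have h1 := B.sum_sq_inner_right (WithLp.toLp 2 fun i : Fin (A.D + 1) => φ i)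
    rw [EuclideanSpace.real_norm_sq_eq] at h1
    rw [← Fin.sum_univ_eq_sum_range (fun i => φ i ^ 2), ← h1]
    refine Finset.sum_congr rfl fun j _ => ?_
    rw [hin, mul_pow]
    have h2 := A.one_le_F (l j)
    have h3 := hnorm j
    rw [div_eq_iff (by linarith)]
    linear_combination (-(∑ i ∈ Finset.range (A.D + 1), A.e i (l j) * φ i) ^ 2) * h3

end Spectral

end Arr

namespace Arr

variable {A : Arr}

theorem p_monic (A : Arr) : ∀ n, (A.p n).Monic ∧ (A.p n).natDegree = n := by
  have h : ∀ n, ((A.p n).Monic ∧ (A.p n).natDegree = n) ∧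
      (A.p (n + 1)).Monic ∧ (A.p (n + 1)).natDegree = n + 1 := by
    intro n
    induction n with
    | zero => exact ⟨⟨Polynomial.monic_one, Polynomial.natDegree_one⟩,
        Polynomial.monic_X_sub_C _, Polynomial.natDegree_X_sub_C _⟩
    | succ n ih =>
      refine ⟨ih.2, ?_⟩
      have h1 := (Polynomial.monic_X_sub_C (A.a (n + 1) : ℤ)).mul ih.2.1
      have h2 : ((Polynomial.X - Polynomial.C (A.a (n + 1) : ℤ)) * A.p (n + 1)).natDegree =
          n + 2 := by
        rw [(Polynomial.monic_X_sub_C (A.a (n + 1) : ℤ)).natDegree_mul ih.2.1,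
          Polynomial.natDegree_X_sub_C, ih.2.2]
        ring
      have h3 : (Polynomial.C (A.bet n : ℤ) * A.p n).natDegree < n + 2 :=
        lt_of_le_of_lt (Polynomial.natDegree_C_mul_le _ _) (by rw [ih.1.2]; omega)
      have h4 : (Polynomial.C (A.bet n : ℤ) * A.p n).degree <
          ((Polynomial.X - Polynomial.C (A.a (n + 1) : ℤ)) * A.p (n + 1)).degree := by
        rw [Polynomial.degree_eq_natDegree h1.ne_zero, h2]
        exact lt_of_le_of_lt Polynomial.degree_le_natDegree (by exact_mod_cast h3)
      rw [p]
      refine ⟨h1.sub_of_left h4, ?_⟩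
      rw [Polynomial.natDegree_sub_eq_left_of_natDegree_lt (by rw [h2]; exact h3), h2]
  exact fun n => (h n).1

/-- The eigenvalues. -/
noncomputable def nodes (A : Arr) : Finset ℝ :=
  ((A.p (A.D + 1)).map (Int.castRingHom ℝ)).roots.toFinset

theorem mem_nodes {x : ℝ} : x ∈ A.nodes ↔ A.ev (A.D + 1) x = 0 := by
  have h := ((A.p_monic (A.D + 1)).1.map (Int.castRingHom ℝ)).ne_zero
  rw [nodes, Multiset.mem_toFinset, Polynomial.mem_roots h, Polynomial.IsRoot.def,
    Polynomial.eval_map, ev, Polynomial.aeval_def]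
  rfl

theorem card_roots_le (A : Arr) :
    ((A.p (A.D + 1)).map (Int.castRingHom ℝ)).roots.card ≤ A.D + 1 := by
  refine (Polynomial.card_roots' _).trans ?_
  rw [(A.p_monic (A.D + 1)).1.natDegree_map, (A.p_monic (A.D + 1)).2]

theorem Reg.nodes_spec (hA : A.Reg) : A.nodes.card = A.D + 1 ∧ ∀ φ : ℕ → ℝ,
    ∑ x ∈ A.nodes, (∑ i ∈ Finset.range (A.D + 1), A.e i x * φ i) ^ 2 / A.F x =
      ∑ i ∈ Finset.range (A.D + 1), φ i ^ 2 := by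
  obtain ⟨S, h1, h2, h3⟩ := hA.parseval
  have h4 : S = A.nodes := by
    refine Finset.eq_of_subset_of_card_le (fun x hx => mem_nodes.2 (h2 x hx)) ?_
    rw [h1]
    exact (Multiset.toFinset_card_le _).trans A.card_roots_le
  rw [← h4]
  exact ⟨h1, h3⟩

/-- The eigenvalues are simple and real. -/
theorem Reg.roots_eq (hA : A.Reg) :
    ((A.p (A.D + 1)).map (Int.castRingHom ℝ)).roots = A.nodes.val ∧
    ((A.p (A.D + 1)).map (Int.castRingHom ℝ)).Splits := by
  have h1 := hA.nodes_spec.1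
  have h2 := A.card_roots_le
  have h3 : ((A.p (A.D + 1)).map (Int.castRingHom ℝ)).roots.card = A.D + 1 :=
    le_antisymm h2 (h1.ge.trans (Multiset.toFinset_card_le _))
  refine ⟨?_, ?_⟩
  · have : A.nodes.val ≤ ((A.p (A.D + 1)).map (Int.castRingHom ℝ)).roots :=
      Multiset.dedup_le _
    exact (Multiset.eq_of_le_of_card_le this (by rw [h3]; exact h1.ge)).symm
  · rw [Polynomial.splits_iff_card_roots, h3, (A.p_monic (A.D + 1)).1.natDegree_map,
      (A.p_monic (A.D + 1)).2]

theorem Reg.abs_le (hA : A.Reg) {x : ℝ} (hx : A.ev (A.D + 1) x = 0) : |x| ≤ A.b 0 := by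
  set B : ℕ → ℝ := fun i => ∏ j ∈ Finset.range i, (A.b j : ℝ) with hB
  have hB0 : ∀ i ≤ A.D, B i ≠ 0 := fun i hi => Finset.prod_ne_zero_iff.2 fun j hj => by
    have := hA.b_pos j (by have := Finset.mem_range.1 hj; omega)
    exact_mod_cast (by omega : A.b j ≠ 0)
  have hBs : ∀ i, B (i + 1) = B i * A.b i := fun i => Finset.prod_range_succ _ _
  set u : ℕ → ℝ := fun i => A.ev i x / B i with hu
  have hrec : ∀ i ≤ A.D, x * u i = A.c i * u (i - 1) + A.a i * u i + A.b i * u (i + 1) := by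
    intro i hi
    rcases i with _ | n
    · have h1 : (A.b 0 : ℝ) ≠ 0 := by
        have := hA.three_le
        exact_mod_cast (by omega : A.b 0 ≠ 0)
      have : B 0 = 1 := Finset.prod_range_zero _
      have h2 : u 1 = (x - A.a 0) / A.b 0 := by
        simp only [hu]
        rw [ev_one, hBs 0, this, one_mul]
      have h3 : u 0 = 1 := by simp only [hu, ev_zero, this, div_one]
      rw [h2, h3, hA.c_zero]
      field_simp
      push_cast
      ring
    · have h0 := hB0 n (by omega)
      have h1 : (A.b n : ℝ) ≠ 0 := by
        have := hA.b_pos n (by omega)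
        exact_mod_cast (by omega : A.b n ≠ 0)
      rw [Nat.add_sub_cancel]
      have h2 := A.ev_add_two n x
      have h3 : (A.bet n : ℝ) = A.b n * A.c (n + 1) := by simp [bet]
      by_cases h4 : n + 1 = A.D
      · have h6 : A.ev (n + 2) x = 0 := by rw [← hx, ← h4]
        have h7 : A.b (n + 1) = 0 := by rw [h4, hA.b_last]
        rw [h6, h3] at h2
        simp only [hu, hBs]
        rw [h7, Nat.cast_zero, zero_mul, add_zero]
        field_simp
        linear_combination -h2
      · have h5 : (A.b (n + 1) : ℝ) ≠ 0 := by
          have := hA.b_pos (n + 1) (by omega)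
          exact_mod_cast (by omega : A.b (n + 1) ≠ 0)
        simp only [hu, hBs]
        rw [h2, h3]
        field_simp
        ring
  obtain ⟨i, hi, hmax⟩ := Finset.exists_max_image (Finset.range (A.D + 1)) (fun i => |u i|)
    ⟨0, Finset.mem_range.2 (Nat.succ_pos _)⟩
  have hi' : i ≤ A.D := by have := Finset.mem_range.1 hi; omega
  have hpos : 0 < |u i| := by
    have := hmax 0 (Finset.mem_range.2 (Nat.succ_pos _))
    have h0 : u 0 = 1 := by simp [hu, hB, ev_zero]
    simp only [h0, abs_one] at this
    linarith
  have hl : (A.c i : ℝ) * |u (i - 1)| ≤ A.c i * |u i| :=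
    mul_le_mul_of_nonneg_left (hmax _ (Finset.mem_range.2 (by omega))) (Nat.cast_nonneg _)
  have hr : (A.b i : ℝ) * |u (i + 1)| ≤ A.b i * |u i| := by
    by_cases h : i = A.D
    · rw [h, hA.b_last]; simp
    · exact mul_le_mul_of_nonneg_left (hmax _ (Finset.mem_range.2 (by omega))) (Nat.cast_nonneg _)
  have h1 : |x| * |u i| ≤ A.b 0 * |u i| := by
    rw [← abs_mul, hrec i hi']
    have hs : (A.c i : ℝ) + A.a i + A.b i = A.b 0 := by exact_mod_cast hA.sum i hi'
    calc _ ≤ |A.c i * u (i - 1)| + |A.a i * u i| + |A.b i * u (i + 1)| := abs_add_three _ _ _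
      _ = A.c i * |u (i - 1)| + A.a i * |u i| + A.b i * |u (i + 1)| := by
        simp only [abs_mul, Nat.abs_cast]
      _ ≤ A.c i * |u i| + A.a i * |u i| + A.b i * |u i| := by linarith
      _ = _ := by rw [← hs]; ring
  exact le_of_mul_le_mul_right h1 hpos

theorem Reg.parseval_subset (hA : A.Reg) {T : Finset ℕ} (hT : ∀ i ∈ T, i ≤ A.D) (φ : ℕ → ℝ) :
    ∑ x ∈ A.nodes, (∑ i ∈ T, A.e i x * φ i) ^ 2 / A.F x = ∑ i ∈ T, φ i ^ 2 := by
  classical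
  have hT' : Finset.range (A.D + 1) ∩ T = T :=
    Finset.inter_eq_right.2 fun i hi => Finset.mem_range.2 (Nat.lt_succ_of_le (hT i hi))
  have h := hA.nodes_spec.2 (fun i => if i ∈ T then φ i else 0)
  simpa only [mul_ite, mul_zero, ite_pow, ne_eq, OfNat.ofNat_ne_zero, not_false_eq_true, zero_pow,
    Finset.sum_ite_mem, hT'] using h

theorem Reg.parseval_pair (hA : A.Reg) {u : ℕ} (hu : u + 1 ≤ A.D) (r s : ℝ) :
    ∑ x ∈ A.nodes, (A.e u x * r + A.e (u + 1) x * s) ^ 2 / A.F x = r ^ 2 + s ^ 2 := by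
  have h := hA.parseval_subset (T := {u, u + 1}) (by
    intro i hi
    simp only [Finset.mem_insert, Finset.mem_singleton] at hi
    omega) (fun i => if i = u then r else s)
  simpa [Finset.sum_pair] using h

/-- Summation by parts of a solution of the constant recurrence against a plane wave. -/
theorem window_telescope {f φ : ℕ → ℝ} {y z β : ℝ} {u W : ℕ}
    (hf : ∀ i, u ≤ i → i < u + W → β * (f (i + 2) + f i) = y * f (i + 1))
    (hφ : ∀ i, β * (φ (i + 2) + φ i) = z * φ (i + 1)) :
    (y - z) * ∑ j ∈ Finset.range W, f (u + 1 + j) * φ (u + 1 + j) =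
      β * (f (u + W + 1) * φ (u + W) - f (u + W) * φ (u + W + 1)) -
      β * (f (u + 1) * φ u - f u * φ (u + 1)) := by
  induction W with
  | zero => simp
  | succ n ih =>
    rw [Finset.sum_range_succ, mul_add, ih fun i h1 h2 => hf i h1 (by omega)]
    have h1 := hf (u + n) (by omega) (by omega)
    have h2 := hφ (u + n)
    rw [show u + 1 + n = u + n + 1 by ring, show u + (n + 1) = u + n + 1 by ring,
      show u + n + 1 + 1 = u + n + 2 by ring]
    linear_combination -φ (u + n + 1) * h1 + f (u + n + 1) * h2

theorem Reg.e_rec (hA : A.Reg) {a β i : ℕ} (hi : i + 2 ≤ A.D) (ha : A.a (i + 1) = a)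
    (h1 : A.bet i = β) (h2 : A.bet (i + 1) = β) (x : ℝ) :
    √(β : ℝ) * (A.e (i + 2) x + A.e i x) = (x - a) * A.e (i + 1) x := by
  have h := hA.sqrt_mul_e x hi
  rw [ha, h1, h2] at h
  linarith

theorem Reg.window (hA : A.Reg) {a β u W : ℕ} {α δ : ℝ} (hδ : 0 < δ) (hW : u + W + 1 ≤ A.D)
    (hW' : 16 * β ≤ δ ^ 2 * W) (hW0 : 0 < W)
    (ha : ∀ i, u + 1 ≤ i → i ≤ u + W → A.a i = a)
    (hb : ∀ i, u ≤ i → i ≤ u + W → A.bet i = β) :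
    1 / 2 ≤ ∑ x ∈ A.nodes with |x - (a + 2 * √(β : ℝ) * Real.cos α)| ≤ δ,
      (∑ j ∈ Finset.range W, A.e (u + 1 + j) x ^ 2) / A.F x := by
  set xs : ℝ := a + 2 * √(β : ℝ) * Real.cos α with hxs
  have hFp : ∀ x, 0 < A.F x := fun x => lt_of_lt_of_le one_pos (A.one_le_F x)
  have key : ∀ φ : ℕ → ℝ, (∀ i, φ (i + 2) + φ i = 2 * Real.cos α * φ (i + 1)) →
      (∑ x ∈ A.nodes, (∑ j ∈ Finset.range W, A.e (u + 1 + j) x * φ (u + 1 + j)) ^ 2 / A.F x =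
        ∑ j ∈ Finset.range W, φ (u + 1 + j) ^ 2) ∧
      ∑ x ∈ A.nodes, (x - xs) ^ 2 *
        (∑ j ∈ Finset.range W, A.e (u + 1 + j) x * φ (u + 1 + j)) ^ 2 / A.F x ≤
        2 * β * (φ (u + W) ^ 2 + φ (u + W + 1) ^ 2) + 2 * β * (φ u ^ 2 + φ (u + 1) ^ 2) := by
    intro φ hφ
    constructor
    · have h := hA.parseval_subset (T := (Finset.range W).map (addLeftEmbedding (u + 1))) (by
        intro i hi
        obtain ⟨j, hj, rfl⟩ := Finset.mem_map.1 hi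
        have := Finset.mem_range.1 hj
        simp only [addLeftEmbedding_apply]
        omega) φ
      simpa only [Finset.sum_map, addLeftEmbedding_apply] using h
    · have h1 := hA.parseval_pair (u := u + W) (by omega) (√(β : ℝ) * φ (u + W + 1))
        (-(√(β : ℝ) * φ (u + W)))
      have h2 := hA.parseval_pair (u := u) (by omega) (√(β : ℝ) * φ (u + 1))
        (-(√(β : ℝ) * φ u))
      have hs : √(β : ℝ) ^ 2 = β := Real.sq_sqrt (Nat.cast_nonneg _)
      have h3 : 2 * β * (φ (u + W) ^ 2 + φ (u + W + 1) ^ 2) +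
          2 * β * (φ u ^ 2 + φ (u + 1) ^ 2) =
          ∑ x ∈ A.nodes, (2 * ((A.e (u + W) x * (√(β : ℝ) * φ (u + W + 1)) +
            A.e (u + W + 1) x * (-(√(β : ℝ) * φ (u + W)))) ^ 2 / A.F x) +
            2 * ((A.e u x * (√(β : ℝ) * φ (u + 1)) +
            A.e (u + 1) x * (-(√(β : ℝ) * φ u))) ^ 2 / A.F x)) := by
        rw [Finset.sum_add_distrib, ← Finset.mul_sum, ← Finset.mul_sum, h1, h2]
        linear_combination (-2 * (φ (u + W) ^ 2 + φ (u + W + 1) ^ 2) -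
          2 * (φ u ^ 2 + φ (u + 1) ^ 2)) * hs
      rw [h3]
      refine Finset.sum_le_sum fun x _ => ?_
      have h4 := window_telescope (f := fun i => A.e i x) (φ := φ) (y := x - a)
        (z := 2 * √(β : ℝ) * Real.cos α) (β := √(β : ℝ)) (u := u) (W := W)
        (fun i h5 h6 => hA.e_rec (by omega) (ha _ (by omega) (by omega)) (hb _ h5 (by omega))
          (hb _ (by omega) (by omega)) x)
        (fun i => by rw [hφ i]; ring)
      rw [show x - a - 2 * √(β : ℝ) * Real.cos α = x - xs by rw [hxs]; ring] at h4
      rw [← mul_pow, h4, ← mul_div_assoc, ← mul_div_assoc, ← add_div]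
      refine div_le_div_of_nonneg_right ?_ (hFp x).le
      nlinarith [sq_nonneg (√(β : ℝ) * (A.e (u + W + 1) x * φ (u + W) - A.e (u + W) x * φ (u + W + 1)) +
        √(β : ℝ) * (A.e (u + 1) x * φ u - A.e u x * φ (u + 1)))]
  have htrig : ∀ i : ℕ, Real.cos (α * (i + 2 : ℕ)) + Real.cos (α * i) =
      2 * Real.cos α * Real.cos (α * (i + 1 : ℕ)) := by
    intro i
    rw [show α * (i + 2 : ℕ) = α * (i + 1 : ℕ) + α by push_cast; ring,
      show α * i = α * (i + 1 : ℕ) - α by push_cast; ring, Real.cos_add, Real.cos_sub]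
    ring
  have htrig' : ∀ i : ℕ, Real.sin (α * (i + 2 : ℕ)) + Real.sin (α * i) =
      2 * Real.cos α * Real.sin (α * (i + 1 : ℕ)) := by
    intro i
    rw [show α * (i + 2 : ℕ) = α * (i + 1 : ℕ) + α by push_cast; ring,
      show α * i = α * (i + 1 : ℕ) - α by push_cast; ring, Real.sin_add, Real.sin_sub]
    ring
  obtain ⟨hc1, hc2⟩ := key (fun i => Real.cos (α * i)) htrig
  obtain ⟨hs1, hs2⟩ := key (fun i => Real.sin (α * i)) htrig'
  set Q : ℝ → ℝ := fun x =>
    (∑ j ∈ Finset.range W, A.e (u + 1 + j) x * Real.cos (α * (u + 1 + j : ℕ))) ^ 2 +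
    (∑ j ∈ Finset.range W, A.e (u + 1 + j) x * Real.sin (α * (u + 1 + j : ℕ))) ^ 2 with hQ
  have hQ0 : ∀ x, 0 ≤ Q x := fun x => by positivity
  have hQW : ∑ x ∈ A.nodes, Q x / A.F x = W := by
    simp only [hQ, add_div, Finset.sum_add_distrib]
    rw [hc1, hs1, ← Finset.sum_add_distrib]
    simp
  have hQd : ∑ x ∈ A.nodes, (x - xs) ^ 2 * Q x / A.F x ≤ 8 * β := by
    simp only [hQ, mul_add, add_div, Finset.sum_add_distrib]
    have h1 : ∀ t : ℝ, Real.sin t ^ 2 = 1 - Real.cos t ^ 2 := fun t => Real.sin_sq t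
    have := add_le_add hc2 hs2
    simp only [h1] at this
    linarith
  have hQM : ∀ x, Q x ≤ W * ∑ j ∈ Finset.range W, A.e (u + 1 + j) x ^ 2 := by
    intro x
    have h1 := Finset.sum_mul_sq_le_sq_mul_sq (Finset.range W) (fun j => A.e (u + 1 + j) x)
      (fun j => Real.cos (α * (u + 1 + j : ℕ)))
    have h2 := Finset.sum_mul_sq_le_sq_mul_sq (Finset.range W) (fun j => A.e (u + 1 + j) x)
      (fun j => Real.sin (α * (u + 1 + j : ℕ)))
    refine (add_le_add h1 h2).trans ?_
    rw [← mul_add, ← Finset.sum_add_distrib]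
    simp [mul_comm]
  have hW1 : (0 : ℝ) < W := by exact_mod_cast hW0
  have hfar : ∑ x ∈ A.nodes with ¬ |x - xs| ≤ δ, Q x / A.F x ≤ W / 2 := by
    have h1 : δ ^ 2 * ∑ x ∈ A.nodes with ¬ |x - xs| ≤ δ, Q x / A.F x ≤ 8 * β := by
      refine le_trans ?_ hQd
      rw [Finset.mul_sum]
      refine (Finset.sum_le_sum (g := fun x => (x - xs) ^ 2 * Q x / A.F x) fun x hx => ?_).trans
        (Finset.sum_le_sum_of_subset_of_nonneg (Finset.filter_subset _ _) fun x _ _ =>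
          div_nonneg (mul_nonneg (sq_nonneg _) (hQ0 x)) (hFp x).le)
      have hx' := not_le.1 (Finset.mem_filter.1 hx).2
      rw [mul_div_assoc]
      refine mul_le_mul_of_nonneg_right ?_ (div_nonneg (hQ0 x) (hFp x).le)
      rw [← sq_abs (x - xs)]
      exact pow_le_pow_left₀ hδ.le hx'.le 2
    have h2 : (0 : ℝ) < δ ^ 2 := by positivity
    refine le_of_mul_le_mul_left (h1.trans ?_) h2
    linarith
  have hnear : W / 2 ≤ ∑ x ∈ A.nodes with |x - xs| ≤ δ, Q x / A.F x := by
    have := Finset.sum_filter_add_sum_filter_not A.nodes (fun x => |x - xs| ≤ δ)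
      (fun x => Q x / A.F x)
    rw [hQW] at this
    linarith
  have h3 : ∑ x ∈ A.nodes with |x - xs| ≤ δ, Q x / A.F x ≤
      W * ∑ x ∈ A.nodes with |x - xs| ≤ δ,
        (∑ j ∈ Finset.range W, A.e (u + 1 + j) x ^ 2) / A.F x := by
    rw [Finset.mul_sum]
    refine Finset.sum_le_sum fun x _ => ?_
    rw [← mul_div_assoc]
    exact div_le_div_of_nonneg_right (hQM x) (hFp x).le
  refine le_of_mul_le_mul_left ?_ hW1
  linarith

/-- On a long constant stretch, a positive proportion of the eigenvalues lie near any point of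
its band and carry a positive proportion of their mass on the stretch. -/
theorem Reg.good_count (hA : A.Reg) {a β u m W : ℕ} {α δ : ℝ} (hδ : 0 < δ)
    (hW : u + m * W + 1 ≤ A.D) (hW' : 16 * β ≤ δ ^ 2 * W) (hW0 : 0 < W)
    (ha : ∀ i, u + 1 ≤ i → i ≤ u + m * W → A.a i = a)
    (hb : ∀ i, u ≤ i → i ≤ u + m * W → A.bet i = β) :
    (m : ℝ) / 4 ≤ (A.nodes.filter fun x => |x - (a + 2 * √(β : ℝ) * Real.cos α)| ≤ δ ∧
      m * A.F x ≤ 4 * (A.D + 1) * ∑ i ∈ Finset.range (m * W), A.e (u + 1 + i) x ^ 2).card := by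
  set N := A.nodes.filter fun x => |x - (a + 2 * √(β : ℝ) * Real.cos α)| ≤ δ with hN
  have hFp : ∀ x, 0 < A.F x := fun x => lt_of_lt_of_le one_pos (A.one_le_F x)
  have hsplit : ∀ (f : ℕ → ℝ) (m : ℕ), ∑ i ∈ Finset.range (m * W), f i =
      ∑ t ∈ Finset.range m, ∑ j ∈ Finset.range W, f (t * W + j) := by
    intro f m
    induction m with
    | zero => simp
    | succ n ih => rw [Nat.succ_mul, Finset.sum_range_add, ih, Finset.sum_range_succ]
  have h1 : (m : ℝ) / 2 ≤ ∑ x ∈ N, (∑ i ∈ Finset.range (m * W), A.e (u + 1 + i) x ^ 2) / A.F x := by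
    simp only [hsplit (fun i => A.e (u + 1 + i) _ ^ 2) m, Finset.sum_div]
    rw [Finset.sum_comm]
    have : (m : ℝ) / 2 = ∑ t ∈ Finset.range m, (1 / 2 : ℝ) := by simp; ring
    rw [this]
    refine Finset.sum_le_sum fun t ht => ?_
    have ht' : t * W + W ≤ m * W := by
      rw [← Nat.succ_mul]
      exact Nat.mul_le_mul_right _ (Finset.mem_range.1 ht)
    have h2 := hA.window (u := u + t * W) (W := W) (α := α) hδ (by omega) hW' hW0
      (fun i h3 h4 => ha i (by omega) (by omega)) (fun i h3 h4 => hb i (by omega) (by omega))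
    simp only [Finset.sum_div] at h2
    refine h2.trans (le_of_eq (Finset.sum_congr rfl fun x _ => Finset.sum_congr rfl fun j _ => ?_))
    rw [show u + t * W + 1 + j = u + 1 + (t * W + j) by ring]
  have h2 : ∀ x, (∑ i ∈ Finset.range (m * W), A.e (u + 1 + i) x ^ 2) / A.F x ≤ 1 := by
    intro x
    rw [div_le_one (hFp x), F_eq]
    have := Finset.sum_map (Finset.range (m * W)) (addLeftEmbedding (u + 1))
      (fun i => A.e i x ^ 2)
    simp only [addLeftEmbedding_apply] at this
    rw [← this]
    refine Finset.sum_le_sum_of_subset_of_nonneg (fun i hi => ?_) fun _ _ _ => sq_nonneg _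
    obtain ⟨j, hj, rfl⟩ := Finset.mem_map.1 hi
    have := Finset.mem_range.1 hj
    simp only [addLeftEmbedding_apply, Finset.mem_range]
    omega
  set G := N.filter fun x => m * A.F x ≤
    4 * (A.D + 1) * ∑ i ∈ Finset.range (m * W), A.e (u + 1 + i) x ^ 2 with hG
  rw [← Finset.filter_filter]
  have hD : (0 : ℝ) < 4 * (A.D + 1) := by positivity
  have h3 : ∑ x ∈ N, (∑ i ∈ Finset.range (m * W), A.e (u + 1 + i) x ^ 2) / A.F x ≤
      G.card + (A.D + 1) * (m / (4 * (A.D + 1))) := by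
    rw [← Finset.sum_filter_add_sum_filter_not N (fun x => m * A.F x ≤
      4 * (A.D + 1) * ∑ i ∈ Finset.range (m * W), A.e (u + 1 + i) x ^ 2)]
    refine add_le_add ?_ ?_
    · refine (Finset.sum_le_card_nsmul _ _ 1 fun x _ => h2 x).trans ?_
      simp [hG]
    · refine (Finset.sum_le_card_nsmul _ _ ((m : ℝ) / (4 * (A.D + 1))) fun x hx => ?_).trans ?_
      · have := not_le.1 (Finset.mem_filter.1 hx).2
        rw [div_le_div_iff₀ (hFp x) hD]
        linarith
      · rw [nsmul_eq_mul]
        refine mul_le_mul_of_nonneg_right ?_ (by positivity)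
        have := hA.nodes_spec.1
        have h5 : (N.filter fun x => ¬ m * A.F x ≤
          4 * (A.D + 1) * ∑ i ∈ Finset.range (m * W), A.e (u + 1 + i) x ^ 2).card ≤ A.D + 1 :=
          ((Finset.card_filter_le _ _).trans (Finset.card_filter_le _ _)).trans this.le
        exact_mod_cast h5
  have h4 : ((A.D : ℝ) + 1) * (m / (4 * (A.D + 1))) = m / 4 := by field_simp
  linarith

end Arr

open Polynomial in
/-- A complete set of conjugate totally real algebraic integers. -/
structure ConjSet (S : Finset ℝ) : Prop where
  nonempty : S.Nonempty
  poly : ∃ f : ℤ[X], f.Monic ∧ (f.map (Int.castRingHom ℝ)).Splits ∧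
    (f.map (Int.castRingHom ℝ)).roots = S.val
  zero : ∀ (g : ℤ[X]), ∀ x ∈ S, aeval x g = 0 → ∀ y ∈ S, aeval y g = 0

namespace ConjSet

open Polynomial

variable {S : Finset ℝ}

theorem exists_prod_eq (hS : ConjSet S) (g : ℤ[X]) : ∃ z : ℤ, ∏ x ∈ S, aeval x g = (z : ℝ) := by
  obtain ⟨f, hf, hs, hr⟩ := hS.poly
  refine ⟨f.resultant g f.natDegree g.natDegree, ?_⟩
  have h1 := resultant_map_map f g f.natDegree g.natDegree (Int.castRingHom ℝ)
  have h2 := resultant_eq_prod_eval (f.map (Int.castRingHom ℝ)) (g.map (Int.castRingHom ℝ))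
    g.natDegree natDegree_map_le hs
  rw [hf.natDegree_map, h1, (hf.map _).leadingCoeff, one_pow, one_mul, hr] at h2
  rw [eq_intCast] at h2
  rw [h2, Finset.prod]
  congr 1
  refine Multiset.map_congr rfl fun x _ => ?_
  rw [eval_map, aeval_def]
  rfl

theorem one_le_abs_prod (hS : ConjSet S) {g : ℤ[X]} {x : ℝ} (hx : x ∈ S) (hg : aeval x g ≠ 0) :
    1 ≤ |∏ x ∈ S, aeval x g| := by
  obtain ⟨z, hz⟩ := hS.exists_prod_eq g
  have h1 : ∏ x ∈ S, aeval x g ≠ 0 := Finset.prod_ne_zero_iff.2 fun y hy h =>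
    hg (hS.zero g y hy h x hx)
  rw [hz] at h1 ⊢
  exact_mod_cast Int.one_le_abs (by exact_mod_cast h1)

theorem exists_disc_eq (hS : ConjSet S) :
    ∃ z : ℤ, ∏ x ∈ S, ∏ y ∈ S.erase x, (x - y) = (z : ℝ) := by
  obtain ⟨f, hf, hs, hr⟩ := hS.poly
  obtain ⟨z, hz⟩ := hS.exists_prod_eq (derivative f)
  refine ⟨z, hz ▸ Finset.prod_congr rfl fun x hx => ?_⟩
  have h1 := Splits.eval_root_derivative hs (hf.map _) (x := x) (by rw [hr]; exact hx)
  rw [derivative_map, eval_map, hr] at h1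
  rw [aeval_def]
  exact h1.symm

theorem disc_ne_zero (S : Finset ℝ) : ∏ x ∈ S, ∏ y ∈ S.erase x, (x - y) ≠ 0 :=
  Finset.prod_ne_zero_iff.2 fun _ _ => Finset.prod_ne_zero_iff.2 fun _ hy =>
    sub_ne_zero.2 (Finset.ne_of_mem_erase hy).symm

theorem one_le_abs_disc (hS : ConjSet S) : 1 ≤ |∏ x ∈ S, ∏ y ∈ S.erase x, (x - y)| := by
  obtain ⟨z, hz⟩ := hS.exists_disc_eq
  have h1 := disc_ne_zero S
  rw [hz] at h1 ⊢
  exact_mod_cast Int.one_le_abs (by exact_mod_cast h1)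

theorem finite_of_card_le (n : ℕ) (K : ℝ) :
    {x : ℝ | ∃ S, ConjSet S ∧ x ∈ S ∧ S.card ≤ n ∧ ∀ y ∈ S, |y| ≤ K}.Finite := by
  set M : ℝ := max K 1 ^ n * (n.choose (n / 2) : ℕ)
  have hU : (Set.Icc (-⌈M⌉) ⌈M⌉ : Set ℤ).Finite := Set.finite_Icc _ _
  refine (bUnion_roots_finite (Int.castRingHom ℝ) n hU).subset ?_
  rintro x ⟨S, hS, hx, hn, hK⟩
  obtain ⟨f, hf, hs, hr⟩ := hS.poly
  have hdeg : f.natDegree = S.card := by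
    rw [← hf.natDegree_map (Int.castRingHom ℝ), hs.natDegree_eq_card_roots, hr]
    rfl
  refine Set.mem_iUnion₂.2 ⟨f, ⟨hdeg ▸ hn, fun i => ?_⟩, ?_⟩
  · have := coeff_bdd_of_roots_le (Int.castRingHom ℝ) (B := K) hf hs (hdeg ▸ hn)
      (fun z hz => by rw [hr] at hz; exact hK z hz) i
    rw [coeff_map, eq_intCast, Real.norm_eq_abs] at this
    have h2 := this.trans (Int.le_ceil M)
    exact abs_le.1 (by exact_mod_cast h2)
  · rw [hr]
    simpa using hx

end ConjSet

namespace Arr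

open Polynomial

variable {A : Arr}

/-- The eigenvalues conjugate to `x`. -/
noncomputable def cls (A : Arr) (x : ℝ) : Finset ℝ := by
  classical exact A.nodes.filter fun y => aeval y (minpoly ℤ x) = 0

theorem isIntegral_of_mem {x : ℝ} (hx : x ∈ A.nodes) : IsIntegral ℤ x :=
  ⟨A.p (A.D + 1), (A.p_monic _).1, by rw [← aeval_def]; exact mem_nodes.1 hx⟩

theorem mem_cls {x y : ℝ} : y ∈ A.cls x ↔ y ∈ A.nodes ∧ aeval y (minpoly ℤ x) = 0 := by
  rw [cls, Finset.mem_filter]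

theorem mem_cls_self {x : ℝ} (hx : x ∈ A.nodes) : x ∈ A.cls x :=
  mem_cls.2 ⟨hx, minpoly.aeval _ _⟩

theorem cls_subset (A : Arr) (x : ℝ) : A.cls x ⊆ A.nodes := fun _ hy => (mem_cls.1 hy).1

theorem minpoly_eq {x y : ℝ} (hx : x ∈ A.nodes) (hy : y ∈ A.cls x) :
    minpoly ℤ y = minpoly ℤ x := by
  have hxi := isIntegral_of_mem hx
  have hyi := isIntegral_of_mem (mem_cls.1 hy).1
  have h1 : minpoly ℤ y ∣ minpoly ℤ x := minpoly.isIntegrallyClosed_dvd hyi (mem_cls.1 hy).2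
  rcases (minpoly.irreducible hxi).dvd_iff.1 h1 with h2 | h2
  · exact absurd h2 (minpoly.irreducible hyi).not_isUnit
  · exact eq_of_monic_of_associated (minpoly.monic hyi) (minpoly.monic hxi) h2.symm

theorem cls_eq {x y : ℝ} (hx : x ∈ A.nodes) (hy : y ∈ A.cls x) : A.cls y = A.cls x := by
  rw [cls, minpoly_eq hx hy, cls]

theorem Reg.conjSet (hA : A.Reg) {x : ℝ} (hx : x ∈ A.nodes) : ConjSet (A.cls x) := by
  classical
  have hxi := isIntegral_of_mem hx
  refine ⟨⟨x, mem_cls_self hx⟩, ⟨minpoly ℤ x, minpoly.monic hxi, ?_, ?_⟩, ?_⟩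
  · refine Splits.of_dvd hA.roots_eq.2 ((A.p_monic (A.D + 1)).1.map (Int.castRingHom ℝ)).ne_zero ?_
    exact Polynomial.map_dvd _ (minpoly.isIntegrallyClosed_dvd hxi (mem_nodes.1 hx))
  · have h0 := ((A.p_monic (A.D + 1)).1.map (Int.castRingHom ℝ)).ne_zero
    have h1 := roots.le_of_dvd h0 (Polynomial.map_dvd (Int.castRingHom ℝ)
      (minpoly.isIntegrallyClosed_dvd hxi (mem_nodes.1 hx)))
    rw [hA.roots_eq.1] at h1
    have h2 : ((minpoly ℤ x).map (Int.castRingHom ℝ)).roots.Nodup :=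
      Multiset.nodup_of_le h1 A.nodes.nodup
    refine (Multiset.Nodup.ext h2 (A.cls x).nodup).2 fun y => ?_
    rw [mem_roots ((minpoly.monic hxi).map _).ne_zero, IsRoot.def, eval_map, Finset.mem_val, mem_cls,
      aeval_def]
    refine ⟨fun h => ⟨?_, h⟩, fun h => h.2⟩
    rw [← Finset.mem_val]
    refine Multiset.mem_of_le h1 ?_
    rw [mem_roots ((minpoly.monic hxi).map _).ne_zero, IsRoot.def, eval_map]
    exact h
  · intro g y hy hg z hz
    obtain ⟨q, rfl⟩ := minpoly.isIntegrallyClosed_dvd (isIntegral_of_mem (mem_cls.1 hy).1) hg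
    rw [minpoly_eq hx hy, map_mul, (mem_cls.1 hz).2, zero_mul]

theorem Reg.F_eq_of_mem_cls (hA : A.Reg) {x y : ℝ} (hx : x ∈ A.nodes) (hy : y ∈ A.cls x) :
    A.F y = A.F x := by
  obtain ⟨q, hq⟩ := hA.rat x (mem_nodes.1 hx)
  set G : ℤ[X] := ∑ i ∈ Finset.range (A.D + 1),
    C (∏ j ∈ Finset.Ico i A.D, (A.bet j : ℤ)) * A.p i ^ 2 with hG
  have hGF : ∀ z, aeval z G = A.w A.D * A.F z := by
    intro z
    rw [hG, map_sum, F, Finset.mul_sum]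
    refine Finset.sum_congr rfl fun i hi => ?_
    have hi' : i ≤ A.D := by have := Finset.mem_range.1 hi; omega
    have h1 : A.w A.D = A.w i * ∏ j ∈ Finset.Ico i A.D, (A.bet j : ℝ) :=
      (Finset.prod_range_mul_prod_Ico _ hi').symm
    have h2 := hA.w_pos hi'
    rw [h1, map_mul, map_pow, aeval_C, ev]
    simp only [algebraMap_int_eq, eq_intCast, Int.cast_prod, Int.cast_natCast]
    field_simp
  obtain ⟨W, hW⟩ : ∃ W : ℕ, A.w A.D = W := ⟨∏ j ∈ Finset.range A.D, A.bet j, by simp [w]⟩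
  have hW0 := hA.w_pos le_rfl
  have hqd : (q.den : ℝ) ≠ 0 := by exact_mod_cast q.den_nz
  have hqq : (q : ℝ) * q.den = q.num := by exact_mod_cast Rat.mul_den_eq_num q
  have h3 := (hA.conjSet hx).zero (C (q.den : ℤ) * G - C (W * q.num)) x (mem_cls_self hx) (by
    rw [map_sub, map_mul, hGF, aeval_C, aeval_C, hq, hW]
    simp only [algebraMap_int_eq, eq_intCast, Int.cast_mul, Int.cast_natCast]
    rw [← hqq]
    ring) y hy
  rw [map_sub, map_mul, hGF, aeval_C, aeval_C, hW] at h3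
  simp only [algebraMap_int_eq, eq_intCast, Int.cast_mul, Int.cast_natCast] at h3
  rw [hW] at hW0
  rw [hq]
  have h4 : (q.den : ℝ) * W ≠ 0 := mul_ne_zero hqd hW0.ne'
  refine mul_left_cancel₀ h4 ?_
  rw [← hqq] at h3
  linear_combination h3

end Arr

section Algebraic

open Polynomial

theorem isIntegral_of_forall_valuationSubring {z : ℂ} (h : ∀ V : ValuationSubring ℂ, z ∈ V) :
    IsIntegral ℤ z := by
  have h1 := iInf_valuationSubring_superset (K := ℂ) (s := (∅ : Set ℂ))
  have h2 : z ∈ (integralClosure (Subring.closure (∅ : Set ℂ)) ℂ).toSubring := by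
    rw [← h1]
    simp only [Subring.mem_iInf]
    exact fun V => h V.1
  have h3 : IsIntegral (Subring.closure (∅ : Set ℂ)) z := h2
  obtain ⟨f, hf, hz⟩ := h3
  have h4 : Subring.closure (∅ : Set ℂ) = (Int.castRingHom ℂ).range := by
    rw [Subring.closure_empty]
    refine le_antisymm bot_le ?_
    rintro _ ⟨n, rfl⟩
    exact intCast_mem _ n
  have hs : Function.Surjective (Int.castRingHom (Subring.closure (∅ : Set ℂ))) := by
    rintro ⟨x, hx⟩
    rw [h4] at hx
    obtain ⟨n, rfl⟩ := hx
    exact ⟨n, Subtype.ext (by simp)⟩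
  have h5 : f ∈ Polynomial.lifts (Int.castRingHom (Subring.closure (∅ : Set ℂ))) := by
    obtain ⟨g, hg⟩ := Polynomial.map_surjective _ hs f
    exact ⟨g, hg⟩
  obtain ⟨g, hg, -, hm⟩ := Polynomial.lifts_and_natDegree_eq_and_monic h5 hf
  refine ⟨g, hm, ?_⟩
  have h6 : (algebraMap (Subring.closure (∅ : Set ℂ)) ℂ).comp
      (Int.castRingHom (Subring.closure (∅ : Set ℂ))) = algebraMap ℤ ℂ := RingHom.ext_int _ _
  rwa [← hg, eval₂_map, h6] at hz

theorem exists_quadratic_roots (V : ValuationSubring ℂ) (y : ℂ) {b : ℂ} (hb : b ≠ 0) :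
    ∃ ζ₁ ζ₂ g : ℂ, ζ₁ + ζ₂ = y ∧ ζ₁ * ζ₂ = b ∧ g ∈ V ∧ ζ₂ = ζ₁ * g := by
  obtain ⟨s, hs⟩ : ∃ s : ℂ, s ^ 2 = y ^ 2 - 4 * b := IsAlgClosed.exists_pow_nat_eq _ two_pos
  have h1 : (y + s) / 2 + (y - s) / 2 = y := by ring
  have h2 : (y + s) / 2 * ((y - s) / 2) = b := by linear_combination -hs / 4
  generalize (y + s) / 2 = ζ₁ at h1 h2
  generalize (y - s) / 2 = ζ₂ at h1 h2
  have h3 : ζ₁ ≠ 0 := fun h => hb (by rw [← h2, h, zero_mul])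
  have h4 : ζ₂ ≠ 0 := fun h => hb (by rw [← h2, h, mul_zero])
  rcases V.mem_or_inv_mem (ζ₂ / ζ₁) with h | h
  · exact ⟨ζ₁, ζ₂, _, h1, h2, h, by field_simp⟩
  · exact ⟨ζ₂, ζ₁, _, by rw [add_comm, h1], by rw [mul_comm, h2], h, by field_simp⟩

/-- `R` is divisible by the `τ`-th power of the smaller root ratio at every place. -/
def RatioDvd (a b τ : ℕ) (R : ℤ[X]) (x : ℝ) : Prop :=
  ∀ (V : ValuationSubring ℂ) (ζ₁ ζ₂ g : ℂ), ζ₁ + ζ₂ = x - a → ζ₁ * ζ₂ = b → g ∈ V → ζ₂ = ζ₁ * g →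
    ∃ r ∈ V, ((aeval x R : ℝ) : ℂ) = g ^ τ * r

theorem RatioDvd.isIntegral {a b τ : ℕ} {R : ℤ[X]} {x y : ℝ} (hb : b ≠ 0)
    (hx : RatioDvd a b τ R x) (hy : RatioDvd a b τ R y) :
    IsIntegral ℤ ((((x - y) ^ 2) ^ τ * (aeval x R * aeval y R) / b ^ τ : ℝ) : ℂ) := by
  refine isIntegral_of_forall_valuationSubring fun V => ?_
  have hb' : (b : ℂ) ≠ 0 := by exact_mod_cast hb
  have key : ∀ x y : ℝ, RatioDvd a b τ R x → RatioDvd a b τ R y → ∀ ζ₁ ζ₂ g ζ₁' ζ₂' g' c : ℂ,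
      ζ₁ + ζ₂ = x - a → ζ₁ * ζ₂ = b → g ∈ V → ζ₂ = ζ₁ * g →
      ζ₁' + ζ₂' = y - a → ζ₁' * ζ₂' = b → g' ∈ V → ζ₂' = ζ₁' * g' → c ∈ V → ζ₁' = ζ₁ * c →
      ((((x - y) ^ 2) ^ τ * (aeval x R * aeval y R) / b ^ τ : ℝ) : ℂ) ∈ V := by
    intro x y hx hy ζ₁ ζ₂ g ζ₁' ζ₂' g' c h1 h2 h3 h4 h1' h2' h3' h4' hc hc'
    obtain ⟨r, hr, hr1⟩ := hx V ζ₁ ζ₂ g h1 h2 h3 h4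
    obtain ⟨r', hr', hr1'⟩ := hy V ζ₁' ζ₂' g' h1' h2' h3' h4'
    set u := (1 + g) - c * (1 + g') with hu
    have huV : u ∈ V := sub_mem (add_mem (one_mem V) h3) (mul_mem hc (add_mem (one_mem V) h3'))
    have h5 : (x : ℂ) - y = ζ₁ * u := by
      rw [hu]
      linear_combination h1' - h1 + h4 - h4' + (-1 - g') * hc'
    have h6 : (b : ℂ) = ζ₁ ^ 2 * g := by rw [← h2, h4]; ring
    have h7 : ((((x - y) ^ 2) ^ τ * (aeval x R * aeval y R) / b ^ τ : ℝ) : ℂ) =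
        (u ^ 2) ^ τ * r * (g' ^ τ * r') := by
      push_cast
      rw [hr1, hr1', h5, div_eq_iff (pow_ne_zero _ hb'), h6]
      simp only [mul_pow]
      ring
    rw [h7]
    exact mul_mem (mul_mem (pow_mem (pow_mem huV _) _) hr) (mul_mem (pow_mem h3' _) hr')
  obtain ⟨ζ₁, ζ₂, g, h1, h2, h3, h4⟩ := exists_quadratic_roots V (x - a) hb'
  obtain ⟨ζ₁', ζ₂', g', h1', h2', h3', h4'⟩ := exists_quadratic_roots V (y - a) hb'
  have hz : ζ₁ ≠ 0 := fun h => hb' (by rw [← h2, h, zero_mul])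
  have hz' : ζ₁' ≠ 0 := fun h => hb' (by rw [← h2', h, zero_mul])
  rcases V.mem_or_inv_mem (ζ₁' / ζ₁) with h | h
  · exact key x y hx hy ζ₁ ζ₂ g ζ₁' ζ₂' g' _ h1 h2 h3 h4 h1' h2' h3' h4' h (by field_simp)
  · have := key y x hy hx ζ₁' ζ₂' g' ζ₁ ζ₂ g _ h1' h2' h3' h4' h1 h2 h3 h4 h (by field_simp)
    rwa [show (y - x) ^ 2 = (x - y) ^ 2 by ring, mul_comm (aeval y R : ℝ)] at this

theorem one_le_abs_of_isIntegral {q : ℚ} (hq : IsIntegral ℤ (q : ℂ)) (h0 : q ≠ 0) : 1 ≤ |q| := by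
  have h1 : IsIntegral ℤ q := by
    have : IsIntegral ℤ (algebraMap ℚ ℂ q) := hq
    exact (isIntegral_algebraMap_iff (algebraMap ℚ ℂ).injective).1 this
  obtain ⟨z, rfl⟩ := IsIntegrallyClosed.isIntegral_iff.1 h1
  rw [algebraMap_int_eq, eq_intCast] at h0 ⊢
  exact_mod_cast Int.one_le_abs (by exact_mod_cast h0)

theorem prod_erase_const {M : Type*} [CommMonoid M] (S : Finset ℝ) (f : ℝ → M) :
    ∏ x ∈ S, ∏ _y ∈ S.erase x, f x = (∏ x ∈ S, f x) ^ (S.card - 1) := by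
  rw [← Finset.prod_pow]
  refine Finset.prod_congr rfl fun x hx => ?_
  rw [Finset.prod_const, Finset.card_erase_of_mem hx]

theorem prod_erase_comm {M : Type*} [CommMonoid M] (S : Finset ℝ) (f : ℝ → ℝ → M) :
    ∏ x ∈ S, ∏ y ∈ S.erase x, f x y = ∏ y ∈ S, ∏ x ∈ S.erase y, f x y :=
  Finset.prod_comm' fun x y => by
    simp only [Finset.mem_erase]
    tauto

/-- The arithmetic lower bound for the discriminant coming from divisibility at all places. -/
theorem ConjSet.pow_le_disc {S : Finset ℝ} (hS : ConjSet S) {a b τ : ℕ} {R : ℤ[X]} (hb : b ≠ 0)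
    (hR : ∀ x ∈ S, RatioDvd a b τ R x) (hne : ∀ x ∈ S, aeval x R ≠ (0 : ℝ)) :
    (b : ℝ) ^ (τ * (S.card * (S.card - 1))) ≤
      |∏ x ∈ S, ∏ y ∈ S.erase x, (x - y)| ^ (2 * τ) * |∏ x ∈ S, aeval x R| ^ (2 * (S.card - 1)) := by
  obtain ⟨z, hz⟩ := hS.exists_disc_eq
  obtain ⟨t, ht⟩ := hS.exists_prod_eq R
  have hz0 := ConjSet.disc_ne_zero S
  have ht0 : ∏ x ∈ S, aeval x R ≠ (0 : ℝ) := Finset.prod_ne_zero_iff.2 hne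
  have h1 : IsIntegral ℤ (∏ x ∈ S, ∏ y ∈ S.erase x,
      ((((x - y) ^ 2) ^ τ * (aeval x R * aeval y R) / b ^ τ : ℝ) : ℂ)) :=
    IsIntegral.prod _ fun x hx => IsIntegral.prod _ fun y hy =>
      (hR x hx).isIntegral hb (hR y (Finset.mem_of_mem_erase hy))
  have h2 : ∏ x ∈ S, ∏ y ∈ S.erase x, (((x - y) ^ 2) ^ τ * (aeval x R * aeval y R) / b ^ τ : ℝ) =
      (z ^ (2 * τ) * t ^ (2 * (S.card - 1)) / b ^ (τ * (S.card * (S.card - 1))) : ℚ) := by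
    simp only [Finset.prod_div_distrib, Finset.prod_mul_distrib, Finset.prod_pow]
    rw [hz, prod_erase_const, prod_erase_comm S fun x y => (aeval y R : ℝ), prod_erase_const, ht]
    rw [Finset.prod_congr rfl fun x hx => by
      rw [Finset.prod_const, Finset.card_erase_of_mem hx], Finset.prod_const]
    push_cast
    congr 1
    · ring
    · ring
  have h3 : (∏ x ∈ S, ∏ y ∈ S.erase x,
      ((((x - y) ^ 2) ^ τ * (aeval x R * aeval y R) / b ^ τ : ℝ) : ℂ)) =
      ((z ^ (2 * τ) * t ^ (2 * (S.card - 1)) / b ^ (τ * (S.card * (S.card - 1))) : ℚ) : ℂ) := by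
    have := congrArg (fun r : ℝ => (r : ℂ)) h2
    simp only [Complex.ofReal_prod, Complex.ofReal_ratCast] at this
    exact this
  rw [h3] at h1
  rw [hz] at hz0
  rw [ht] at ht0
  have hz1 : (z : ℚ) ≠ 0 := by exact_mod_cast hz0
  have ht1 : (t : ℚ) ≠ 0 := by exact_mod_cast ht0
  have hb1 : (b : ℚ) ≠ 0 := by exact_mod_cast hb
  have h4 := one_le_abs_of_isIntegral h1 (div_ne_zero (mul_ne_zero (pow_ne_zero _ hz1)
    (pow_ne_zero _ ht1)) (pow_ne_zero _ hb1))
  have hb2 : (0 : ℚ) < b := by positivity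
  rw [abs_div, one_le_div (abs_pos.2 (pow_ne_zero _ hb1)), abs_mul, abs_pow, abs_pow, abs_pow,
    abs_of_pos hb2] at h4
  rw [hz, ht]
  exact_mod_cast h4

end Algebraic

section Vandermonde

open Polynomial

/-- The monic Chebyshev polynomials on `[-2, 2]`, normalised so that the `0`-th one is monic too. -/
noncomputable def chebC : ℕ → ℝ[X]
  | 0 => 1
  | 1 => X
  | 2 => X ^ 2 - 2
  | n + 3 => X * chebC (n + 2) - chebC (n + 1)

theorem chebC_monic : ∀ n, (chebC n).Monic ∧ (chebC n).natDegree = n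
  | 0 => by simp [chebC]
  | 1 => by simp [chebC, monic_X]
  | 2 => by
      have h : chebC 2 = X ^ 2 - C 2 := rfl
      rw [h]
      exact ⟨monic_X_pow_sub_C _ two_ne_zero, natDegree_X_pow_sub_C⟩
  | n + 3 => by
      obtain ⟨h1, h1'⟩ := chebC_monic (n + 1)
      obtain ⟨h2, h2'⟩ := chebC_monic (n + 2)
      have hm : (X * chebC (n + 2)).Monic := monic_X.mul h2
      have hd : (X * chebC (n + 2)).natDegree = n + 3 := by
        rw [monic_X.natDegree_mul h2, natDegree_X, h2']; ring
      have hlt : (chebC (n + 1)).degree < (X * chebC (n + 2)).degree := by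
        rw [degree_eq_natDegree hm.ne_zero, degree_eq_natDegree h1.ne_zero, hd, h1']
        exact_mod_cast (by omega : n + 1 < n + 3)
      refine ⟨hm.sub_of_left hlt, ?_⟩
      change (X * chebC (n + 2) - chebC (n + 1)).natDegree = _
      rw [natDegree_sub_eq_left_of_natDegree_lt (by rw [hd, h1']; omega), hd]

theorem eval_chebC (θ : ℝ) : ∀ n, (chebC (n + 1)).eval (2 * Real.cos θ) = 2 * Real.cos ((n + 1) * θ)
  | 0 => by simp [chebC]
  | 1 => by
      have : ((1 : ℕ) + 1 : ℝ) * θ = 2 * θ := by norm_num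
      rw [this, Real.cos_two_mul]
      simp [chebC]; ring
  | n + 2 => by
      have h1 := eval_chebC θ n
      have h2 := eval_chebC θ (n + 1)
      change (X * chebC (n + 2) - chebC (n + 1)).eval _ = _
      rw [eval_sub, eval_mul, eval_X, h1, h2]
      push_cast
      have e1 : ((n : ℝ) + 2 + 1) * θ = ((n : ℝ) + 1 + 1) * θ + θ := by ring
      have e2 : ((n : ℝ) + 1) * θ = ((n : ℝ) + 1 + 1) * θ - θ := by ring
      rw [e1, e2, Real.cos_add, Real.cos_sub]
      ring

theorem abs_eval_chebC_le {t : ℝ} (ht : |t| ≤ 2) (n : ℕ) : |(chebC n).eval t| ≤ 2 := by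
  obtain ⟨h1, h2⟩ := abs_le.1 ht
  rcases n with _ | n
  · simp [chebC]
  · have : t = 2 * Real.cos (Real.arccos (t / 2)) := by
      rw [Real.cos_arccos (by linarith) (by linarith)]; ring
    rw [this, eval_chebC, abs_mul, abs_of_pos (by norm_num : (0 : ℝ) < 2)]
    linarith [Real.abs_cos_le_one ((n + 1) * Real.arccos (t / 2))]

theorem prod_erase_eq_vandermonde {n : ℕ} (v : Fin n → ℝ) :
    |∏ i, ∏ j ∈ Finset.univ.erase i, (v i - v j)| = (Matrix.vandermonde v).det ^ 2 := by
  rw [Matrix.det_vandermonde, Finset.abs_prod, ← sq_abs, Finset.abs_prod, sq]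
  simp_rw [Finset.abs_prod]
  have h : ∀ i : Fin n, ∏ j ∈ Finset.univ.erase i, |v i - v j| =
      (∏ j ∈ Finset.Ioi i, |v j - v i|) * ∏ j ∈ Finset.Iio i, |v j - v i| := by
    intro i
    rw [← Finset.prod_union]
    · have : Finset.univ.erase i = Finset.Ioi i ∪ Finset.Iio i := by
        ext j; simp [lt_or_lt_iff_ne, eq_comm]
      rw [this]
      exact Finset.prod_congr rfl fun j _ => abs_sub_comm _ _
    · rw [Finset.disjoint_left]; intro j; simp; exact fun h => h.le
  rw [Finset.prod_congr rfl fun i _ => h i, Finset.prod_mul_distrib]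
  congr 1
  rw [Finset.prod_comm' (t' := Finset.univ) (s' := fun j => Finset.Ioi j) (by simp)]
  exact Finset.prod_congr rfl fun j _ => Finset.prod_congr rfl fun i _ => abs_sub_comm _ _

theorem abs_det_vandermonde_le {n : ℕ} {v : Fin n → ℝ} (hv : ∀ i, |v i| ≤ 2) :
    |(Matrix.vandermonde v).det| ≤ n.factorial * 2 ^ n := by
  rw [Matrix.det_eval_matrixOfPolynomials_eq_det_vandermonde v (fun i => chebC i)
    (fun i => (chebC_monic i).2) (fun i => (chebC_monic i).1)]
  have := Matrix.det_le (A := Matrix.of fun i j : Fin n => (chebC j).eval (v i))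
    (abv := AbsoluteValue.abs) (x := 2) (fun i j => abs_eval_chebC_le (hv i) j)
  simpa using this

/-- The pair product of points in an interval of capacity `r` is at most `(g! 2^g)² r^{g(g-1)}`. -/
theorem abs_disc_le {T : Finset ℝ} {m r : ℝ} (hr : 0 < r) (hT : ∀ x ∈ T, |x - m| ≤ 2 * r) :
    |∏ x ∈ T, ∏ y ∈ T.erase x, (x - y)| ≤
      (T.card.factorial * 2 ^ T.card) ^ 2 * r ^ (T.card * (T.card - 1)) := by
  set n := T.card with hn
  let φ : Fin n ≃ T := T.equivFin.symm
  let v : Fin n → ℝ := fun i => ((φ i : ℝ) - m) / r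
  have hv : ∀ i, |v i| ≤ 2 := fun i => by
    rw [abs_div, abs_of_pos hr, div_le_iff₀ hr]; exact hT _ (φ i).2
  have hmap : T = Finset.univ.map (φ.toEmbedding.trans (Function.Embedding.subtype _)) := by
    ext x
    simp only [Finset.mem_map, Finset.mem_univ, true_and, Function.Embedding.trans_apply,
      Equiv.coe_toEmbedding, Function.Embedding.subtype_apply]
    constructor
    · intro hx; exact ⟨φ.symm ⟨x, hx⟩, by simp⟩
    · rintro ⟨i, rfl⟩; exact (φ i).2
  have key : ∏ x ∈ T, ∏ y ∈ T.erase x, (x - y) =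
      r ^ (n * (n - 1)) * ∏ i, ∏ j ∈ Finset.univ.erase i, (v i - v j) := by
    conv_lhs => rw [hmap]
    rw [Finset.prod_map]
    have : ∀ i : Fin n, ∏ y ∈ (Finset.univ.map (φ.toEmbedding.trans
        (Function.Embedding.subtype _))).erase
        (φ.toEmbedding.trans (Function.Embedding.subtype _) i),
        ((φ.toEmbedding.trans (Function.Embedding.subtype _) i) - y) =
        r ^ (n - 1) * ∏ j ∈ Finset.univ.erase i, (v i - v j) := by
      intro i
      rw [← Finset.map_erase, Finset.prod_map]
      have hc : (Finset.univ.erase i).card = n - 1 := by simp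
      rw [← hc, ← Finset.prod_const, ← Finset.prod_mul_distrib]
      refine Finset.prod_congr rfl fun j _ => ?_
      simp only [v, Function.Embedding.trans_apply, Equiv.coe_toEmbedding,
        Function.Embedding.subtype_apply]
      field_simp; ring
    rw [Finset.prod_congr rfl fun i _ => this i, Finset.prod_mul_distrib, Finset.prod_const]
    simp [← pow_mul, mul_comm]
  rw [key, abs_mul, abs_of_pos (pow_pos hr _), prod_erase_eq_vandermonde, mul_comm, ← sq_abs]
  gcongr
  exact abs_det_vandermonde_le hv

end Vandermonde

section Recurrence

variable {f : ℕ → ℝ} {ξ : ℝ} {p q : ℕ}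

theorem rec_conserved (hf : ∀ i, p ≤ i → i + 2 ≤ q → f (i + 2) + f i = 2 * ξ * f (i + 1)) {i : ℕ}
    (hi : p ≤ i) (hq : i + 1 ≤ q) : f i ^ 2 + f (i + 1) ^ 2 - 2 * ξ * f i * f (i + 1) =
      f p ^ 2 + f (p + 1) ^ 2 - 2 * ξ * f p * f (p + 1) := by
  induction i, hi using Nat.le_induction with
  | base => rfl
  | succ i hi ih =>
    rw [← ih (by omega)]
    linear_combination (f (i + 2) - f i) * hf i hi (by omega)

theorem rec_sq_le (hf : ∀ i, p ≤ i → i + 2 ≤ q → f (i + 2) + f i = 2 * ξ * f (i + 1))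
    (hpq : p < q) {i : ℕ} (hi : p ≤ i) (hq : i ≤ q) : (1 - ξ ^ 2) * f i ^ 2 ≤
      f p ^ 2 + f (p + 1) ^ 2 - 2 * ξ * f p * f (p + 1) := by
  rcases hq.lt_or_eq with hq | rfl
  · rw [← rec_conserved hf hi hq]
    nlinarith [sq_nonneg (f (i + 1) - ξ * f i)]
  · obtain ⟨j, rfl⟩ : ∃ j, i = j + 1 := ⟨i - 1, by omega⟩
    rw [← rec_conserved hf (i := j) (by omega) le_rfl]
    nlinarith [sq_nonneg (f j - ξ * f (j + 1))]

theorem rec_geom (hf : ∀ i, p ≤ i → i + 2 ≤ q → f (i + 2) + f i = 2 * ξ * f (i + 1)) {z w : ℝ}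
    (hzw : z * w = 1) (hs : z + w = 2 * ξ) {i : ℕ} (hq : p + i + 1 ≤ q) :
    f (p + i + 1) - w * f (p + i) = z ^ i * (f (p + 1) - w * f p) := by
  induction i with
  | zero => simp
  | succ i ih =>
    rw [pow_succ', mul_assoc, ← ih (by omega)]
    have := hf (p + i) (by omega) (by omega)
    rw [← hs] at this
    linear_combination this + f (p + i) * hzw

/-- The Chebyshev polynomials of the second kind, shifted so that `jumpU ξ 0 = 0`. -/
def jumpU (ξ : ℝ) : ℕ → ℝ
  | 0 => 0
  | 1 => 1
  | n + 2 => 2 * ξ * jumpU ξ (n + 1) - jumpU ξ n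

theorem jumpU_one : ∀ n, jumpU 1 n = n
  | 0 => by simp [jumpU]
  | 1 => by simp [jumpU]
  | n + 2 => by rw [jumpU, jumpU_one n, jumpU_one (n + 1)]; push_cast; ring

theorem continuous_jumpU : ∀ n, Continuous fun ξ => jumpU ξ n
  | 0 => by simp only [jumpU]; fun_prop
  | 1 => by simp only [jumpU]; fun_prop
  | n + 2 => by
    have h1 := continuous_jumpU n
    have h2 := continuous_jumpU (n + 1)
    simp only [jumpU]; fun_prop

theorem rec_jump (hf : ∀ i, p ≤ i → i + 2 ≤ q → f (i + 2) + f i = 2 * ξ * f (i + 1)) :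
    ∀ (L : ℕ) {i : ℕ}, p + L + 1 ≤ i → i + L + 1 ≤ q →
      f (i + L + 1) - f (i - (L + 1)) = jumpU ξ (L + 1) * (f (i + 1) - f (i - 1))
  | 0, i, h1, h2 => by simp [jumpU]
  | 1, i, h1, h2 => by
    obtain ⟨j, rfl⟩ : ∃ j, i = j + 2 := ⟨i - 2, by omega⟩
    have e1 := hf (j + 2) (by omega) (by omega)
    have e2 := hf j (by omega) (by omega)
    simp only [jumpU, show j + 2 - (1 + 1) = j by omega,
      show j + 2 - 1 = j + 1 by omega]
    simp only [add_assoc] at e1 e2 ⊢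
    norm_num at e1 e2 ⊢
    linear_combination e1 - e2
  | L + 2, i, h1, h2 => by
    have i1 := rec_jump hf L (i := i) (by omega) (by omega)
    have i2 := rec_jump hf (L + 1) (i := i) (by omega) (by omega)
    obtain ⟨j, rfl⟩ : ∃ j, i = j + L + 3 := ⟨i - L - 3, by omega⟩
    have e1 := hf (j + L + 3 + L + 1) (by omega) (by omega)
    have e2 := hf j (by omega) (by omega)
    rw [show j + L + 3 - (L + 1) = j + 2 by omega] at i1
    rw [show j + L + 3 - (L + 1 + 1) = j + 1 by omega] at i2
    rw [show j + L + 3 - (L + 2 + 1) = j by omega]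
    change _ = (2 * ξ * jumpU ξ (L + 2) - jumpU ξ (L + 1)) * _
    rw [sub_mul, mul_assoc, ← i1, ← i2]
    rw [show j + L + 3 + L + 1 + 2 = j + L + 3 + (L + 2) + 1 by omega,
      show j + L + 3 + L + 1 + 1 = j + L + 3 + (L + 1) + 1 by omega] at e1
    linear_combination e1 - e2

/-- Near `ξ = 1` a solution with large conserved quantity has large norm. -/
theorem rec_near_one (hf : ∀ i, p ≤ i → i + 2 ≤ q → f (i + 2) + f i = 2 * ξ * f (i + 1))
    (L : ℕ) {S : ℝ} (hS : ∑ i ∈ Finset.Icc p q, f i ^ 2 ≤ S) (hpq : p + 2 * (L + 1) ≤ q)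
    {c : ℝ} (hc : 1 - ξ ^ 2 ≤ c) (hc0 : 0 ≤ c)
    (hE0 : 0 ≤ f p ^ 2 + f (p + 1) ^ 2 - 2 * ξ * f p * f (p + 1)) :
    jumpU ξ (L + 1) ^ 2 * ((q - p - 2 * (L + 1)) *
      (f p ^ 2 + f (p + 1) ^ 2 - 2 * ξ * f p * f (p + 1)) - c * S) ≤ S := by
  set E := f p ^ 2 + f (p + 1) ^ 2 - 2 * ξ * f p * f (p + 1) with hE
  set T := Finset.Icc (p + L + 1) (q - (L + 1)) with hT
  have hterm : ∀ i ∈ T, jumpU ξ (L + 1) ^ 2 * (E - c * f i ^ 2) ≤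
      (f (i + L + 1) ^ 2 + f (i - (L + 1)) ^ 2) / 2 := by
    intro i hi
    rw [hT, Finset.mem_Icc] at hi
    have h1 := rec_jump hf L (i := i) (by omega) (by omega)
    obtain ⟨j, rfl⟩ : ∃ j, i = j + 1 := ⟨i - 1, by omega⟩
    have h2 := rec_conserved hf (i := j) (by omega) (by omega)
    have h3 := hf j (by omega) (by omega)
    rw [Nat.add_sub_cancel] at h1
    have h4 : (f (j + 1 + 1) - f j) ^ 2 = 4 * (E - (1 - ξ ^ 2) * f (j + 1) ^ 2) := by
      rw [hE, ← h2]
      have h3' : f (j + 1 + 1) = 2 * ξ * f (j + 1) - f j := by linarith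
      rw [h3']; ring
    have h5 : E - c * f (j + 1) ^ 2 ≤ (f (j + 1 + 1) - f j) ^ 2 / 4 := by
      rw [h4]; nlinarith [sq_nonneg (f (j + 1))]
    calc _ ≤ jumpU ξ (L + 1) ^ 2 * ((f (j + 1 + 1) - f j) ^ 2 / 4) := by gcongr
      _ = (f (j + 1 + L + 1) - f (j + 1 - (L + 1))) ^ 2 / 4 := by rw [h1]; ring
      _ ≤ _ := by nlinarith [sq_nonneg (f (j + 1 + L + 1) + f (j + 1 - (L + 1)))]
  have hcard : ((T.card : ℕ) : ℝ) = q - p - 2 * (L + 1) + 1 := by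
    rw [hT, Nat.card_Icc]
    have : q - (L + 1) + 1 - (p + L + 1) + (p + 2 * (L + 1)) = q + 1 := by omega
    have h : ((q - (L + 1) + 1 - (p + L + 1) : ℕ) : ℝ) + (p + 2 * (L + 1)) = q + 1 := by
      exact_mod_cast this
    linarith
  have hsub : ∀ φ : ℕ → ℕ, (∀ i ∈ T, φ i ∈ Finset.Icc p q) → Set.InjOn φ T →
      ∑ i ∈ T, f (φ i) ^ 2 ≤ S := by
    intro φ h1 h2
    rw [← Finset.sum_image (g := φ) (f := fun i => f i ^ 2) h2]
    exact (Finset.sum_le_sum_of_subset_of_nonneg (Finset.image_subset_iff.2 h1)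
      fun _ _ _ => sq_nonneg _).trans hS
  have s1 := hsub id (fun i hi => by simp [hT] at hi ⊢; omega) (fun _ _ _ _ h => h)
  have s2 := hsub (fun i => i + L + 1) (fun i hi => by simp [hT] at hi ⊢; omega)
    (fun i _ j _ h => by simpa using h)
  have s3 := hsub (fun i => i - (L + 1)) (fun i hi => by simp [hT] at hi ⊢; omega)
    (fun i hi j hj h => by simp [hT] at hi hj h; omega)
  have hsum := Finset.sum_le_sum hterm
  rw [← Finset.mul_sum, Finset.sum_sub_distrib, Finset.sum_const, ← Finset.mul_sum,
    ← Finset.sum_div, Finset.sum_add_distrib, nsmul_eq_mul, hcard] at hsum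
  simp only [id] at s1
  have hfin : jumpU ξ (L + 1) ^ 2 * ((q - p - 2 * (L + 1)) * E - c * S) ≤
      jumpU ξ (L + 1) ^ 2 * ((q - p - 2 * (L + 1) + 1) * E - c * ∑ i ∈ T, f i ^ 2) := by
    refine mul_le_mul_of_nonneg_left ?_ (sq_nonneg _)
    have := mul_le_mul_of_nonneg_left s1 hc0
    linarith
  linarith

end Recurrence

namespace Arr

variable {A : Arr} {h : ℕ}

theorem Reg.a_zero (hA : A.Reg) : A.a 0 = 0 := by
  have := hA.sum 0 (Nat.zero_le _)
  omega

theorem Reg.sum_one (hA : A.Reg) : 1 + A.a 1 + A.b 1 = A.b 0 := by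
  have := hA.sum 1 (by have := hA.two_le; omega)
  rwa [hA.c_one] at this

theorem Head.a_eq (hh : A.Head h) (hA : A.Reg) {i : ℕ} (h1 : 1 ≤ i) (h2 : i ≤ h) :
    A.a i = A.a 1 := by
  have := hA.sum i (by have := hh.lt; omega)
  have := hA.sum_one
  have := hh.c_eq i h1 h2
  have := hh.b_eq i h1 h2
  omega

theorem Head.bet_eq (hh : A.Head h) {i : ℕ} (h1 : 1 ≤ i) (h2 : i + 1 ≤ h) :
    A.bet i = A.b 1 := by
  rw [bet, hh.b_eq i h1 (by omega), hh.c_eq (i + 1) (by omega) h2, mul_one]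

theorem Reg.bet_zero (hA : A.Reg) : A.bet 0 = A.b 0 := by
  rw [bet, zero_add, hA.c_one, mul_one]

theorem Head.two_le_b (hh : A.Head h) (hA : A.Reg) (h2 : 2 ≤ h) : 2 ≤ A.b 1 :=
  hA.b_one (hh.c_eq 2 (by omega) h2)

/-- The normalised coordinate in which the band of the head is `[-1, 1]`. -/
noncomputable def xi (A : Arr) (x : ℝ) : ℝ := (x - A.a 1) / (2 * √(A.b 1 : ℝ))

/-- The quantity conserved along the head. -/
noncomputable def En (A : Arr) (x : ℝ) : ℝ :=
  (A.b 0 - x) * (A.b 0 + (A.a 1 + 1) * x) / (A.b 0 * A.b 1)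

theorem Head.e_rec (hh : A.Head h) (hA : A.Reg) (x : ℝ) {i : ℕ} (h1 : 1 ≤ i) (h2 : i + 2 ≤ h) :
    A.e (i + 2) x + A.e i x = 2 * A.xi x * A.e (i + 1) x := by
  have h3 := hA.e_rec (i := i) (by have := hh.lt; omega) (hh.a_eq hA (by omega) (by omega))
    (hh.bet_eq h1 (by omega)) (hh.bet_eq (by omega) (by omega)) x
  have h4 : (0 : ℝ) < √(A.b 1 : ℝ) := Real.sqrt_pos.2 (by
    exact_mod_cast (by have := hh.two_le_b hA (by omega); omega : 0 < A.b 1))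
  rw [xi]
  field_simp
  linarith

theorem Head.energy (hh : A.Head h) (hA : A.Reg) (h2 : 2 ≤ h) (x : ℝ) :
    A.e 1 x ^ 2 + A.e (1 + 1) x ^ 2 - 2 * A.xi x * A.e 1 x * A.e (1 + 1) x = A.En x := by
  have e1 := hA.sqrt_mul_e_one x
  have e2 := hA.sqrt_mul_e x (n := 0) (by have := hh.lt; omega)
  have hk : (0 : ℝ) < A.b 0 := by exact_mod_cast (by have := hA.three_le; omega : 0 < A.b 0)
  have hb : (0 : ℝ) < A.b 1 := by
    exact_mod_cast (by have := hh.two_le_b hA (by omega); omega : 0 < A.b 1)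
  rw [hA.bet_zero, hA.a_zero, e_zero] at e1
  rw [hA.bet_zero, zero_add, hh.bet_eq le_rfl h2, e_zero, zero_add] at e2
  have hs : (1 : ℝ) + A.a 1 + A.b 1 = A.b 0 := by exact_mod_cast hA.sum_one
  have hk' := Real.sqrt_pos.2 hk
  have hb' := Real.sqrt_pos.2 hb
  have hk2 := Real.sq_sqrt hk.le
  have hb2 := Real.sq_sqrt hb.le
  have e1' : A.e 1 x = x / √(A.b 0 : ℝ) := by field_simp; push_cast at e1; linarith
  have e2' : A.e 2 x = ((x - A.a 1) * A.e 1 x - √(A.b 0 : ℝ)) / √(A.b 1 : ℝ) := by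
    field_simp; linarith
  have ha : (A.a 1 : ℝ) = √(A.b 0 : ℝ) ^ 2 - 1 - √(A.b 1 : ℝ) ^ 2 := by linarith
  have hE : A.En x = (√(A.b 0 : ℝ) ^ 2 - x) * (√(A.b 0 : ℝ) ^ 2 + (A.a 1 + 1) * x) /
      (√(A.b 0 : ℝ) ^ 2 * √(A.b 1 : ℝ) ^ 2) := by rw [hk2, hb2, En]
  rw [hE, xi, show 1 + 1 = 2 from rfl, e2', e1', ha]
  field_simp
  ring

end Arr

theorem abs_disc_split {S G : Finset ℝ} (hG : G ⊆ S) {M : ℝ} (hM : 1 ≤ M)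
    (hS : ∀ x ∈ S, ∀ y ∈ S, |x - y| ≤ M) :
    |∏ x ∈ S, ∏ y ∈ S.erase x, (x - y)| ≤
      |∏ x ∈ G, ∏ y ∈ G.erase x, (x - y)| * M ^ (2 * S.card * (S \ G).card) := by
  classical
  simp only [Finset.abs_prod]
  have h1 : ∏ x ∈ S, ∏ y ∈ S.erase x, |x - y| =
      (∏ x ∈ S \ G, ∏ y ∈ S.erase x, |x - y|) * ∏ x ∈ G, ∏ y ∈ S.erase x, |x - y| :=
    (Finset.prod_sdiff hG).symm
  have h2 : ∏ x ∈ S \ G, ∏ y ∈ S.erase x, |x - y| ≤ M ^ (S.card * (S \ G).card) := by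
    rw [pow_mul, ← Finset.prod_const]
    refine Finset.prod_le_prod (fun _ _ => Finset.prod_nonneg fun _ _ => abs_nonneg _)
      fun x hx => ?_
    calc ∏ y ∈ S.erase x, |x - y| ≤ ∏ y ∈ S.erase x, M :=
          Finset.prod_le_prod (fun _ _ => abs_nonneg _) fun y hy =>
            hS x (Finset.mem_sdiff.1 hx).1 y (Finset.mem_of_mem_erase hy)
      _ ≤ M ^ S.card := by
          rw [Finset.prod_const]
          exact pow_le_pow_right₀ hM (Finset.card_le_card (Finset.erase_subset _ _))
  have h3 : ∏ x ∈ G, ∏ y ∈ S.erase x, |x - y| ≤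
      (∏ x ∈ G, ∏ y ∈ G.erase x, |x - y|) * M ^ (S.card * (S \ G).card) := by
    calc ∏ x ∈ G, ∏ y ∈ S.erase x, |x - y|
        ≤ ∏ x ∈ G, ((∏ y ∈ G.erase x, |x - y|) * M ^ (S \ G).card) := by
          refine Finset.prod_le_prod (fun _ _ => Finset.prod_nonneg fun _ _ => abs_nonneg _)
            fun x hx => ?_
          have hsub : G.erase x ⊆ S.erase x := Finset.erase_subset_erase _ hG
          rw [← Finset.prod_sdiff hsub, mul_comm]
          have hsd : S.erase x \ G.erase x = S \ G := by
            ext y; simp only [Finset.mem_sdiff, Finset.mem_erase]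
            constructor
            · rintro ⟨⟨h1, h2⟩, h3⟩; exact ⟨h2, fun h => h3 ⟨h1, h⟩⟩
            · rintro ⟨h1, h2⟩
              exact ⟨⟨fun h => h2 (h ▸ hx), h1⟩, fun h => h2 h.2⟩
          rw [hsd]
          refine mul_le_mul_of_nonneg_left ?_ (Finset.prod_nonneg fun _ _ => abs_nonneg _)
          rw [← Finset.prod_const]
          exact Finset.prod_le_prod (fun _ _ => abs_nonneg _) fun y hy =>
            hS x (hG hx) y (Finset.mem_sdiff.1 hy).1
      _ = (∏ x ∈ G, ∏ y ∈ G.erase x, |x - y|) * M ^ ((S \ G).card * G.card) := by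
          rw [Finset.prod_mul_distrib, Finset.prod_const, pow_mul]
      _ ≤ _ := by
          refine mul_le_mul_of_nonneg_left (pow_le_pow_right₀ hM ?_)
            (Finset.prod_nonneg fun _ _ => Finset.prod_nonneg fun _ _ => abs_nonneg _)
          rw [mul_comm]
          exact Nat.mul_le_mul_right _ (Finset.card_le_card hG)
  rw [h1]
  calc _ ≤ M ^ (S.card * (S \ G).card) *
        ((∏ x ∈ G, ∏ y ∈ G.erase x, |x - y|) * M ^ (S.card * (S \ G).card)) :=
        mul_le_mul h2 h3 (Finset.prod_nonneg fun _ _ => Finset.prod_nonneg fun _ _ => abs_nonneg _)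
          (by positivity)
    _ = _ := by rw [mul_assoc 2, two_mul, pow_add]; ring

/-- The two roots of `Z² - 2ξZ + 1` for `|ξ| ≥ 1`. -/
theorem exists_add_inv_eq {ξ : ℝ} (h : 1 ≤ |ξ|) :
    ∃ z : ℝ, z ≠ 0 ∧ z + z⁻¹ = 2 * ξ ∧ |ξ| ≤ |z| ∧ |z| ≤ 2 * |ξ| := by
  have h1 : 1 ≤ ξ ^ 2 := by rw [← sq_abs]; nlinarith
  have h2 := Real.sq_sqrt (by linarith : (0 : ℝ) ≤ ξ ^ 2 - 1)
  have h3 := Real.sqrt_nonneg (ξ ^ 2 - 1)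
  have h4 : √(ξ ^ 2 - 1) ≤ |ξ| := by
    rw [← Real.sqrt_sq_eq_abs]; exact Real.sqrt_le_sqrt (by linarith)
  set s := √(ξ ^ 2 - 1)
  rcases le_total 0 ξ with h0 | h0
  · rw [abs_of_nonneg h0] at *
    have hz : 0 < ξ + s := by linarith
    refine ⟨ξ + s, hz.ne', ?_, ?_, ?_⟩
    · field_simp; linear_combination h2
    · rw [abs_of_pos hz]; linarith
    · rw [abs_of_pos hz]; linarith
  · rw [abs_of_nonpos h0] at *
    have hz : ξ - s < 0 := by linarith
    refine ⟨ξ - s, hz.ne, ?_, ?_, ?_⟩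
    · have := hz.ne
      field_simp; linear_combination h2
    · rw [abs_of_neg hz]; linarith
    · rw [abs_of_neg hz]; linarith

namespace Arr

variable {A : Arr} {h : ℕ}

theorem e_sq_le_F (A : Arr) (x : ℝ) {i : ℕ} (hi : i ≤ A.D) : A.e i x ^ 2 ≤ A.F x := by
  rw [F_eq]
  exact Finset.single_le_sum (f := fun i => A.e i x ^ 2) (fun _ _ => sq_nonneg _)
    (Finset.mem_range.2 (by omega))

theorem sum_e_sq_le_F (A : Arr) (x : ℝ) {p q : ℕ} (hq : q ≤ A.D) :
    ∑ i ∈ Finset.Icc p q, A.e i x ^ 2 ≤ A.F x := by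
  rw [F_eq]
  refine Finset.sum_le_sum_of_subset_of_nonneg (fun i hi => ?_) fun _ _ _ => sq_nonneg _
  simp at hi ⊢; omega

theorem En_le (hA : A.Reg) (hb : 1 ≤ A.b 1) {x : ℝ} (hx : |x| ≤ A.b 0) :
    |A.En x| ≤ 2 * A.b 0 * (1 + A.b 0) := by
  have hk : (1 : ℝ) ≤ A.b 0 := by exact_mod_cast (by have := hA.three_le; omega : 1 ≤ A.b 0)
  have hb' : (1 : ℝ) ≤ A.b 1 := by exact_mod_cast hb
  have ha : (A.a 1 : ℝ) + 1 ≤ A.b 0 := by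
    exact_mod_cast (by have := hA.sum_one; omega : A.a 1 + 1 ≤ A.b 0)
  have h1 : |(A.b 0 : ℝ) - x| ≤ 2 * A.b 0 := by
    rw [abs_le] at hx ⊢; constructor <;> linarith
  have h2 : |(A.b 0 : ℝ) + (A.a 1 + 1) * x| ≤ A.b 0 * (1 + A.b 0) := by
    refine (abs_add_le _ _).trans ?_
    rw [abs_mul, abs_of_pos (by linarith), abs_of_pos (by positivity : (0 : ℝ) < A.a 1 + 1)]
    nlinarith [abs_nonneg x]
  rw [En, abs_div, abs_mul, abs_of_pos (by positivity : (0 : ℝ) < (A.b 0 : ℝ) * A.b 1),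
    div_le_iff₀ (by positivity)]
  calc _ ≤ 2 * (A.b 0 : ℝ) * (A.b 0 * (1 + A.b 0)) := mul_le_mul h1 h2 (abs_nonneg _) (by positivity)
    _ ≤ 2 * (A.b 0 : ℝ) * (A.b 0 * (1 + A.b 0)) * A.b 1 := le_mul_of_one_le_right (by positivity) hb'
    _ = _ := by ring

/-- Eigenvalues in the middle of the band of the head with large degree and small norm. -/
theorem exists_head_good (k : ℕ) : ∃ κ : ℝ, 0 < κ ∧ ∀ n₀ : ℕ, ∃ N : ℕ, ∀ (A : Arr) (h : ℕ), A.Reg →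
    A.b 0 = k → A.Head h → N ≤ h → ∃ x ∈ A.nodes, |A.xi x| ≤ 1 / 2 ∧ A.F x ≤ κ * h ∧
      n₀ < (A.cls x).card := by
  classical
  refine ⟨2 ^ (2 * k + 11) * (k * (k + 1) + 1), by positivity, fun n₀ => ?_⟩
  set Z := (ConjSet.finite_of_card_le n₀ k).toFinset with hZ
  refine ⟨128 * Z.card + 130, fun A h hA hk hh hN => ?_⟩
  have hb2 := hh.two_le_b hA (by omega)
  have hb0 : (0 : ℝ) < A.b 1 := by exact_mod_cast (by omega : 0 < A.b 1)
  have hb' := Real.sqrt_pos.2 hb0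
  have hm : (h - 2) / 16 * 16 ≤ h - 2 := Nat.div_mul_le_self _ _
  have hD := hh.lt
  have hgc := hA.good_count (a := A.a 1) (β := A.b 1) (u := 1) (m := (h - 2) / 16) (W := 16)
    (α := Real.pi / 2) (δ := √(A.b 1 : ℝ)) hb' (by omega)
    (by rw [Real.sq_sqrt hb0.le]; push_cast; linarith) (by norm_num)
    (fun i h1 h2 => hh.a_eq hA (by omega) (by omega)) (fun i h1 h2 => hh.bet_eq h1 (by omega))
  simp only [Real.cos_pi_div_two, mul_zero, add_zero] at hgc
  have hmh : (h : ℝ) / 32 ≤ ((h - 2) / 16 : ℕ) := by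
    rw [div_le_iff₀ (by norm_num)]
    exact_mod_cast (by omega : h ≤ (h - 2) / 16 * 32)
  set m := (h - 2) / 16
  have hh0 : (0 : ℝ) < h := by exact_mod_cast (by omega : 0 < h)
  set T : Finset ℝ := A.nodes.filter fun x : ℝ => |x - A.a 1| ≤ √(A.b 1 : ℝ) ∧
      m * A.F x ≤ 4 * (A.D + 1) * ∑ i ∈ Finset.range (m * 16), A.e (1 + 1 + i) x ^ 2 with hT
  have hcard : Z.card < T.card := by
    have : (128 * Z.card + 130 : ℝ) ≤ h := by exact_mod_cast hN
    have : (Z.card : ℝ) < T.card := by linarith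
    exact_mod_cast this
  obtain ⟨x, hxT, hxZ⟩ : ∃ x ∈ T, x ∉ Z := Finset.exists_mem_notMem_of_card_lt_card hcard
  rw [hT, Finset.mem_filter] at hxT
  obtain ⟨hx, hxa, hxF⟩ := hxT
  have hxk : |x| ≤ A.b 0 := hA.abs_le (mem_nodes.1 hx)
  have hxi : |A.xi x| ≤ 1 / 2 := by
    rw [xi, abs_div, abs_of_pos (by positivity : (0 : ℝ) < 2 * √(A.b 1 : ℝ)),
      div_le_iff₀ (by positivity)]
    linarith
  refine ⟨x, hx, hxi, ?_, ?_⟩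
  · have he : ∀ i ∈ Finset.range (m * 16), A.e (1 + 1 + i) x ^ 2 ≤ 4 * (k * (k + 1)) := by
      intro i hi
      rw [Finset.mem_range] at hi
      have h1 := rec_sq_le (f := fun i => A.e i x) (ξ := A.xi x) (p := 1) (q := h)
        (fun i h1 h2 => hh.e_rec hA x h1 h2) (by omega) (i := 1 + 1 + i) (by omega) (by omega)
      rw [hh.energy hA (by omega)] at h1
      have h2 := (le_abs_self _).trans (En_le hA (by omega) hxk)
      have h3 : A.xi x ^ 2 ≤ 1 / 4 := by rw [← sq_abs]; nlinarith [abs_nonneg (A.xi x)]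
      rw [hk] at h2
      nlinarith [sq_nonneg (A.e (1 + 1 + i) x)]
    have hs := Finset.sum_le_sum he
    rw [Finset.sum_const, Finset.card_range, nsmul_eq_mul] at hs
    have hDk : (A.D + 1 : ℝ) ≤ 2 ^ (2 * k + 2) * h := by
      have := hh.D_lt hA
      rw [hk] at this
      have h3 : 2 ^ (2 * k + 1) * (h + 1) ≤ 2 ^ (2 * k + 1) * (2 * h) := by gcongr; omega
      exact_mod_cast (by rw [pow_succ]; linarith : A.D + 1 ≤ 2 ^ (2 * k + 2) * h)
    have hmh' : ((m * 16 : ℕ) : ℝ) ≤ h := by exact_mod_cast (by omega : m * 16 ≤ h)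
    have h4 : (h : ℝ) / 32 * A.F x ≤ 4 * (2 ^ (2 * k + 2) * h) * (h * (4 * (k * (k + 1)))) := by
      calc (h : ℝ) / 32 * A.F x ≤ m * A.F x := by
            gcongr; exact zero_le_one.trans (A.one_le_F x)
        _ ≤ _ := hxF
        _ ≤ 4 * (A.D + 1) * (((m * 16 : ℕ) : ℝ) * (4 * (k * (k + 1)))) := by gcongr
        _ ≤ _ := by gcongr
    have h5 : (h : ℝ) / 32 * A.F x ≤ h / 32 * (2 ^ (2 * k + 11) * (k * (k + 1)) * h) := by
      refine h4.trans (le_of_eq ?_)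
      rw [pow_add, pow_add]; ring
    have h6 := le_of_mul_le_mul_left h5 (by positivity)
    refine h6.trans ?_
    gcongr; linarith
  · by_contra hc
    apply hxZ
    rw [hZ, Set.Finite.mem_toFinset]
    exact ⟨A.cls x, hA.conjSet hx, mem_cls_self hx, not_lt.1 hc, fun y hy => by
      rw [← hk]; exact hA.abs_le (mem_nodes.1 (cls_subset A x hy))⟩

/-- Outside of the band of the head the norm controls the energy. -/
theorem Head.pow_mul_En_le (hh : A.Head h) (hA : A.Reg) (h2 : 2 ≤ h) {x z : ℝ} (hz : z ≠ 0)
    (hz1 : 1 ≤ |z|) (hzx : z + z⁻¹ = 2 * A.xi x) :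
    |z| ^ (h - 2) * |A.En x| ≤ 2 * (1 + |z|) * A.F x := by
  obtain ⟨j, rfl⟩ : ∃ j, h = j + 2 := ⟨h - 2, by omega⟩
  have hD := hh.lt
  have h1 := rec_geom (f := fun i => A.e i x) (ξ := A.xi x) (p := 1) (q := j + 2)
    (fun i h1 h2 => hh.e_rec hA x h1 h2) (z := z) (w := z⁻¹) (mul_inv_cancel₀ hz) hzx (i := j)
    (by omega)
  have h3 := hh.energy hA h2 x
  have h4 : (A.e (1 + 1) x - z⁻¹ * A.e 1 x) * (A.e (1 + 1) x - z * A.e 1 x) = A.En x := by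
    rw [← h3, ← hzx]; field_simp; ring
  have hF0 : 0 ≤ A.F x := zero_le_one.trans (A.one_le_F x)
  have hb : ∀ i ≤ A.D, |A.e i x| ≤ √(A.F x) := fun i hi => by
    rw [← Real.sqrt_sq_eq_abs]; exact Real.sqrt_le_sqrt (A.e_sq_le_F x hi)
  have hzi : |z⁻¹| ≤ 1 := by rw [abs_inv]; exact inv_le_one_of_one_le₀ hz1
  rw [Nat.add_sub_cancel, ← abs_pow, ← abs_mul, ← h4, ← mul_assoc, ← h1, abs_mul]
  have h5 : |A.e (1 + j + 1) x - z⁻¹ * A.e (1 + j) x| ≤ 2 * √(A.F x) := by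
    refine (abs_sub _ _).trans ?_
    rw [abs_mul]
    nlinarith [hb (1 + j + 1) (by omega), hb (1 + j) (by omega), abs_nonneg (A.e (1 + j) x)]
  have h6 : |A.e (1 + 1) x - z * A.e 1 x| ≤ (1 + |z|) * √(A.F x) := by
    refine (abs_sub _ _).trans ?_
    rw [abs_mul]
    nlinarith [hb (1 + 1) (by omega), hb 1 (by omega), abs_nonneg z]
  calc _ ≤ (2 * √(A.F x)) * ((1 + |z|) * √(A.F x)) :=
        mul_le_mul h5 h6 (abs_nonneg _) (by positivity)
    _ = 2 * (1 + |z|) * √(A.F x) ^ 2 := by ring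
    _ = _ := by rw [Real.sq_sqrt hF0]

end Arr

open Polynomial in
theorem abs_prod_le_pow {S : Finset ℝ} {g : ℤ[X]} {M : ℝ}
    (h : ∀ x ∈ S, |aeval x g| ≤ M) : |∏ x ∈ S, aeval x g| ≤ M ^ S.card := by
  rw [Finset.abs_prod, ← Finset.prod_const]
  exact Finset.prod_le_prod (fun _ _ => abs_nonneg _) h

theorem eventually_mul_pow_le (C : ℝ) {q : ℝ} (h0 : 0 < q) (h1 : q < 1) :
    ∀ᶠ h : ℕ in atTop, C * h * q ^ h ≤ √q ^ h := by
  have hs0 := Real.sqrt_pos.2 h0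
  have hs1 : √q < 1 := by rw [Real.sqrt_lt' one_pos]; linarith
  have ht := (tendsto_self_mul_const_pow_of_lt_one hs0.le hs1).const_mul C
  rw [mul_zero] at ht
  filter_upwards [ht.eventually (gt_mem_nhds one_pos)] with h hh
  have : q ^ h = √q ^ h * √q ^ h := by rw [← mul_pow, Real.mul_self_sqrt h0.le]
  rw [this]
  have hp : 0 < √q ^ h := by positivity
  nlinarith

namespace Arr

variable {A : Arr} {h : ℕ}

theorem xi_eq_iff (hb : 1 ≤ A.b 1) (x : ℝ) : x = A.a 1 + 2 * √(A.b 1 : ℝ) * A.xi x := by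
  have hb' : (0 : ℝ) < √(A.b 1 : ℝ) := Real.sqrt_pos.2 (by exact_mod_cast hb)
  rw [xi]; field_simp; ring

set_option maxHeartbeats 1000000 in
/-- Eigenvalues of small norm lie in the band of the head, away from its right end, or are nearly
zeros of the energy. -/
theorem head_conj {k b : ℕ} (hb : 2 ≤ b) (hbk : 1 + b ≤ k) {κ : ℝ} (hκ : 0 < κ) :
    ∃ ε ρ : ℝ, 0 < ε ∧ ε ≤ 1 / 2 ∧ 0 < ρ ∧ ρ < 1 ∧ ∃ N : ℕ, ∀ (A : Arr) (h : ℕ), A.Reg →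
      A.b 0 = k → A.b 1 = b → A.Head h → N ≤ h → ∀ x : ℝ, |x| ≤ k → A.F x ≤ κ * h →
      (-(1 + ε / 2) ≤ A.xi x ∧ A.xi x ≤ 1 - ε) ∨
        |((k : ℝ) - x) * (k + (A.a 1 + 1) * x)| ≤ ρ ^ h := by
  set r := √(b : ℝ) with hr
  have hb0 : (2 : ℝ) ≤ b := by exact_mod_cast hb
  have hr2 : r ^ 2 = b := Real.sq_sqrt (by linarith)
  have hr1 : 1 < r := by
    have : 0 ≤ r := Real.sqrt_nonneg _
    nlinarith
  set a : ℝ := k - 1 - b with ha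
  have ha0 : 0 ≤ a := by
    have : (1 + b : ℝ) ≤ k := by exact_mod_cast hbk
    linarith
  have hk0 : (0 : ℝ) < k := by linarith
  set g : ℝ → ℝ := fun ξ => (k - (a + 2 * r * ξ)) * (k + (a + 1) * (a + 2 * r * ξ)) / (k * b) with hg
  have hgc : Continuous g := by simp only [hg]; fun_prop
  have hg1 : 0 < g 1 := by
    have e1 : (k : ℝ) - (a + 2 * r * 1) = (r - 1) ^ 2 := by rw [ha, ← hr2]; ring
    simp only [hg]
    rw [e1]
    have : 0 < (r - 1) ^ 2 := by have : 0 < r - 1 := by linarith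
                                 positivity
    positivity
  set E0 := g 1 / 2 with hE0
  have hE0p : 0 < E0 := by positivity
  obtain ⟨L, hL⟩ := exists_nat_gt (4 * κ / E0)
  have hev : ∀ᶠ ξ in nhds (1 : ℝ), E0 < g ξ ∧ ((L : ℝ) + 1) ^ 2 / 2 < jumpU ξ (L + 1) ^ 2 ∧
      1 - ξ ^ 2 < E0 / (4 * κ) := by
    refine (hgc.continuousAt.eventually (lt_mem_nhds (half_lt_self hg1))).and
      ((((continuous_jumpU (L + 1)).pow 2).continuousAt.eventually (lt_mem_nhds ?_)).and
      ((by fun_prop : Continuous fun ξ : ℝ => 1 - ξ ^ 2).continuousAt.eventually (gt_mem_nhds ?_)))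
    · simp only [Pi.pow_apply, jumpU_one]; push_cast; have : 0 < ((L : ℝ) + 1) ^ 2 := by positivity
      linarith
    · norm_num; positivity
  obtain ⟨ε₀, hε₀, hball⟩ := Metric.eventually_nhds_iff.1 hev
  set ε := min (ε₀ / 2) (1 / 2) with hε
  have hεp : 0 < ε := by positivity
  set q := (1 + ε / 2)⁻¹ with hq
  have hq0 : 0 < q := by positivity
  have hq1 : q < 1 := inv_lt_one_of_one_lt₀ (by linarith)
  obtain ⟨N, hN⟩ := eventually_atTop.1 (eventually_mul_pow_le (k * b * (2 * (1 + 2 * k) * κ) *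
    (1 + ε / 2) ^ 2) hq0 hq1)
  refine ⟨ε, √q, hεp, min_le_right _ _, Real.sqrt_pos.2 hq0,
    by rw [Real.sqrt_lt' one_pos]; linarith, max N (8 * L + 20), fun A h hA hAk hAb hh hh0 x hxk hF => ?_⟩
  have hN' := hN h (le_of_max_le_left hh0)
  have hhL := le_of_max_le_right hh0
  have hD := hh.lt
  have haA : (A.a 1 : ℝ) = a := by
    have := hA.sum_one
    rw [hAk, hAb] at this
    have : (1 + A.a 1 + b : ℝ) = k := by exact_mod_cast this
    rw [ha]; linarith
  have hx := xi_eq_iff (A := A) (by omega) x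
  rw [hAb, haA] at hx
  set ξ := A.xi x with hξ
  have hEn : A.En x = g ξ := by
    simp only [hg]; rw [← hx, En, hAk, hAb, haA]
  have hh1 : (0 : ℝ) < h := by exact_mod_cast (by omega : 0 < h)
  by_cases hξ1 : 1 - ε < ξ ∧ ξ < 1 + ε
  · exfalso
    obtain ⟨h1, h2, h3⟩ := hball (y := ξ) (by
      rw [Real.dist_eq, abs_lt]
      have : ε ≤ ε₀ / 2 := min_le_left _ _
      constructor <;> linarith)
    have h4 := rec_near_one (f := fun i => A.e i x) (p := 1) (q := h)
      (fun i h1 h2 => hh.e_rec hA x h1 h2) L ((A.sum_e_sq_le_F x hD.le).trans hF) (by omega)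
      (le_of_lt h3) (by positivity) (by rw [hh.energy hA (by omega), hEn]; linarith)
    rw [hh.energy hA (by omega), hEn] at h4
    have h5 : (3 / 4 : ℝ) * h ≤ h - (1 : ℕ) - 2 * (L + 1) := by
      have : (8 * L + 20 : ℝ) ≤ h := by exact_mod_cast hhL
      push_cast; linarith
    have h6 : (1 / 2 : ℝ) * h * E0 ≤
        (h - (1 : ℕ) - 2 * (L + 1)) * g ξ - E0 / (4 * κ) * (κ * h) := by
      have : E0 / (4 * κ) * (κ * h) = 1 / 4 * h * E0 := by field_simp
      rw [this]
      have : (3 / 4 : ℝ) * h * E0 ≤ (h - (1 : ℕ) - 2 * (L + 1)) * g ξ :=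
        mul_le_mul h5 h1.le hE0p.le (le_trans (by positivity) h5)
      linarith
    have h7 : ((L : ℝ) + 1) ^ 2 / 2 * ((1 / 2 : ℝ) * h * E0) ≤ κ * h :=
      (mul_le_mul h2.le h6 (by positivity) (sq_nonneg _)).trans h4
    have h8 : 4 * κ < L * E0 := by rwa [div_lt_iff₀ hE0p] at hL
    have h9 : ((L : ℝ) + 1) ^ 2 * E0 ≤ 4 * κ := by
      refine le_of_mul_le_mul_left ?_ hh1
      linarith
    have h10 : (L : ℝ) ≤ ((L : ℝ) + 1) ^ 2 := by nlinarith [Nat.cast_nonneg (α := ℝ) L]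
    have h11 := mul_le_mul_of_nonneg_right h10 hE0p.le
    linarith
  by_cases hξ2 : -(1 + ε / 2) ≤ ξ ∧ ξ ≤ 1 - ε
  · exact Or.inl hξ2
  right
  have hξa : 1 + ε / 2 ≤ |ξ| := by
    by_contra hc
    rw [not_le, abs_lt] at hc
    refine hξ2 ⟨hc.1.le, ?_⟩
    by_contra hc2
    exact hξ1 ⟨by linarith, by linarith⟩
  obtain ⟨z, hz0, hz1, hz2, hz3⟩ := exists_add_inv_eq (by linarith : 1 ≤ |ξ|)
  have h1 := hh.pow_mul_En_le hA (by omega) hz0 (by linarith) hz1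
  have hξk : |ξ| ≤ k := by
    rw [hξ, xi, hAb, haA, abs_div, abs_of_pos (by positivity : 0 < 2 * r), div_le_iff₀ (by positivity)]
    refine (abs_sub _ _).trans ?_
    rw [abs_of_nonneg ha0]
    have : a ≤ k := by rw [ha]; linarith
    nlinarith
  have hq' : 1 + ε / 2 = q⁻¹ := by rw [hq, inv_inv]
  have h2 : (1 + ε / 2) ^ (h - 2) * |A.En x| ≤ 2 * (1 + 2 * k) * (κ * h) := by
    calc _ ≤ |z| ^ (h - 2) * |A.En x| := by gcongr; linarith
      _ ≤ _ := h1
      _ ≤ _ := by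
        have := zero_le_one.trans (A.one_le_F x)
        gcongr; linarith
  have h3 : |((k : ℝ) - x) * (k + (A.a 1 + 1) * x)| = k * b * |A.En x| := by
    rw [En, hAk, hAb, abs_div, abs_of_pos (by positivity : (0 : ℝ) < k * b)]
    field_simp
  rw [h3]
  refine le_trans ?_ hN'
  have h4 : (1 + ε / 2) ^ h = (1 + ε / 2) ^ (h - 2) * (1 + ε / 2) ^ 2 := by
    rw [← pow_add]; congr 1; omega
  have h5 : q ^ h * (1 + ε / 2) ^ h = 1 := by rw [hq', ← mul_pow, mul_inv_cancel₀ hq0.ne', one_pow]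
  calc (k * b * |A.En x| : ℝ) = k * b * ((1 + ε / 2) ^ (h - 2) * |A.En x|) * (1 + ε / 2) ^ 2 * q ^ h := by
        rw [h4] at h5
        linear_combination -(k * b * |A.En x|) * h5
    _ ≤ k * b * (2 * (1 + 2 * k) * (κ * h)) * (1 + ε / 2) ^ 2 * q ^ h := by gcongr
    _ = _ := by ring

end Arr

theorem log_core_false {n g n' k τ h : ℕ} {ε r ν η L : ℝ}
    (hn : 2 ≤ n) (hg : g ≤ n) (hε : 0 < ε) (hε1 : ε ≤ 1 / 2)
    (hr : 2 ≤ r ^ 2) (hr0 : 0 < r) (hν : ν = η * ε / 16) (hτ : η * h ≤ τ) (hτ0 : 0 < τ)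
    (hk : 0 < Real.log (2 * k)) (hn' : n' ≤ ε / (64 * Real.log (2 * k)) * n)
    (hlog : 4 * Real.log (2 * n) ≤ (n - 1) * ε / 8)
    (hT : L ≤ n * (ν * h))
    (hmain : τ * (n * (n - 1)) * (2 * Real.log r) ≤ 2 * τ * (2 * Real.log (g.factorial * 2 ^ g) +
      g * (g - 1) * Real.log (r * (1 - ε / 4)) + 2 * n * n' * Real.log (2 * k)) + 2 * (n - 1) * L) :
    False := by
  have hn2 : (2 : ℝ) ≤ n := by exact_mod_cast hn
  have hgn : (g : ℝ) ≤ n := by exact_mod_cast hg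
  have hτ' : (0 : ℝ) < τ := by exact_mod_cast hτ0
  have h1 : Real.log (g.factorial * 2 ^ g) ≤ n * Real.log (2 * n) := by
    rw [← Real.log_pow]
    refine Real.log_le_log (by positivity) ?_
    have : g.factorial * 2 ^ g ≤ (2 * n) ^ n := by
      rw [mul_pow, mul_comm]
      exact Nat.mul_le_mul (Nat.pow_le_pow_right (by norm_num) hg)
        ((Nat.factorial_le hg).trans (Nat.factorial_le_pow n))
    exact_mod_cast this
  have h2 : 0 ≤ Real.log (r * (1 - ε / 4)) := by
    refine Real.log_nonneg ?_
    nlinarith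
  have h3 : (g : ℝ) * (g - 1) ≤ n * (n - 1) := by
    rcases Nat.eq_zero_or_pos g with rfl | hg0
    · simp; nlinarith
    · have : (1 : ℝ) ≤ g := by exact_mod_cast hg0
      nlinarith
  have h4 : Real.log (r * (1 - ε / 4)) ≤ Real.log r - ε / 4 := by
    rw [Real.log_mul hr0.ne' (by linarith)]
    linarith [Real.log_le_sub_one_of_pos (by linarith : 0 < 1 - ε / 4)]
  have h5 : (n' : ℝ) * Real.log (2 * k) ≤ ε / 64 * n := by
    calc (n' : ℝ) * Real.log (2 * k) ≤ ε / (64 * Real.log (2 * k)) * n * Real.log (2 * k) := by gcongr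
      _ = _ := by field_simp
  have h6 : (g : ℝ) * (g - 1) * Real.log (r * (1 - ε / 4)) ≤
      n * (n - 1) * (Real.log r - ε / 4) :=
    (mul_le_mul_of_nonneg_right h3 h2).trans (mul_le_mul_of_nonneg_left h4 (by nlinarith))
  have h7 : L ≤ n * (τ * ε / 16) := by
    refine hT.trans ?_
    rw [hν]
    gcongr
    nlinarith
  have h8 : 2 * ((n : ℝ) - 1) * L ≤ 2 * (n - 1) * (n * (τ * ε / 16)) :=
    mul_le_mul_of_nonneg_left h7 (by linarith)
  have h9 : (τ : ℝ) * (n * ((n - 1) * (2 * Real.log r))) ≤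
      τ * (n * (4 * Real.log (2 * n) + 2 * (n - 1) * (Real.log r - ε / 4) + 4 * (ε / 64 * n) +
        2 * (n - 1) * (ε / 16))) := by
    have : 2 * (τ : ℝ) * (2 * Real.log (g.factorial * 2 ^ g) +
      g * (g - 1) * Real.log (r * (1 - ε / 4)) + 2 * n * n' * Real.log (2 * k)) ≤
      2 * τ * (2 * (n * Real.log (2 * n)) + n * (n - 1) * (Real.log r - ε / 4) +
        2 * n * (ε / 64 * n)) := by
      have h10 : 2 * (n : ℝ) * n' * Real.log (2 * k) ≤ 2 * n * (ε / 64 * n) := by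
        rw [mul_assoc]; gcongr
      gcongr
    linarith
  have h10 := le_of_mul_le_mul_left (le_of_mul_le_mul_left h9 hτ') (by linarith)
  nlinarith

namespace Arr

theorem aeval_energy_poly (k a : ℕ) (x : ℝ) : Polynomial.aeval x
    (((Polynomial.C (k : ℤ) - Polynomial.X) *
      (Polynomial.C (k : ℤ) + Polynomial.C (a + 1 : ℤ) * Polynomial.X) : Polynomial ℤ)) =
    ((k : ℝ) - x) * (k + (a + 1) * x) := by
  simp

theorem band_energy_pos {A : Arr} (hA : A.Reg) (hb : 2 ≤ A.b 1) {x : ℝ} (hx : |A.xi x| < 1) :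
    0 < ((A.b 0 : ℝ) - x) * (A.b 0 + (A.a 1 + 1) * x) := by
  have hb0 : (2 : ℝ) ≤ A.b 1 := by exact_mod_cast hb
  have hs : (1 : ℝ) + A.a 1 + A.b 1 = A.b 0 := by exact_mod_cast hA.sum_one
  have h1 := xi_eq_iff (A := A) (by omega) x
  set r := √(A.b 1 : ℝ) with hr
  have hr2 : r ^ 2 = A.b 1 := Real.sq_sqrt (by linarith)
  have hr1 : 1 < r := by
    have : 0 ≤ r := Real.sqrt_nonneg _
    nlinarith
  obtain ⟨h2, h3⟩ := abs_lt.1 hx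
  have h4 : A.a 1 - 2 * r < x := by nlinarith
  have h5 : x < A.a 1 + 2 * r := by nlinarith
  have ha : (0 : ℝ) ≤ A.a 1 := Nat.cast_nonneg _
  refine mul_pos ?_ ?_
  · nlinarith [sq_nonneg (r - 1)]
  · have h6 : ((A.a 1 : ℝ) + 1) * (A.a 1 - 2 * r) < (A.a 1 + 1) * x := by gcongr
    nlinarith [sq_nonneg (r - (A.a 1 + 1)), sq_nonneg (A.a 1 : ℝ)]

set_option maxHeartbeats 1000000 in
/-- An array with a long head admits no integral form that is small on `[-k, k]` and highly
divisible at all places. -/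
theorem core {k b : ℕ} (hb : 2 ≤ b) (hbk : 1 + b ≤ k) {η : ℝ} (hη : 0 < η) :
    ∃ ν : ℝ, 0 < ν ∧ ∃ N : ℕ, ∀ (A : Arr) (h : ℕ), A.Reg → A.b 0 = k → A.b 1 = b → A.Head h →
      N ≤ h → ∀ (τ : ℕ) (R : Polynomial ℤ), η * h ≤ τ →
      (∀ x ∈ A.nodes, RatioDvd (A.a 1) b τ R x) →
      (∀ x : ℝ, |x| ≤ k → |Polynomial.aeval x R| ≤ Real.exp (ν * h)) →
      (∀ x ∈ A.nodes, |A.xi x| < 1 → Polynomial.aeval x R ≠ 0) → False := by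
  classical
  obtain ⟨κ, hκ, hgood⟩ := exists_head_good k
  obtain ⟨ε, ρ, hε, hε1, hρ, hρ1, N1, hconj⟩ := head_conj hb hbk hκ
  have hk3 : (3 : ℝ) ≤ k := by exact_mod_cast (by omega : 3 ≤ k)
  have hlk : 0 < Real.log (2 * k) := Real.log_pos (by linarith)
  have hlρ : Real.log ρ < 0 := Real.log_neg hρ hρ1
  obtain ⟨n₀, hn₀⟩ : ∃ n₀ : ℕ, ∀ n : ℕ, n₀ ≤ n → 4 * Real.log (2 * n) ≤ (n - 1) * ε / 8 := by
    have h1 : (fun n : ℕ => Real.log (2 * n)) =o[atTop] fun n : ℕ => (2 * n : ℝ) :=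
      Real.isLittleO_log_id_atTop.comp_tendsto
        (tendsto_natCast_atTop_atTop.const_mul_atTop (by norm_num))
    have h2 := h1.bound (by positivity : 0 < ε / 256)
    obtain ⟨M, hM⟩ := eventually_atTop.1 h2
    refine ⟨max M 2, fun n hn => ?_⟩
    have h3 := hM n (le_of_max_le_left hn)
    have hn2 : (2 : ℝ) ≤ n := by exact_mod_cast le_of_max_le_right hn
    rw [Real.norm_eq_abs, Real.norm_eq_abs, abs_of_pos (by linarith : (0 : ℝ) < 2 * n)] at h3
    have := (le_abs_self _).trans h3
    nlinarith
  obtain ⟨N2, hgood⟩ := hgood (n₀ + 2)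
  set K1 : ℝ := 2 * k * (k + k * k) with hK1
  have hK1p : 1 ≤ K1 := by rw [hK1]; nlinarith
  set ε2 := ε / (64 * Real.log (2 * k)) with hε2
  have hε2p : 0 < ε2 := by positivity
  obtain ⟨N3, hN3⟩ := exists_nat_gt (Real.log K1 / (-Real.log ρ * ε2))
  refine ⟨η * ε / 16, by positivity, max (max N1 N2) (max N3 2), ?_⟩
  intro A h hA hAk hAb hh hN τ R hτ hR hRle hRne
  have hh1 : N1 ≤ h := le_trans (le_trans (le_max_left _ _) (le_max_left _ _)) hN
  have hh2 : N2 ≤ h := le_trans (le_trans (le_max_right _ _) (le_max_left _ _)) hN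
  have hh3 : N3 ≤ h := le_trans (le_trans (le_max_left _ _) (le_max_right _ _)) hN
  have hh4 : 2 ≤ h := le_trans (le_trans (le_max_right _ _) (le_max_right _ _)) hN
  have hhp : (0 : ℝ) < h := by exact_mod_cast (by omega : 0 < h)
  obtain ⟨θ, hθ, hθb, hθF, hθn⟩ := hgood A h hA hAk hh hh2
  have hθb' : |A.xi θ| < 1 := by linarith
  set S := A.cls θ with hS
  have hSc := hA.conjSet hθ
  have hθS : θ ∈ S := mem_cls_self hθ
  have hSk : ∀ x ∈ S, |x| ≤ k := fun x hx => by
    rw [← hAk]; exact hA.abs_le (mem_nodes.1 (cls_subset A θ hx))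
  set G := S.filter fun x => -(1 + ε / 2) ≤ A.xi x ∧ A.xi x ≤ 1 - ε with hG
  have hGS : G ⊆ S := Finset.filter_subset _ _
  have hbad : ∀ x ∈ S \ G, |((k : ℝ) - x) * (k + (A.a 1 + 1) * x)| ≤ ρ ^ h := by
    intro x hx
    rw [Finset.mem_sdiff, hG, Finset.mem_filter, not_and] at hx
    have := hconj A h hA hAk hAb hh hh1 x (hSk x hx.1) (by
      rw [hA.F_eq_of_mem_cls hθ hx.1]; exact hθF)
    exact this.resolve_left (hx.2 hx.1)
  set n := S.card with hn
  set n' := (S \ G).card with hn'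
  have hn2 : 2 ≤ n := by omega
  have hn2' : (2 : ℝ) ≤ n := by exact_mod_cast hn2
  have haA : (A.a 1 : ℝ) + 1 ≤ k := by
    have := hA.sum_one
    rw [hAk] at this
    exact_mod_cast (by omega : A.a 1 + 1 ≤ k)
  -- few conjugates outside of the shrunken band
  have hn'le : (n' : ℝ) ≤ ε2 * n := by
    have h1 := hSc.one_le_abs_prod hθS (g := (Polynomial.C (k : ℤ) - Polynomial.X) *
      (Polynomial.C (k : ℤ) + Polynomial.C (A.a 1 + 1 : ℤ) * Polynomial.X)) (by
        rw [aeval_energy_poly, ← hAk]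
        exact (band_energy_pos hA (by omega) hθb').ne')
    rw [Finset.abs_prod, ← Finset.prod_sdiff hGS] at h1
    have h2 : ∏ x ∈ S \ G, |Polynomial.aeval x ((Polynomial.C (k : ℤ) - Polynomial.X) *
      (Polynomial.C (k : ℤ) + Polynomial.C (A.a 1 + 1 : ℤ) * Polynomial.X))| ≤ (ρ ^ h) ^ n' := by
      rw [← Finset.prod_const]
      refine Finset.prod_le_prod (fun _ _ => abs_nonneg _) fun x hx => ?_
      rw [aeval_energy_poly]; exact hbad x hx
    have h3 : ∏ x ∈ G, |Polynomial.aeval x ((Polynomial.C (k : ℤ) - Polynomial.X) *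
      (Polynomial.C (k : ℤ) + Polynomial.C (A.a 1 + 1 : ℤ) * Polynomial.X))| ≤ K1 ^ n := by
      calc _ ≤ ∏ x ∈ G, K1 := by
            refine Finset.prod_le_prod (fun _ _ => abs_nonneg _) fun x hx => ?_
            have hx := hSk x (hGS hx)
            rw [aeval_energy_poly, abs_mul, hK1]
            have h4 : |(k : ℝ) - x| ≤ 2 * k := by
              rw [abs_le] at hx ⊢; constructor <;> linarith
            have h5 : |(k : ℝ) + (A.a 1 + 1) * x| ≤ k + k * k := by
              refine (abs_add_le _ _).trans ?_
              rw [abs_mul, abs_of_pos (by linarith : (0 : ℝ) < k),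
                abs_of_pos (by positivity : (0 : ℝ) < A.a 1 + 1)]
              gcongr
            gcongr
        _ ≤ _ := by
            rw [Finset.prod_const]
            exact pow_le_pow_right₀ hK1p (Finset.card_le_card hGS)
    have h4 : 1 ≤ (ρ ^ h) ^ n' * K1 ^ n :=
      h1.trans (mul_le_mul h2 h3 (Finset.prod_nonneg fun _ _ => abs_nonneg _) (by positivity))
    have h5 := Real.log_nonneg h4
    rw [Real.log_mul (by positivity) (by positivity), Real.log_pow, Real.log_pow, Real.log_pow] at h5
    have h6 : Real.log K1 < h * (-Real.log ρ * ε2) := by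
      rw [div_lt_iff₀ (by nlinarith)] at hN3
      refine hN3.trans_le ?_
      have : (N3 : ℝ) ≤ h := by exact_mod_cast hh3
      have : 0 ≤ -Real.log ρ * ε2 := by nlinarith
      gcongr
    have h7 : (n' : ℝ) * (h * -Real.log ρ) ≤ ε2 * n * (h * -Real.log ρ) := by nlinarith
    exact le_of_mul_le_mul_right h7 (by nlinarith)
  -- the discriminant
  have hb2 : (2 : ℝ) ≤ b := by exact_mod_cast hb
  set r := √(b : ℝ) with hr
  have hr2 : r ^ 2 = b := Real.sq_sqrt (by linarith)
  have hr0 : 0 < r := Real.sqrt_pos.2 (by linarith)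
  have hr' : 0 < r * (1 - ε / 4) := mul_pos hr0 (by linarith)
  have hdG := abs_disc_le (T := G) (m := A.a 1 - 3 * ε / 2 * r) hr' (fun x hx => by
    have h1 := xi_eq_iff (A := A) (by omega) x
    rw [hAb] at h1
    rw [hG, Finset.mem_filter] at hx
    rw [abs_le]
    obtain ⟨-, h2, h3⟩ := hx
    have h4 : r * -(1 + ε / 2) ≤ r * A.xi x := by gcongr
    have h5 : r * A.xi x ≤ r * (1 - ε) := by gcongr
    constructor <;> nlinarith)
  have hdS := abs_disc_split hGS (M := 2 * k) (by linarith) (fun x hx y hy => by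
    refine (abs_sub _ _).trans ?_
    linarith [hSk x hx, hSk y hy])
  have hRne' : ∀ x ∈ S, Polynomial.aeval x R ≠ (0 : ℝ) := fun x hx h0 =>
    hRne θ hθ hθb' (hSc.zero R x hx h0 θ hθS)
  have hpow := hSc.pow_le_disc (a := A.a 1) (b := b) (τ := τ) (R := R) (by omega)
    (fun x hx => hR x (cls_subset A θ hx)) hRne'
  have hRprod := abs_prod_le_pow (S := S) (g := R) fun x hx => hRle x (hSk x hx)
  have hRpos : 0 < |∏ x ∈ S, Polynomial.aeval x R| :=
    abs_pos.2 (Finset.prod_ne_zero_iff.2 hRne')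
  have hdpos : 0 < |∏ x ∈ S, ∏ y ∈ S.erase x, (x - y)| := abs_pos.2 (ConjSet.disc_ne_zero S)
  have hτ0 : 0 < τ := by
    have : 0 < η * h := by positivity
    exact_mod_cast this.trans_le hτ
  have hlogd := Real.log_le_log hdpos (hdS.trans (mul_le_mul_of_nonneg_right hdG (by positivity)))
  rw [Real.log_mul (by positivity) (by positivity), Real.log_mul (by positivity) (by positivity),
    Real.log_pow, Real.log_pow, Real.log_pow] at hlogd
  have hlogR := Real.log_le_log hRpos hRprod
  rw [Real.log_pow, Real.log_exp] at hlogR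
  have hlogm := Real.log_le_log (by positivity) hpow
  rw [Real.log_mul (by positivity) (by positivity), Real.log_pow, Real.log_pow, Real.log_pow,
    ← hr2, Real.log_pow] at hlogm
  refine log_core_false (n := n) (g := G.card) (n' := n') (k := k) (τ := τ) (h := h) (ε := ε)
    (r := r) (ν := η * ε / 16) (η := η) (L := Real.log |∏ x ∈ S, Polynomial.aeval x R|)
    hn2 (Finset.card_le_card hGS) hε hε1 (by rw [hr2]; exact hb2) hr0 rfl hτ hτ0 hlk hn'le
    (hn₀ n (by omega)) hlogR ?_
  have hn1 : ((n - 1 : ℕ) : ℝ) = n - 1 := by rw [Nat.cast_sub (by omega)]; simp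
  have hg1 : ((G.card * (G.card - 1) : ℕ) : ℝ) = G.card * (G.card - 1) := by
    rcases Nat.eq_zero_or_pos G.card with h0 | h0
    · simp [h0]
    · rw [Nat.cast_mul, Nat.cast_sub (by omega)]; simp
  rw [hg1] at hlogd
  rw [← hS, ← hn] at hlogm
  rw [← hn, ← hn'] at hlogd
  push_cast [hn1] at hlogm hlogd
  have hfin := mul_le_mul_of_nonneg_left hlogd (by positivity : (0 : ℝ) ≤ 2 * τ)
  linarith

end Arr

theorem aeval_mem_valuationSubring (V : ValuationSubring ℂ) {x : ℝ} (hx : (x : ℂ) ∈ V)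
    (U : Polynomial ℤ) : ((Polynomial.aeval x U : ℝ) : ℂ) ∈ V := by
  induction U using Polynomial.induction_on' with
  | add p q hp hq => rw [map_add, Complex.ofReal_add]; exact add_mem hp hq
  | monomial n c =>
    rw [Polynomial.aeval_monomial]
    push_cast
    refine mul_mem ?_ (pow_mem hx n)
    simp

theorem ofReal_mem_valuationSubring (V : ValuationSubring ℂ) {x : ℝ}
    (hx : IsIntegral ℤ x) : (x : ℂ) ∈ V := by
  have h1 : IsIntegral V (x : ℂ) := (hx.map (Complex.ofRealHom.toIntAlgHom)).tower_top
  obtain ⟨y, hy⟩ := IsIntegrallyClosed.isIntegral_iff.1 h1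
  rw [← hy]
  exact y.2

theorem quadratic_mem_valuationSubring (V : ValuationSubring ℂ) {y b z w : ℂ} (hy : y ∈ V)
    (hb : b ∈ V) (hs : z + w = y) (hp : z * w = b) : z ∈ V := by
  rcases V.mem_or_inv_mem z with h | h
  · exact h
  · rcases eq_or_ne z 0 with rfl | h0
    · exact zero_mem V
    · have : z = y - b * z⁻¹ := by rw [← hs, ← hp]; field_simp; ring
      rw [this]
      exact sub_mem hy (mul_mem hb h)

/-- Exponential bounds absorb a constant to a small power of the head length. -/
theorem exists_pow_le_exp {C ν : ℝ} (hC : 1 ≤ C) (hν : 0 < ν) :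
    ∃ N : ℕ, ∀ h m : ℕ, N ≤ h → N * m ≤ h → C ^ (m + 1) ≤ Real.exp (ν * h) := by
  obtain ⟨N, hN⟩ := exists_nat_gt (2 * Real.log C / ν)
  refine ⟨N, fun h m h1 h2 => ?_⟩
  have hl : 0 ≤ Real.log C := Real.log_nonneg hC
  rw [← Real.log_le_iff_le_exp (by positivity), Real.log_pow]
  have h3 : (N : ℝ) * (m + 1) ≤ 2 * h := by exact_mod_cast (by linarith : N * (m + 1) ≤ 2 * h)
  rw [div_lt_iff₀ hν] at hN
  push_cast
  have h4 : (0 : ℝ) ≤ m + 1 := by positivity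
  nlinarith

namespace Arr

variable {A : Arr} {h : ℕ}

/-- The transfer matrix between two places of the recurrence. -/
theorem Reg.transfer (hA : A.Reg) (h1 : 1 ≤ h) (j : ℕ) : h + j ≤ A.D + 1 →
    ∃ U V U' V' : Polynomial ℤ,
      (∀ x : ℝ, A.ev (h + j) x =
        Polynomial.aeval x U * A.ev h x + Polynomial.aeval x V * A.ev (h - 1) x) ∧
      (∀ x : ℝ, A.ev (h + j - 1) x =
        Polynomial.aeval x U' * A.ev h x + Polynomial.aeval x V' * A.ev (h - 1) x) ∧
      (∀ x : ℝ, 0 < Polynomial.aeval x U * Polynomial.aeval x V' -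
        Polynomial.aeval x U' * Polynomial.aeval x V) ∧
      ∀ x : ℝ, |x| ≤ A.b 0 → |Polynomial.aeval x U| ≤ (3 * (A.b 0 : ℝ) ^ 2) ^ j ∧
        |Polynomial.aeval x V| ≤ (3 * (A.b 0 : ℝ) ^ 2) ^ j ∧
        |Polynomial.aeval x U'| ≤ (3 * (A.b 0 : ℝ) ^ 2) ^ j ∧
        |Polynomial.aeval x V'| ≤ (3 * (A.b 0 : ℝ) ^ 2) ^ j := by
  induction j with
  | zero =>
    intro _
    refine ⟨1, 0, 0, 1, ?_, ?_, ?_, ?_⟩ <;> simp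
  | succ j ih =>
    intro hj
    obtain ⟨U, V, U', V', hu, hv, hd, hb⟩ := ih (by omega)
    obtain ⟨i, hi⟩ : ∃ i, h + j = i + 1 := ⟨h + j - 1, by omega⟩
    have hβ : (1 : ℝ) ≤ A.bet i := by exact_mod_cast hA.bet_pos (i := i) (by omega)
    refine ⟨(Polynomial.X - Polynomial.C (A.a (i + 1) : ℤ)) * U - Polynomial.C (A.bet i : ℤ) * U',
      (Polynomial.X - Polynomial.C (A.a (i + 1) : ℤ)) * V - Polynomial.C (A.bet i : ℤ) * V',
      U, V, ?_, ?_, ?_, ?_⟩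
    · intro x
      have h2 := hu x
      have h3 := hv x
      rw [hi] at h2 h3
      rw [Nat.add_sub_cancel] at h3
      rw [show h + (j + 1) = i + 2 by omega, ev_add_two, h2, h3]
      simp only [map_sub, map_mul, Polynomial.aeval_X, Polynomial.aeval_C]
      simp
      ring
    · intro x
      rw [← add_assoc, Nat.add_sub_cancel]
      exact hu x
    · intro x
      have h2 := mul_pos (by linarith : (0 : ℝ) < A.bet i) (hd x)
      simp only [map_sub, map_mul, Polynomial.aeval_X, Polynomial.aeval_C]
      simp
      nlinarith
    · intro x hx
      obtain ⟨b1, b2, b3, b4⟩ := hb x hx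
      have hk : (3 : ℝ) ≤ A.b 0 := by exact_mod_cast hA.three_le
      have hs := hA.sum (i + 1) (by omega)
      have hs' := hA.sum i (by omega)
      have ha : (A.a (i + 1) : ℝ) ≤ A.b 0 := by exact_mod_cast (by omega : A.a (i + 1) ≤ A.b 0)
      have ha0 : (0 : ℝ) ≤ A.a (i + 1) := Nat.cast_nonneg _
      have hβ2 : (A.bet i : ℝ) ≤ A.b 0 ^ 2 := by
        rw [sq]
        exact_mod_cast Nat.mul_le_mul (by omega : A.b i ≤ A.b 0) (by omega : A.c (i + 1) ≤ A.b 0)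
      have hxa : |x - A.a (i + 1)| ≤ 2 * A.b 0 := by
        rw [_root_.abs_le] at hx ⊢
        constructor <;> linarith
      set M := (3 * (A.b 0 : ℝ) ^ 2) ^ j with hM
      have hM0 : 0 ≤ M := by positivity
      have step : ∀ P Q : ℝ, |P| ≤ M → |Q| ≤ M →
          |(x - A.a (i + 1)) * P - A.bet i * Q| ≤ (3 * (A.b 0 : ℝ) ^ 2) ^ (j + 1) := by
        intro P Q hP hQ
        refine (abs_sub _ _).trans ?_
        rw [abs_mul, abs_mul, abs_of_nonneg (by linarith : (0 : ℝ) ≤ A.bet i), pow_succ, ← hM]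
        calc _ ≤ 2 * A.b 0 * M + A.b 0 ^ 2 * M := by gcongr
          _ ≤ _ := by nlinarith [mul_nonneg hM0 (by nlinarith : 0 ≤ 2 * (A.b 0 : ℝ) ^ 2 - 2 * A.b 0)]
      have mono : M ≤ (3 * (A.b 0 : ℝ) ^ 2) ^ (j + 1) := by
        rw [pow_succ, ← hM]
        nlinarith
      refine ⟨?_, ?_, b1.trans mono, b2.trans mono⟩
      · simpa using step _ _ b1 b3
      · simpa using step _ _ b2 b4

theorem Head.sub_mul_ev (hh : A.Head h) (hA : A.Reg) (x : ℝ) {z w : ℂ}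
    (hs : z + w = x - A.a 1) (hp : z * w = A.b 1) (n : ℕ) : n + 2 ≤ h →
    (A.ev (n + 2) x : ℂ) - w * A.ev (n + 1) x = z ^ n * (x * z - A.b 0) := by
  induction n with
  | zero =>
    intro hn
    rw [ev_add_two, zero_add, ev_one, ev_zero, hA.a_zero, hA.bet_zero]
    push_cast
    rw [← hs]
    ring
  | succ n ih =>
    intro hn
    rw [pow_succ, mul_comm (z ^ n), mul_assoc, ← ih (by omega), show n + 1 + 2 = (n + 1) + 2 by rfl,
      ev_add_two, hh.a_eq hA (by omega) (by omega), hh.bet_eq (by omega) (by omega)]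
    push_cast
    rw [← hs, ← hp]
    ring

theorem band_quadratic {a b : ℕ} {x : ℝ} (hx : (x - a) ^ 2 < 4 * b) {P Q : ℝ}
    (hPQ : ¬ (P = 0 ∧ Q = 0)) : 0 < P ^ 2 * b + P * Q * (x - a) + Q ^ 2 := by
  by_contra! hle
  have h1 : (2 * Q + P * (x - a)) ^ 2 + P ^ 2 * (4 * b - (x - a) ^ 2) ≤ 0 := by nlinarith
  have h2 : P = 0 := by
    by_contra h0
    have := mul_pos (pow_pos (abs_pos.2 h0) 2) (sub_pos.2 hx)
    rw [sq_abs] at this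
    nlinarith [sq_nonneg (2 * Q + P * (x - a))]
  subst h2
  refine hPQ ⟨rfl, ?_⟩
  nlinarith

theorem sq_lt_of_abs_xi_lt (hb : 1 ≤ A.b 1) {x : ℝ} (hx : |A.xi x| < 1) :
    (x - A.a 1) ^ 2 < 4 * A.b 1 := by
  have hb' : (1 : ℝ) ≤ A.b 1 := by exact_mod_cast hb
  have h1 := xi_eq_iff hb x
  have h2 : √(A.b 1 : ℝ) ^ 2 = A.b 1 := Real.sq_sqrt (by linarith)
  have h3 : A.xi x ^ 2 < 1 := by
    rw [← sq_abs]; nlinarith [abs_nonneg (A.xi x)]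
  have h4 : (x - A.a 1) ^ 2 = 4 * A.b 1 * A.xi x ^ 2 := by
    rw [← h2]
    nth_rw 1 [h1]
    ring
  nlinarith

theorem quadratic_abs_le {k a b : ℝ} (hk : 3 ≤ k) (ha : 0 ≤ a) (hak : a ≤ k) (hb : 0 ≤ b)
    (hbk : b ≤ k) {x M P Q : ℝ} (hx : |x| ≤ k) (hP : |P| ≤ M) (hQ : |Q| ≤ M) :
    |P ^ 2 * b + P * Q * (x - a) + Q ^ 2| ≤ 4 * k * M ^ 2 := by
  have hM : 0 ≤ M := (abs_nonneg _).trans hP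
  have hxa : |x - a| ≤ 2 * k := by
    rw [abs_le] at hx ⊢
    constructor <;> linarith
  refine (abs_add_three _ _ _).trans ?_
  rw [abs_mul, abs_mul, abs_mul, abs_pow, abs_pow, abs_of_nonneg hb]
  calc _ ≤ M ^ 2 * k + M * M * (2 * k) + M ^ 2 := by gcongr
    _ ≤ _ := by nlinarith [sq_nonneg M]

theorem energy_abs_le {k a x : ℝ} (hk : 3 ≤ k) (ha : 0 ≤ a) (hak : a + 1 ≤ k) (hx : |x| ≤ k) :
    |(k - x) * (k + (a + 1) * x)| ≤ 4 * k ^ 3 := by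
  rw [abs_mul]
  have h4 : |(k : ℝ) - x| ≤ 2 * k := by
    rw [abs_le] at hx ⊢; constructor <;> linarith
  have h5 : |(k : ℝ) + (a + 1) * x| ≤ k + k * k := by
    refine (abs_add_le _ _).trans ?_
    rw [abs_mul, abs_of_pos (by linarith : (0 : ℝ) < k), abs_of_pos (by positivity : 0 < a + 1)]
    gcongr
  calc _ ≤ 2 * k * (k + k * k) := by gcongr
    _ ≤ _ := by nlinarith [sq_nonneg k]

/-- The recurrence cannot terminate shortly after a long head. -/
theorem end_far {k b : ℕ} (hb : 2 ≤ b) (hbk : 1 + b ≤ k) :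
    ∃ N : ℕ, ∀ (A : Arr) (h : ℕ), A.Reg → A.b 0 = k → A.b 1 = b → A.Head h → N ≤ h →
      N * (A.D - h) ≤ h → False := by
  obtain ⟨ν, hν, N1, hcore⟩ := core hb hbk (η := 1 / 2) (by norm_num)
  have hk3 : (3 : ℝ) ≤ k := by exact_mod_cast (by omega : 3 ≤ k)
  obtain ⟨N2, hN2⟩ := exists_pow_le_exp (C := 4 * (k : ℝ) ^ 3 * (4 * k) * (3 * (k : ℝ) ^ 2) ^ 2)
    (by
      have h1 : (1 : ℝ) ≤ k := by linarith
      have h2 : (1 : ℝ) ≤ k ^ 3 := one_le_pow₀ h1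
      have h3 : (1 : ℝ) ≤ (3 * (k : ℝ) ^ 2) ^ 2 := one_le_pow₀ (by nlinarith)
      have h4 : (1 : ℝ) ≤ 4 * (k : ℝ) ^ 3 * (4 * k) := by nlinarith
      exact one_le_mul_of_one_le_of_one_le h4 h3) hν
  refine ⟨max (max N1 N2) 4, fun A h hA hAk hAb hh hN hND => ?_⟩
  have hh1 : N1 ≤ h := le_trans (le_trans (le_max_left _ _) (le_max_left _ _)) hN
  have hh2 : N2 ≤ h := le_trans (le_trans (le_max_right _ _) (le_max_left _ _)) hN
  have hh4 : 4 ≤ h := le_trans (le_max_right _ _) hN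
  have hexp := hN2 h (A.D - h) hh2 (le_trans (Nat.mul_le_mul_right _
    (le_trans (le_max_right _ _) (le_max_left _ _))) hND)
  have hlt := hh.lt
  obtain ⟨U, V, U', V', hu, -, hd, hle⟩ := hA.transfer (h := h) (by omega) (A.D - h + 1) (by omega)
  rw [show h + (A.D - h + 1) = A.D + 1 by omega] at hu
  have hs1 := hA.sum_one
  rw [hAk, hAb] at hs1
  have haA : (A.a 1 : ℝ) + 1 ≤ k := by exact_mod_cast (by omega : A.a 1 + 1 ≤ k)
  have hkb : (k : ℝ) = 1 + A.a 1 + b := by exact_mod_cast hs1.symm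
  have hRe : ∀ x : ℝ, Polynomial.aeval x ((Polynomial.C (k : ℤ) - Polynomial.X) *
      (Polynomial.C (k : ℤ) + Polynomial.C (A.a 1 + 1 : ℤ) * Polynomial.X) *
      (U ^ 2 * Polynomial.C (b : ℤ) + U * V * (Polynomial.X - Polynomial.C (A.a 1 : ℤ)) + V ^ 2)) =
      ((k - x) * (k + (A.a 1 + 1) * x)) * ((Polynomial.aeval x U) ^ 2 * b +
      Polynomial.aeval x U * Polynomial.aeval x V * (x - A.a 1) + (Polynomial.aeval x V) ^ 2) := by
    intro x
    rw [map_mul, aeval_energy_poly]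
    simp
  refine hcore A h hA hAk hAb hh hh1 (h - 2) ((Polynomial.C (k : ℤ) - Polynomial.X) *
      (Polynomial.C (k : ℤ) + Polynomial.C (A.a 1 + 1 : ℤ) * Polynomial.X) *
      (U ^ 2 * Polynomial.C (b : ℤ) + U * V * (Polynomial.X - Polynomial.C (A.a 1 : ℤ)) + V ^ 2))
    ?_ ?_ ?_ ?_
  · rw [Nat.cast_sub (by omega)]
    have : (4 : ℝ) ≤ h := by exact_mod_cast hh4
    push_cast
    linarith
  · intro x hx W z w g hs hp hg hzw
    rw [hRe]
    have hx0 := mem_nodes.1 hx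
    have hxW := ofReal_mem_valuationSubring W (isIntegral_of_mem hx)
    have hnat : ∀ n : ℕ, (n : ℂ) ∈ W := fun n => natCast_mem W n
    have hzW : z ∈ W := quadratic_mem_valuationSubring W (sub_mem hxW (hnat (A.a 1))) (hnat b) hs hp
    have hwW : w ∈ W := by rw [hzw]; exact mul_mem hzW hg
    have hUW := aeval_mem_valuationSubring W hxW U
    have hVW := aeval_mem_valuationSubring W hxW V
    have hz0 : z ≠ 0 := by
      rintro rfl
      rw [zero_mul] at hp
      have : (b : ℂ) ≠ 0 := by exact_mod_cast (by omega : b ≠ 0)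
      exact this hp.symm
    rw [← hAb] at hp
    have e1 := hh.sub_mul_ev hA x hs hp (h - 2) (by omega)
    have e2 := hh.sub_mul_ev hA x (z := w) (w := z) (by rw [add_comm]; exact hs)
      (by rw [mul_comm]; exact hp) (h - 2) (by omega)
    rw [show h - 2 + 2 = h by omega, show h - 2 + 1 = h - 1 by omega, hAk] at e1 e2
    have h0 := hu x
    rw [hx0] at h0
    have h0' : (0 : ℂ) = (Polynomial.aeval x U : ℝ) * (A.ev h x : ℂ) +
      (Polynomial.aeval x V : ℝ) * (A.ev (h - 1) x : ℂ) := by exact_mod_cast h0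
    set u : ℂ := ((Polynomial.aeval x U : ℝ) : ℂ)
    set v : ℂ := ((Polynomial.aeval x V : ℝ) : ℂ)
    set P : ℂ := (A.ev h x : ℂ)
    set Q : ℂ := (A.ev (h - 1) x : ℂ)
    have e3 : z ^ (h - 2) * ((x * z - k) * (u * z + v)) =
        z ^ (h - 2) * (g ^ (h - 2) * ((x * w - k) * (u * w + v))) := by
      rw [← mul_assoc, ← mul_assoc, ← mul_pow, ← hzw, ← mul_assoc, ← e1, ← e2]
      linear_combination (z - w) * -h0'
    have e4 := mul_left_cancel₀ (pow_ne_zero _ hz0) e3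
    refine ⟨((x * w - k) * (u * w + v)) ^ 2, pow_mem (mul_mem (sub_mem (mul_mem hxW hwW) (hnat k))
      (add_mem (mul_mem hUW hwW) hVW)) 2, ?_⟩
    have e5 : g ^ (h - 2) * ((x * w - k) * (u * w + v)) ^ 2 =
        ((x * z - k) * (u * z + v)) * ((x * w - k) * (u * w + v)) := by
      rw [e4]; ring
    rw [e5]
    have hk' : (k : ℂ) = 1 + A.a 1 + z * w := by
      rw [hp, hAb]; exact_mod_cast hs1.symm
    have hb' : (b : ℂ) = z * w := by rw [hp, hAb]
    push_cast
    rw [hb', ← hs]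
    have ha' : (A.a 1 : ℂ) + 1 = k - z * w := by rw [hk']; ring
    have hxa : (A.a 1 : ℂ) = x - (z + w) := by rw [hs]; ring
    have e6 : ((k : ℂ) - x) * (k + (A.a 1 + 1) * x) = (x * z - k) * (x * w - k) := by
      have : (A.a 1 : ℂ) * (k * x) = (x - (z + w)) * (k * x) := by rw [hxa]
      linear_combination this - x ^ 2 * ha'
    rw [e6]
    ring
  · intro x hx
    rw [hRe, abs_mul]
    rw [← hAk] at hx
    obtain ⟨b1, b2, -, -⟩ := hle x hx
    rw [hAk] at b1 b2 hx
    refine le_trans (mul_le_mul (energy_abs_le hk3 (Nat.cast_nonneg _) haA hx)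
      (quadratic_abs_le hk3 (Nat.cast_nonneg _) (by linarith) (Nat.cast_nonneg b)
        (by exact_mod_cast (by omega : b ≤ k)) hx b1 b2) (abs_nonneg _) (by positivity))
      (le_trans ?_ hexp)
    rw [mul_pow _ ((3 * (k : ℝ) ^ 2) ^ 2), ← pow_mul (3 * (k : ℝ) ^ 2),
      ← pow_mul (3 * (k : ℝ) ^ 2), mul_comm 2 (A.D - h + 1), ← mul_assoc]
    gcongr
    refine le_self_pow₀ ?_ (by omega)
    have h2 : (1 : ℝ) ≤ (k : ℝ) ^ 3 := one_le_pow₀ (by linarith)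
    nlinarith
  · intro x hx hxb
    rw [hRe]
    have h1 := band_energy_pos hA (by omega) hxb
    rw [hAk] at h1
    have h2 := sq_lt_of_abs_xi_lt (by omega) hxb
    rw [hAb] at h2
    refine (mul_pos h1 (band_quadratic h2 ?_)).ne'
    rintro ⟨h3, h4⟩
    have := hd x
    rw [h3, h4] at this
    simp at this

end Arr

namespace Arr

variable {A : Arr} {h : ℕ}

theorem tail_sub_mul_ev (hA : A.Reg) {s : ℕ}
    (ht : ∀ i, s ≤ i → i < A.D → A.c i = A.b 1 ∧ A.b i = 1) (x : ℝ) {z w : ℂ}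
    (hs : z + w = x - A.a 1) (hp : z * w = A.b 1) (n : ℕ) : s + n + 1 ≤ A.D →
    (A.ev (s + n + 1) x : ℂ) - w * A.ev (s + n) x = z ^ n * (A.ev (s + 1) x - w * A.ev s x) := by
  induction n with
  | zero =>
    intro _
    simp
  | succ n ih =>
    intro hn
    obtain ⟨h1, h2⟩ := ht (s + n + 1) (by omega) (by omega)
    have h3 := (ht (s + n) (by omega) (by omega)).2
    have h4 := hA.sum (s + n + 1) (by omega)
    have h5 := hA.sum_one
    have h6 : A.a (s + n + 1) = A.a 1 := by omega
    have h7 : A.bet (s + n) = A.b 1 := by rw [bet, h1, h3, one_mul]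
    rw [pow_succ, mul_comm (z ^ n), mul_assoc, ← ih (by omega),
      show s + (n + 1) + 1 = (s + n) + 2 by omega, show s + (n + 1) = s + n + 1 by omega,
      ev_add_two, h6, h7]
    push_cast
    rw [← hs, ← hp]
    ring

theorem transfer_norm_pos {P Q P' Q' b y : ℝ} (hy : y ^ 2 < 4 * b) (hd : 0 < P * Q' - P' * Q) :
    0 < (P ^ 2 + Q' ^ 2) * b - P * Q' * (y ^ 2 - 2 * b) + (Q - P' * b) * (P - Q') * y +
      (Q - P' * b) ^ 2 := by
  have e : (P ^ 2 + Q' ^ 2) * b - P * Q' * (y ^ 2 - 2 * b) + (Q - P' * b) * (P - Q') * y +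
      (Q - P' * b) ^ 2 =
      ((P - Q') * y / 2 + (Q - P' * b)) ^ 2 + (b - y ^ 2 / 4) * (P + Q') ^ 2 := by ring
  rw [e]
  have hb : 0 < b - y ^ 2 / 4 := by linarith
  rcases eq_or_ne (P + Q') 0 with h0 | h0
  · have hQ' : Q' = -P := by linarith
    subst hQ'
    have h1 : (P - -P) * y / 2 + (Q - P' * b) ≠ 0 := by
      intro h1
      have h2 : Q = P' * b - P * y := by linarith
      rw [h2] at hd
      nlinarith [sq_nonneg (P - P' * y / 2), mul_nonneg hb.le (sq_nonneg P')]
    have := pow_pos (abs_pos.2 h1) 2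
    rw [sq_abs] at this
    have := mul_nonneg hb.le (sq_nonneg (P + -P))
    linarith
  · have := pow_pos (abs_pos.2 h0) 2
    rw [sq_abs] at this
    have := mul_pos hb this
    have := sq_nonneg ((P - Q') * y / 2 + (Q - P' * b))
    linarith

theorem transfer_norm_le {k P Q P' Q' b y M : ℝ} (hk : 3 ≤ k) (hb : 0 ≤ b) (hbk : b ≤ k)
    (hy : |y| ≤ 2 * k) (hP : |P| ≤ M) (hQ : |Q| ≤ M) (hP' : |P'| ≤ M) (hQ' : |Q'| ≤ M) :
    |(P ^ 2 + Q' ^ 2) * b - P * Q' * (y ^ 2 - 2 * b) + (Q - P' * b) * (P - Q') * y +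
      (Q - P' * b) ^ 2| ≤ 20 * k ^ 2 * M ^ 2 := by
  have hM : 0 ≤ M := (abs_nonneg _).trans hP
  have hC : |Q - P' * b| ≤ (1 + k) * M := by
    refine (abs_sub _ _).trans ?_
    rw [abs_mul, abs_of_nonneg hb]
    calc _ ≤ M + M * k := by gcongr
      _ = _ := by ring
  have hPQ : |P - Q'| ≤ 2 * M := (abs_sub _ _).trans (by linarith)
  have hy2 : |y ^ 2 - 2 * b| ≤ 4 * k ^ 2 + 2 * k := by
    refine (abs_sub _ _).trans ?_
    rw [abs_pow, abs_mul, abs_of_nonneg hb, abs_two]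
    calc _ ≤ (2 * k) ^ 2 + 2 * k := by gcongr
      _ = _ := by ring
  have hs : |P ^ 2 + Q' ^ 2| ≤ 2 * M ^ 2 := by
    refine (abs_add_le _ _).trans ?_
    rw [abs_pow, abs_pow]
    calc _ ≤ M ^ 2 + M ^ 2 := by gcongr
      _ = _ := by ring
  refine (abs_add_le _ _).trans ?_
  refine (add_le_add_left ((abs_add_le _ _).trans (add_le_add_left (abs_sub _ _) _)) _).trans ?_
  simp only [abs_mul, abs_pow] at *
  rw [abs_of_nonneg hb]
  calc _ ≤ 2 * M ^ 2 * k + M * M * (4 * k ^ 2 + 2 * k) + (1 + k) * M * (2 * M) * (2 * k) +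
        ((1 + k) * M) ^ 2 := by gcongr
    _ = (2 * k + (4 * k ^ 2 + 2 * k) + (1 + k) * 4 * k + (1 + k) ^ 2) * M ^ 2 := by ring
    _ ≤ _ := by
      gcongr
      nlinarith

set_option maxHeartbeats 1000000 in
/-- The mirror image of the head cannot occur at the end of the array. -/
theorem tail_far {k b : ℕ} (hb : 2 ≤ b) (hbk : 1 + b ≤ k) {η : ℝ} (hη : 0 < η) :
    ∃ N : ℕ, ∀ (A : Arr) (h s : ℕ), A.Reg → A.b 0 = k → A.b 1 = b → A.Head h → N ≤ h →
      h ≤ s → N * (s - h) ≤ h → η * h ≤ ((A.D - s : ℕ) : ℝ) →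
      (∀ i, s ≤ i → i < A.D → A.c i = b ∧ A.b i = 1) → False := by
  obtain ⟨ν, hν, N1, hcore⟩ := core hb hbk (η := min (η / 2) (1 / 2))
    (lt_min (by linarith) (by norm_num))
  have hk3 : (3 : ℝ) ≤ k := by exact_mod_cast (by omega : 3 ≤ k)
  have hk1 : (1 : ℝ) ≤ k := by linarith
  obtain ⟨N2, hN2⟩ := exists_pow_le_exp
    (C := 16 * (k : ℝ) ^ 3 * (4 * (k : ℝ) ^ 3 * (20 * (k : ℝ) ^ 2)) * (3 * (k : ℝ) ^ 2) ^ 2)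
    (by
      have h2 : (1 : ℝ) ≤ k ^ 3 := one_le_pow₀ hk1
      have h3 : (1 : ℝ) ≤ k ^ 2 := one_le_pow₀ hk1
      have h4 : (1 : ℝ) ≤ (3 * (k : ℝ) ^ 2) ^ 2 := one_le_pow₀ (by nlinarith)
      exact one_le_mul_of_one_le_of_one_le (one_le_mul_of_one_le_of_one_le (by linarith)
        (one_le_mul_of_one_le_of_one_le (by linarith) (by linarith))) h4) hν
  obtain ⟨N3, hN3⟩ := exists_nat_gt (2 / η)
  refine ⟨max (max N1 N2) (max N3 4), fun A h s hA hAk hAb hh hN hhs hND hsD ht => ?_⟩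
  have hh1 : N1 ≤ h := le_trans (le_trans (le_max_left _ _) (le_max_left _ _)) hN
  have hh2 : N2 ≤ h := le_trans (le_trans (le_max_right _ _) (le_max_left _ _)) hN
  have hh3 : N3 ≤ h := le_trans (le_trans (le_max_left _ _) (le_max_right _ _)) hN
  have hh4 : 4 ≤ h := le_trans (le_trans (le_max_right _ _) (le_max_right _ _)) hN
  have hexp := hN2 h (s - h) hh2 (le_trans (Nat.mul_le_mul_right _
    (le_trans (le_max_right _ _) (le_max_left _ _))) hND)
  have hηh : 2 ≤ η * h := by
    rw [div_lt_iff₀ hη] at hN3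
    have : (N3 : ℝ) ≤ h := by exact_mod_cast hh3
    nlinarith
  have hDs2 : 2 ≤ A.D - s := by exact_mod_cast hηh.trans hsD
  rw [← hAb] at ht
  obtain ⟨U, V, U', V', hu, hu', hd, hle⟩ :=
    hA.transfer (h := h) (by omega) (s - h + 1) (by omega)
  rw [show h + (s - h + 1) = s + 1 by omega] at hu hu'
  rw [Nat.add_sub_cancel] at hu'
  have hs1 := hA.sum_one
  rw [hAk, hAb] at hs1
  have haA : (A.a 1 : ℝ) + 1 ≤ k := by exact_mod_cast (by omega : A.a 1 + 1 ≤ k)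
  have hsumD := hA.sum A.D le_rfl
  rw [hAk] at hsumD
  have hcD := hA.c_pos A.D (by omega) le_rfl
  obtain ⟨R, hRe⟩ : ∃ R : Polynomial ℤ, ∀ x : ℝ, Polynomial.aeval x R =
      ((x - A.a A.D) ^ 2 * b + (x - A.a A.D) * (-A.c A.D) * (x - A.a 1) + (-A.c A.D) ^ 2) *
      (((k - x) * (k + (A.a 1 + 1) * x)) *
      (((Polynomial.aeval x U) ^ 2 + (Polynomial.aeval x V') ^ 2) * b -
      (Polynomial.aeval x U) * (Polynomial.aeval x V') * ((x - A.a 1) ^ 2 - 2 * b) +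
      (Polynomial.aeval x V - Polynomial.aeval x U' * b) *
      (Polynomial.aeval x U - Polynomial.aeval x V') * (x - A.a 1) +
      (Polynomial.aeval x V - Polynomial.aeval x U' * b) ^ 2)) := by
    set X : Polynomial ℤ := Polynomial.X
    refine ⟨((X - (A.a A.D : Polynomial ℤ)) ^ 2 * b +
      (X - (A.a A.D : Polynomial ℤ)) * (-A.c A.D) * (X - A.a 1) + (-A.c A.D) ^ 2) *
      (((k - X) * (k + (A.a 1 + 1) * X)) * ((U ^ 2 + V' ^ 2) * b - U * V' * ((X - A.a 1) ^ 2 - (b + b)) +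
      (V - U' * b) * (U - V') * (X - A.a 1) + (V - U' * b) ^ 2)), fun x => ?_⟩
    simp only [two_mul]
    simp [X]
  refine hcore A h hA hAk hAb hh hh1 (min (A.D - 1 - s) (h - 2)) R ?_ ?_ ?_ ?_
  · rw [Nat.cast_min]
    refine le_min ?_ ?_
    · rw [show A.D - 1 - s = (A.D - s) - 1 by omega, Nat.cast_sub (by omega)]
      have : min (η / 2) (1 / 2) * (h : ℝ) ≤ η / 2 * h := by gcongr; exact min_le_left _ _
      push_cast
      linarith
    · rw [Nat.cast_sub (by omega)]
      have : min (η / 2) (1 / 2) * (h : ℝ) ≤ 1 / 2 * h := by gcongr; exact min_le_right _ _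
      have : (4 : ℝ) ≤ h := by exact_mod_cast hh4
      push_cast
      linarith
  · intro x hx W z w g hs hp hg hzw
    rw [hRe]
    have hx0 := mem_nodes.1 hx
    have hxW := ofReal_mem_valuationSubring W (isIntegral_of_mem hx)
    have hnat : ∀ n : ℕ, (n : ℂ) ∈ W := fun n => natCast_mem W n
    have hzW : z ∈ W := quadratic_mem_valuationSubring W (sub_mem hxW (hnat (A.a 1))) (hnat b) hs hp
    have hwW : w ∈ W := by rw [hzw]; exact mul_mem hzW hg
    have hUW := aeval_mem_valuationSubring W hxW U
    have hVW := aeval_mem_valuationSubring W hxW V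
    have hUW' := aeval_mem_valuationSubring W hxW U'
    have hVW' := aeval_mem_valuationSubring W hxW V'
    have hz0 : z ≠ 0 := by
      rintro rfl
      rw [zero_mul] at hp
      have : (b : ℂ) ≠ 0 := by exact_mod_cast (by omega : b ≠ 0)
      exact this hp.symm
    rw [← hAb] at hp
    have hs' : w + z = x - A.a 1 := by rw [add_comm]; exact hs
    have hp' : w * z = A.b 1 := by rw [mul_comm]; exact hp
    have e1 := hh.sub_mul_ev hA x hs hp (h - 2) (by omega)
    have e2 := hh.sub_mul_ev hA x hs' hp' (h - 2) (by omega)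
    rw [show h - 2 + 2 = h by omega, show h - 2 + 1 = h - 1 by omega, hAk] at e1 e2
    have f1 := tail_sub_mul_ev hA ht x hs hp (A.D - 1 - s) (by omega)
    have f2 := tail_sub_mul_ev hA ht x hs' hp' (A.D - 1 - s) (by omega)
    rw [show s + (A.D - 1 - s) + 1 = A.D by omega, show s + (A.D - 1 - s) = A.D - 1 by omega] at f1 f2
    have hlast := ev_add_two A (A.D - 1) x
    have hbD : A.bet (A.D - 1) = A.c A.D := by
      rw [bet, (ht (A.D - 1) (by omega) (by omega)).2, one_mul, show A.D - 1 + 1 = A.D by omega]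
    rw [show A.D - 1 + 2 = A.D + 1 by omega, show A.D - 1 + 1 = A.D by omega, hx0, hbD] at hlast
    have h0 : (0 : ℂ) = (x - A.a A.D) * (A.ev A.D x : ℂ) - A.c A.D * (A.ev (A.D - 1) x : ℂ) := by
      exact_mod_cast hlast
    have g1 : (A.ev (s + 1) x : ℂ) = (Polynomial.aeval x U : ℝ) * (A.ev h x : ℂ) +
      (Polynomial.aeval x V : ℝ) * (A.ev (h - 1) x : ℂ) := by exact_mod_cast hu x
    have g2 : (A.ev s x : ℂ) = (Polynomial.aeval x U' : ℝ) * (A.ev h x : ℂ) +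
      (Polynomial.aeval x V' : ℝ) * (A.ev (h - 1) x : ℂ) := by exact_mod_cast hu' x
    rw [g1, g2] at f1 f2
    set u : ℂ := ((Polynomial.aeval x U : ℝ) : ℂ)
    set v : ℂ := ((Polynomial.aeval x V : ℝ) : ℂ)
    set u' : ℂ := ((Polynomial.aeval x U' : ℝ) : ℂ)
    set v' : ℂ := ((Polynomial.aeval x V' : ℝ) : ℂ)
    set P : ℂ := (A.ev h x : ℂ)
    set Q : ℂ := (A.ev (h - 1) x : ℂ)
    set P₁ : ℂ := (A.ev A.D x : ℂ)
    set Q₁ : ℂ := (A.ev (A.D - 1) x : ℂ)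
    have hk' : (k : ℂ) = 1 + A.a 1 + z * w := by
      rw [hp, hAb]; exact_mod_cast hs1.symm
    have hb' : (b : ℂ) = z * w := by rw [hp, hAb]
    set T₁ : ℂ := z * (x - A.a A.D) - A.c A.D with hT₁
    set T₂ : ℂ := w * (x - A.a A.D) - A.c A.D with hT₂
    set m11 : ℂ := u * z - z * w * u' + v - w * v' with hm11
    set m12 : ℂ := u * w - u' * w ^ 2 + v - w * v' with hm12
    set m21 : ℂ := u * z - u' * z ^ 2 + v - z * v' with hm21
    set m22 : ℂ := u * w - z * w * u' + v - z * v' with hm22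
    have hTT : T₁ * (P₁ - w * Q₁) = T₂ * (P₁ - z * Q₁) := by
      rw [hT₁, hT₂]
      linear_combination -(z - w) * h0
    rw [f1, f2] at hTT
    set t := A.D - 1 - s
    set X₁ : ℂ := x * z - k with hX₁
    set X₂ : ℂ := x * w - k with hX₂
    have k1 : (z - w) * (u * P + v * Q - w * (u' * P + v' * Q)) =
        m11 * (z ^ (h - 2) * X₁) - m12 * (w ^ (h - 2) * X₂) := by
      rw [← e1, ← e2, hm11, hm12]; ring
    have k2 : (z - w) * (u * P + v * Q - z * (u' * P + v' * Q)) =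
        m21 * (z ^ (h - 2) * X₁) - m22 * (w ^ (h - 2) * X₂) := by
      rw [← e1, ← e2, hm21, hm22]; ring
    have k3 : T₁ * z ^ t * (m11 * (z ^ (h - 2) * X₁) - m12 * (w ^ (h - 2) * X₂)) =
        T₂ * w ^ t * (m21 * (z ^ (h - 2) * X₁) - m22 * (w ^ (h - 2) * X₂)) := by
      rw [← k1, ← k2]
      linear_combination (z - w) * hTT
    have hwt : ∀ n, w ^ n = z ^ n * g ^ n := fun n => by rw [hzw, mul_pow]
    have k4 : z ^ t * z ^ (h - 2) * (T₁ * X₁ * m11) = z ^ t * z ^ (h - 2) *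
        (g ^ (h - 2) * (T₁ * m12 * X₂) + g ^ t * (T₂ * (m21 * X₁ - m22 * (g ^ (h - 2) * X₂)))) := by
      rw [hwt, hwt] at k3
      linear_combination k3
    have k5 := mul_left_cancel₀ (mul_ne_zero (pow_ne_zero _ hz0) (pow_ne_zero _ hz0)) k4
    have hsplit : ∀ n, min t (h - 2) ≤ n → g ^ n = g ^ (min t (h - 2)) * g ^ (n - min t (h - 2)) :=
      fun n hn => by rw [← pow_add, Nat.add_sub_cancel' hn]
    have hT₁W : T₁ ∈ W := sub_mem (mul_mem hzW (sub_mem hxW (hnat _))) (hnat _)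
    have hT₂W : T₂ ∈ W := sub_mem (mul_mem hwW (sub_mem hxW (hnat _))) (hnat _)
    have hX₁W : X₁ ∈ W := sub_mem (mul_mem hxW hzW) (hnat _)
    have hX₂W : X₂ ∈ W := sub_mem (mul_mem hxW hwW) (hnat _)
    have hm12W : m12 ∈ W := sub_mem (add_mem (sub_mem (mul_mem hUW hwW)
      (mul_mem hUW' (pow_mem hwW 2))) hVW) (mul_mem hwW hVW')
    have hm21W : m21 ∈ W := sub_mem (add_mem (sub_mem (mul_mem hUW hzW)
      (mul_mem hUW' (pow_mem hzW 2))) hVW) (mul_mem hzW hVW')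
    have hm22W : m22 ∈ W := sub_mem (add_mem (sub_mem (mul_mem hUW hwW)
      (mul_mem (mul_mem hzW hwW) hUW')) hVW) (mul_mem hzW hVW')
    refine ⟨(g ^ (h - 2 - min t (h - 2)) * (T₁ * m12 * X₂) + g ^ (t - min t (h - 2)) *
      (T₂ * (m21 * X₁ - m22 * (g ^ (h - 2) * X₂)))) * (T₂ * X₂ * m22), ?_, ?_⟩
    · refine mul_mem (add_mem (mul_mem (pow_mem hg _) (mul_mem (mul_mem hT₁W hm12W) hX₂W))
        (mul_mem (pow_mem hg _) (mul_mem hT₂W (sub_mem (mul_mem hm21W hX₁W)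
        (mul_mem hm22W (mul_mem (pow_mem hg _) hX₂W)))))) (mul_mem (mul_mem hT₂W hX₂W) hm22W)
    · have e5 : g ^ (min t (h - 2)) * ((g ^ (h - 2 - min t (h - 2)) * (T₁ * m12 * X₂) +
          g ^ (t - min t (h - 2)) * (T₂ * (m21 * X₁ - m22 * (g ^ (h - 2) * X₂)))) *
          (T₂ * X₂ * m22)) = (T₁ * X₁ * m11) * (T₂ * X₂ * m22) := by
        rw [k5]
        have i1 := hsplit (h - 2) (min_le_right _ _)
        have i2 := hsplit t (min_le_left _ _)
        linear_combination -(T₁ * m12 * X₂ * (T₂ * X₂ * m22)) * i1 -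
          (T₂ * (m21 * X₁ - m22 * (g ^ (h - 2) * X₂))) * (T₂ * X₂ * m22) * i2
      rw [e5]
      push_cast
      rw [hb', ← hs]
      have ha' : (A.a 1 : ℂ) + 1 = k - z * w := by rw [hk']; ring
      have hxa : (A.a 1 : ℂ) = x - (z + w) := by rw [hs]; ring
      have e6 : ((k : ℂ) - x) * (k + (A.a 1 + 1) * x) = X₁ * X₂ := by
        have : (A.a 1 : ℂ) * (k * x) = (x - (z + w)) * (k * x) := by rw [hxa]
        rw [hX₁, hX₂]
        linear_combination this - x ^ 2 * ha'
      rw [e6]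
      have e7 : ((x : ℂ) - A.a A.D) ^ 2 * (z * w) + (x - A.a A.D) * -A.c A.D * (z + w) +
          (-A.c A.D) ^ 2 = T₁ * T₂ := by
        rw [hT₁, hT₂]; ring
      rw [e7]
      have e8 : (u ^ 2 + v' ^ 2) * (z * w) - u * v' * ((z + w) ^ 2 - 2 * (z * w)) +
          (v - u' * (z * w)) * (u - v') * (z + w) + (v - u' * (z * w)) ^ 2 = m11 * m22 := by
        rw [hm11, hm22]; ring
      rw [e8]
      ring
  · intro x hx
    rw [hRe, abs_mul, abs_mul]
    rw [← hAk] at hx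
    obtain ⟨b1, b2, b3, b4⟩ := hle x hx
    rw [hAk] at b1 b2 b3 b4 hx
    have hbk' : (b : ℝ) ≤ k := by exact_mod_cast (by omega : b ≤ k)
    have hsub : ∀ a : ℕ, a ≤ k → |x - a| ≤ 2 * k := fun a ha => by
      have ha' : (a : ℝ) ≤ k := by exact_mod_cast ha
      have ha0 : (0 : ℝ) ≤ a := Nat.cast_nonneg a
      rw [abs_le] at hx ⊢
      constructor <;> linarith
    have hc : |(-A.c A.D : ℝ)| ≤ 2 * k := by
      rw [abs_neg, abs_of_nonneg (Nat.cast_nonneg _)]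
      have : (A.c A.D : ℝ) ≤ k := by exact_mod_cast (by omega : A.c A.D ≤ k)
      linarith
    refine le_trans (mul_le_mul (quadratic_abs_le hk3 (Nat.cast_nonneg _) (by linarith)
      (Nat.cast_nonneg b) hbk' hx (hsub _ (by omega)) hc) (mul_le_mul
      (energy_abs_le hk3 (Nat.cast_nonneg _) haA hx)
      (transfer_norm_le hk3 (Nat.cast_nonneg b) hbk' (hsub (A.a 1) (by omega)) b1 b2 b3 b4)
      (abs_nonneg _) (by positivity)) (by positivity) (by positivity)) (le_trans ?_ hexp)
    have h1 : (1 : ℝ) ≤ k ^ 3 := one_le_pow₀ hk1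
    have h2 : (1 : ℝ) ≤ k ^ 2 := one_le_pow₀ hk1
    rw [mul_pow _ ((3 * (k : ℝ) ^ 2) ^ 2), ← pow_mul (3 * (k : ℝ) ^ 2),
      ← pow_mul (3 * (k : ℝ) ^ 2), mul_comm 2 (s - h + 1)]
    calc _ = 16 * (k : ℝ) ^ 3 * (4 * (k : ℝ) ^ 3 * (20 * (k : ℝ) ^ 2)) *
          (3 * (k : ℝ) ^ 2) ^ ((s - h + 1) * 2) := by ring
      _ ≤ _ := by
        gcongr
        exact le_self_pow₀ (one_le_mul_of_one_le_of_one_le (by linarith)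
          (one_le_mul_of_one_le_of_one_le (by linarith) (by linarith))) (by omega)
  · intro x hx hxb
    rw [hRe]
    have h1 := band_energy_pos hA (by omega) hxb
    rw [hAk] at h1
    have h2 := sq_lt_of_abs_xi_lt (by omega) hxb
    rw [hAb] at h2
    refine (mul_pos (band_quadratic h2 ?_) (mul_pos h1 (transfer_norm_pos h2 (hd x)))).ne'
    rintro ⟨-, h4⟩
    have : (A.c A.D : ℝ) = 0 := by linarith
    have : A.c A.D = 0 := by exact_mod_cast this
    omega

end Arr

theorem exists_in_band {B p q k : ℝ} (hB : 1 < B) (hp : 1 ≤ p) (hq : 1 ≤ q) (hpB : p ≤ B)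
    (h1 : ¬ (q = 1 ∧ p = B)) (h2 : ¬ (q = B ∧ p = 1)) (hk : 1 + B ^ 2 ≤ k) :
    ∃ x : ℝ, |x - (k - p ^ 2 - q ^ 2)| < 2 * (p * q) ∧ 2 * B < |x - (k - 1 - B ^ 2)| ∧ x < k ∧
      k + (k - B ^ 2) * x ≠ 0 := by
  have hpq : 0 < p * q := by positivity
  by_cases hc : B + 1 < p + q
  · set L := k - (p + q) ^ 2 with hL
    set M := min (k - (B + 1) ^ 2) (k - (p - q) ^ 2) with hM
    have hLM : L < M := lt_min (by nlinarith) (by nlinarith)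
    have hM1 : M ≤ k - (B + 1) ^ 2 := min_le_left _ _
    have hM2 : M ≤ k - (p - q) ^ 2 := min_le_right _ _
    have key : ∀ x, L < x → x < M → |x - (k - p ^ 2 - q ^ 2)| < 2 * (p * q) ∧
        2 * B < |x - (k - 1 - B ^ 2)| ∧ x < k := fun x hx1 hx2 =>
      ⟨abs_lt.2 ⟨by nlinarith, by nlinarith⟩, lt_abs.2 (Or.inr (by nlinarith)), by nlinarith⟩
    by_cases h0 : k + (k - B ^ 2) * ((2 * L + M) / 3) = 0
    · obtain ⟨e1, e2, e3⟩ := key ((L + 2 * M) / 3) (by linarith) (by linarith)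
      exact ⟨_, e1, e2, e3, by nlinarith⟩
    · obtain ⟨e1, e2, e3⟩ := key ((2 * L + M) / 3) (by linarith) (by linarith)
      exact ⟨_, e1, e2, e3, h0⟩
  · have hlt : (p - q) ^ 2 < (B - 1) ^ 2 := by
      refine sq_lt_sq' ?_ ?_
      · by_contra! h
        exact h2 ⟨by linarith, by linarith⟩
      · by_contra! h
        exact h1 ⟨by linarith, by linarith⟩
    obtain ⟨x, hx1, hx2⟩ := exists_between (show max (k - (B - 1) ^ 2) (k - (p + q) ^ 2) <
      k - (p - q) ^ 2 from max_lt (by linarith) (by nlinarith))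
    rw [max_lt_iff] at hx1
    have hx0 : 0 < x := by nlinarith
    exact ⟨x, abs_lt.2 ⟨by nlinarith, by nlinarith⟩, lt_abs.2 (Or.inl (by nlinarith)), by nlinarith,
      ne_of_gt (by nlinarith)⟩

theorem exists_pow_lt_pow {C K r : ℝ} (hK : 1 ≤ K) (hr : 1 < r) :
    ∃ N : ℕ, ∀ h m : ℕ, N ≤ h → N * m ≤ h → C * h ^ 3 * K ^ (m + 1) < r ^ (2 * (h - 2)) := by
  have hL : 0 < Real.log r := Real.log_pos hr
  have hr0 : 0 < r := by linarith
  obtain ⟨N1, h1⟩ := exists_pow_le_exp hK hL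
  have ht : Tendsto (fun h : ℕ => C * r ^ 4 * ((h : ℝ) ^ 3 / r ^ h)) atTop (nhds (C * r ^ 4 * 0)) :=
    (tendsto_pow_const_div_const_pow_of_one_lt 3 hr).const_mul _
  rw [mul_zero] at ht
  obtain ⟨N2, h2⟩ := (ht.eventually_lt_const one_pos).exists_forall_of_atTop
  refine ⟨max (max N1 N2) 2, fun h m hN hm => ?_⟩
  have e1 := h1 h m (by omega) (le_trans (Nat.mul_le_mul_right _ (by omega)) hm)
  have e2 := h2 h (by omega)
  rw [mul_comm (Real.log r), Real.exp_nat_mul, Real.exp_log hr0] at e1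
  rw [mul_div_assoc', div_lt_one (by positivity)] at e2
  have e3 : r ^ (2 * (h - 2)) * r ^ 4 = r ^ h * r ^ h := by
    rw [← pow_add, ← pow_add]; congr 1; omega
  have hr4 : 0 < r ^ 4 := by positivity
  have hrh : 0 < r ^ h := by positivity
  refine lt_of_mul_lt_mul_right (a := r ^ 4) ?_ hr4.le
  rw [e3]
  rcases le_or_gt C 0 with hC | hC
  · have : C * h ^ 3 * K ^ (m + 1) * r ^ 4 ≤ 0 := by
      have : 0 ≤ (h : ℝ) ^ 3 * K ^ (m + 1) * r ^ 4 := by positivity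
      nlinarith
    exact this.trans_lt (by positivity)
  · calc C * h ^ 3 * K ^ (m + 1) * r ^ 4 = C * r ^ 4 * h ^ 3 * K ^ (m + 1) := by ring
      _ ≤ C * r ^ 4 * h ^ 3 * r ^ h := by gcongr
      _ < _ := by gcongr

/-- A conjugacy class with many close elements is too small a discriminant. -/
theorem disc_lt_one {n g : ℕ} {c M ε : ℝ} (hc : 0 < c) (hM : 1 < M)
    (hε : ε = Real.exp (-(5 * Real.log M / c ^ 2))) (hg : 2 ≤ g) (hng : c * n ≤ g) (hn : 0 < n) :
    ε ^ (g * (g - 1)) * M ^ (2 * n * n) < 1 := by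
  have hL := Real.log_pos hM
  rw [hε, ← Real.exp_nat_mul, ← Real.exp_log (show 0 < M by linarith), ← Real.exp_nat_mul,
    ← Real.exp_add, Real.exp_lt_one_iff, Real.log_exp]
  have hgg : (g : ℝ) ^ 2 / 2 ≤ ((g * (g - 1) : ℕ) : ℝ) := by
    rw [Nat.cast_mul, Nat.cast_sub (by omega)]
    have : (2 : ℝ) ≤ g := by exact_mod_cast hg
    push_cast; nlinarith
  have hn' : (0 : ℝ) < n := by exact_mod_cast hn
  have h1 : (c * n) ^ 2 ≤ (g : ℝ) ^ 2 := pow_le_pow_left₀ (by positivity) hng 2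
  have h2 : c ^ 2 * n ^ 2 / 2 * (5 * Real.log M / c ^ 2) ≤
      ((g * (g - 1) : ℕ) : ℝ) * (5 * Real.log M / c ^ 2) := by
    gcongr; linarith
  have h3 : c ^ 2 * n ^ 2 / 2 * (5 * Real.log M / c ^ 2) = 5 / 2 * n ^ 2 * Real.log M := by
    field_simp
  push_cast at *
  nlinarith [mul_pos (pow_pos hn' 2) hL]

namespace Arr

variable {A : Arr} {h : ℕ}

/-- Among many nodes some conjugacy class is large and has a positive proportion. -/
theorem exists_dense_class {G : Finset ℝ} (hG : G ⊆ A.nodes) {Z : Finset ℝ} {n₀ : ℕ}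
    (hZ : ∀ x ∈ A.nodes, (A.cls x).card ≤ n₀ → x ∈ Z) {c : ℝ} (hc : 0 ≤ c)
    (hcard : c * A.nodes.card + Z.card < G.card) :
    ∃ x ∈ A.nodes, n₀ < (A.cls x).card ∧ c * (A.cls x).card ≤ (A.cls x ∩ G).card := by
  classical
  by_contra! hcon
  set N := A.nodes.filter fun x => n₀ < (A.cls x).card with hN
  set I := N.image A.cls with hI
  have hcls : ∀ x ∈ N, N.filter (fun y => A.cls y = A.cls x) = A.cls x := by
    intro x hx
    rw [hN, Finset.mem_filter] at hx
    ext y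
    simp only [hN, Finset.mem_filter]
    constructor
    · rintro ⟨⟨h1, -⟩, h2⟩
      rw [← h2]; exact mem_cls_self h1
    · intro hy
      have := cls_eq hx.1 hy
      exact ⟨⟨cls_subset A x hy, this ▸ hx.2⟩, this⟩
  have h1 : N.card = ∑ S ∈ I, (N.filter fun y => A.cls y = S).card :=
    Finset.card_eq_sum_card_image _ _
  have h2 : (G ∩ N).card = ∑ S ∈ I, ((G ∩ N).filter fun y => A.cls y = S).card :=
    Finset.card_eq_sum_card_fiberwise fun x hx =>
      Finset.mem_image_of_mem _ (Finset.mem_inter.1 hx).2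
  have h3 : ((G ∩ N).card : ℝ) ≤ c * N.card := by
    rw [h1, h2, Nat.cast_sum, Nat.cast_sum, Finset.mul_sum]
    refine Finset.sum_le_sum fun S hS => ?_
    obtain ⟨x, hx, rfl⟩ := Finset.mem_image.1 hS
    rw [hcls x hx]
    rw [hN, Finset.mem_filter] at hx
    refine le_trans ?_ (hcon x hx.1 hx.2).le
    norm_cast
    refine Finset.card_le_card fun y hy => ?_
    simp only [Finset.mem_filter, Finset.mem_inter] at hy ⊢
    refine ⟨hy.2 ▸ mem_cls_self (hG hy.1.1), hy.1.1⟩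
  have h4 : (G \ N).card ≤ Z.card := by
    refine Finset.card_le_card fun y hy => ?_
    rw [Finset.mem_sdiff, hN, Finset.mem_filter] at hy
    exact hZ y (hG hy.1) (not_lt.1 fun h => hy.2 ⟨hG hy.1, h⟩)
  have h5 : (G ∩ N).card + (G \ N).card = G.card := Finset.card_inter_add_card_sdiff _ _
  have h6 : (N.card : ℝ) ≤ A.nodes.card := by
    exact_mod_cast Finset.card_le_card (Finset.filter_subset _ _)
  have h5' : ((G ∩ N).card : ℝ) + (G \ N).card = G.card := by exact_mod_cast h5
  have h4' : ((G \ N).card : ℝ) ≤ Z.card := by exact_mod_cast h4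
  nlinarith [mul_le_mul_of_nonneg_left h6 hc]

theorem Reg.pair_le (hA : A.Reg) {x : ℝ} (hx : |x| ≤ A.b 0) {i : ℕ} (hi : i + 2 ≤ A.D) :
    A.e (i + 1) x ^ 2 + A.e (i + 2) x ^ 2 ≤
      (8 * (A.b 0 : ℝ) ^ 2 + 1) * (A.e i x ^ 2 + A.e (i + 1) x ^ 2) := by
  have h1 := hA.sqrt_mul_e x hi
  have hs := hA.sum (i + 1) (by omega)
  have hc := hA.sum i (by omega)
  set k : ℝ := ((A.b 0 : ℕ) : ℝ) with hk
  have hk0 : 0 ≤ k := by positivity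
  have hcast : ∀ n ≤ A.b 0, (n : ℝ) ≤ k := fun n h => by rw [hk]; exact_mod_cast h
  have ha : (A.a (i + 1) : ℝ) ≤ k := hcast _ (by omega)
  have hxa : |x - A.a (i + 1)| ≤ 2 * k := by
    refine (abs_sub _ _).trans ?_
    rw [Nat.abs_cast]; linarith
  have hb1 : √(A.bet i : ℝ) ≤ k := by
    rw [Real.sqrt_le_left hk0, bet, Nat.cast_mul, sq]
    gcongr
    · exact hcast _ (by omega)
    · exact hcast _ (by omega)
  have hb2 : 1 ≤ √(A.bet (i + 1) : ℝ) := by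
    rw [Real.one_le_sqrt]; exact_mod_cast hA.bet_pos (by omega)
  have h2 : |A.e (i + 2) x| ≤ 2 * k * |A.e (i + 1) x| + k * |A.e i x| := by
    calc |A.e (i + 2) x| ≤ √(A.bet (i + 1) : ℝ) * |A.e (i + 2) x| :=
          le_mul_of_one_le_left (abs_nonneg _) hb2
      _ = |√(A.bet (i + 1) : ℝ) * A.e (i + 2) x| := by
          rw [abs_mul, abs_of_nonneg (Real.sqrt_nonneg _)]
      _ ≤ |x - A.a (i + 1)| * |A.e (i + 1) x| + √(A.bet i : ℝ) * |A.e i x| := by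
          rw [h1]
          refine (abs_sub _ _).trans ?_
          rw [abs_mul, abs_mul, abs_of_nonneg (Real.sqrt_nonneg (A.bet i : ℝ))]
      _ ≤ _ := by gcongr
  have h3 := pow_le_pow_left₀ (abs_nonneg _) h2 2
  rw [sq_abs] at h3
  rw [← sq_abs (A.e i x), ← sq_abs (A.e (i + 1) x)]
  nlinarith [sq_nonneg (k * (2 * |A.e (i + 1) x| - |A.e i x|)), sq_nonneg (k * |A.e i x|),
    sq_nonneg |A.e i x|]

theorem Reg.pair_add_le (hA : A.Reg) {x : ℝ} (hx : |x| ≤ A.b 0) {i : ℕ} (n : ℕ) :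
    i + n + 1 ≤ A.D → A.e (i + n) x ^ 2 + A.e (i + n + 1) x ^ 2 ≤
      (8 * (A.b 0 : ℝ) ^ 2 + 1) ^ n * (A.e i x ^ 2 + A.e (i + 1) x ^ 2) := by
  induction n with
  | zero => simp
  | succ n ih =>
    intro hi
    refine (hA.pair_le hx (i := i + n) (by omega)).trans ?_
    rw [pow_succ' _ n, mul_assoc]
    exact mul_le_mul_of_nonneg_left (ih (by omega)) (by positivity)

theorem Reg.pair_zero_le (hA : A.Reg) {x : ℝ} (hx : |x| ≤ A.b 0) :
    A.e 0 x ^ 2 + A.e 1 x ^ 2 ≤ 8 * (A.b 0 : ℝ) ^ 2 + 1 := by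
  have h1 := hA.sqrt_mul_e_one x
  have hk : (3 : ℝ) ≤ A.b 0 := by exact_mod_cast hA.three_le
  rw [hA.bet_zero, hA.a_zero, e_zero, Nat.cast_zero, sub_zero, mul_one] at h1
  have h2 : (A.b 0 : ℝ) * A.e 1 x ^ 2 = x ^ 2 := by
    have h := congrArg (· ^ 2) h1
    simpa only [mul_pow, Real.sq_sqrt (show (0 : ℝ) ≤ A.b 0 by linarith)] using h
  have h3 : x ^ 2 ≤ (A.b 0 : ℝ) ^ 2 := sq_le_sq' (by linarith [neg_le_of_abs_le hx]) (le_of_abs_le hx)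
  rw [e_zero]
  nlinarith [sq_nonneg (A.e 1 x)]

theorem Reg.abs_e_one_le (hA : A.Reg) {x : ℝ} (hx : |x| ≤ A.b 0) :
    |A.e 1 x| ≤ 8 * (A.b 0 : ℝ) ^ 2 + 1 := by
  have h1 := hA.pair_zero_le hx
  refine abs_le_of_sq_le_sq ?_ (by positivity)
  nlinarith [sq_nonneg (A.e 0 x), sq_nonneg (A.b 0 : ℝ)]

theorem Reg.abs_e_two_le (hA : A.Reg) {x : ℝ} (hx : |x| ≤ A.b 0) :
    |A.e (1 + 1) x| ≤ 8 * (A.b 0 : ℝ) ^ 2 + 1 := by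
  have h1 := hA.pair_zero_le hx
  have h2 := hA.pair_le hx (i := 0) (by have := hA.two_le; omega)
  refine abs_le_of_sq_le_sq ?_ (by positivity)
  simp only [zero_add] at h2
  rw [show 1 + 1 = 2 from rfl]
  nlinarith [sq_nonneg (A.e 1 x), sq_nonneg (A.b 0 : ℝ)]

/-- Outside of the band the head grows at most geometrically. -/
theorem Head.abs_e_le (hh : A.Head h) (hA : A.Reg) {x z : ℝ} (hx : |x| ≤ A.b 0)
    (hz1 : 1 ≤ |z|) (hzx : z + z⁻¹ = 2 * A.xi x) (i : ℕ) : 1 + i ≤ h →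
    |A.e (1 + i) x| ≤ (i + 1) * (2 * (8 * (A.b 0 : ℝ) ^ 2 + 1)) * |z| ^ i := by
  have hz : z ≠ 0 := by rintro rfl; simp at hz1; linarith
  have hzi : |z⁻¹| ≤ 1 := by rw [abs_inv]; exact inv_le_one_of_one_le₀ hz1
  have e1 := hA.abs_e_one_le hx
  have e2 := hA.abs_e_two_le hx
  set K := 8 * (A.b 0 : ℝ) ^ 2 + 1
  have hK : 0 ≤ K := by positivity
  induction i with
  | zero => intro _; simp; linarith
  | succ i ih =>
    intro hi
    have h1 := rec_geom (f := fun i => A.e i x) (ξ := A.xi x) (p := 1) (q := h)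
      (fun i h1 h2 => hh.e_rec hA x h1 h2) (z := z) (w := z⁻¹) (mul_inv_cancel₀ hz) hzx (i := i)
      (by omega)
    have h2 : A.e (1 + (i + 1)) x = z⁻¹ * A.e (1 + i) x +
        z ^ i * (A.e (1 + 1) x - z⁻¹ * A.e 1 x) := by
      rw [← add_assoc]; linarith
    have h3 : |A.e (1 + 1) x - z⁻¹ * A.e 1 x| ≤ 2 * K := by
      refine (abs_sub _ _).trans ?_
      rw [abs_mul]
      nlinarith [abs_nonneg (A.e 1 x)]
    have hzp : |z| ^ i ≤ |z| ^ (i + 1) := pow_le_pow_right₀ hz1 (by omega)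
    have hzp0 : 0 ≤ |z| ^ i := by positivity
    calc |A.e (1 + (i + 1)) x| ≤ 1 * ((i + 1) * (2 * K) * |z| ^ i) + |z| ^ i * (2 * K) := by
          rw [h2]
          refine (abs_add_le _ _).trans ?_
          rw [abs_mul, abs_mul, abs_pow]
          have := ih (by omega)
          gcongr
      _ = (i + 2) * (2 * K) * |z| ^ i := by ring
      _ ≤ (i + 2) * (2 * K) * |z| ^ (i + 1) := by gcongr
      _ = _ := by push_cast; ring

theorem Head.pair_le (hh : A.Head h) (hA : A.Reg) (h2 : 2 ≤ h) {x z : ℝ} (hx : |x| ≤ A.b 0)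
    (hz1 : 1 ≤ |z|) (hzx : z + z⁻¹ = 2 * A.xi x) : A.e (h - 1) x ^ 2 + A.e (h - 1 + 1) x ^ 2 ≤
      8 * h ^ 2 * (8 * (A.b 0 : ℝ) ^ 2 + 1) ^ 2 * |z| ^ 2 * |z| ^ (2 * (h - 2)) := by
  obtain ⟨j, rfl⟩ : ∃ j, h = j + 2 := ⟨h - 2, by omega⟩
  have e1 := hh.abs_e_le hA hx hz1 hzx j (by omega)
  have e2 := hh.abs_e_le hA hx hz1 hzx (j + 1) (by omega)
  set K := 8 * (A.b 0 : ℝ) ^ 2 + 1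
  have hK : 0 ≤ K := by positivity
  have hzp : |z| ^ j ≤ |z| ^ (j + 1) := pow_le_pow_right₀ hz1 (by omega)
  rw [show j + 2 - 1 + 1 = 1 + (j + 1) by omega, show j + 2 - 1 = 1 + j by omega,
    Nat.add_sub_cancel]
  have e1' : |A.e (1 + j) x| ≤ (j + 2) * (2 * K) * |z| ^ (j + 1) :=
    e1.trans (by gcongr; norm_num)
  have e2' : |A.e (1 + (j + 1)) x| ≤ (j + 2) * (2 * K) * |z| ^ (j + 1) := by
    refine e2.trans (le_of_eq ?_); push_cast; ring
  have f1 := pow_le_pow_left₀ (abs_nonneg _) e1' 2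
  have f2 := pow_le_pow_left₀ (abs_nonneg _) e2' 2
  rw [sq_abs] at f1 f2
  calc _ ≤ ((j + 2) * (2 * K) * |z| ^ (j + 1)) ^ 2 + ((j + 2) * (2 * K) * |z| ^ (j + 1)) ^ 2 :=
        add_le_add f1 f2
    _ = _ := by push_cast; ring

theorem Head.sq_pow_mul_En_le (hh : A.Head h) (hA : A.Reg) (h2 : 2 ≤ h) {x z : ℝ}
    (hx : |x| ≤ A.b 0) (hz1 : 1 ≤ |z|) (hzx : z + z⁻¹ = 2 * A.xi x) :
    |z| ^ (2 * (h - 2)) * A.En x ^ 2 ≤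
      4 * (1 + |z|) ^ 2 * (8 * (A.b 0 : ℝ) ^ 2 + 1) ^ 2 * A.F x := by
  obtain ⟨j, rfl⟩ : ∃ j, h = j + 2 := ⟨h - 2, by omega⟩
  have hz : z ≠ 0 := by rintro rfl; simp at hz1; linarith
  have hD := hh.lt
  have h1 := rec_geom (f := fun i => A.e i x) (ξ := A.xi x) (p := 1) (q := j + 2)
    (fun i h1 h2 => hh.e_rec hA x h1 h2) (z := z) (w := z⁻¹) (mul_inv_cancel₀ hz) hzx (i := j)
    (by omega)
  have h3 := hh.energy hA h2 x
  have h4 : (A.e (1 + 1) x - z⁻¹ * A.e 1 x) * (A.e (1 + 1) x - z * A.e 1 x) = A.En x := by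
    rw [← h3, ← hzx]; field_simp; ring
  have hF0 : 0 ≤ A.F x := zero_le_one.trans (A.one_le_F x)
  have hb : ∀ i ≤ A.D, |A.e i x| ≤ √(A.F x) := fun i hi => by
    rw [← Real.sqrt_sq_eq_abs]; exact Real.sqrt_le_sqrt (A.e_sq_le_F x hi)
  have hzi : |z⁻¹| ≤ 1 := by rw [abs_inv]; exact inv_le_one_of_one_le₀ hz1
  have h5 : |A.e (1 + j + 1) x - z⁻¹ * A.e (1 + j) x| ≤ 2 * √(A.F x) := by
    refine (abs_sub _ _).trans ?_
    rw [abs_mul]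
    nlinarith [hb (1 + j + 1) (by omega), hb (1 + j) (by omega), abs_nonneg (A.e (1 + j) x)]
  have e1 := hA.abs_e_one_le hx
  have e2 := hA.abs_e_two_le hx
  set K := 8 * (A.b 0 : ℝ) ^ 2 + 1
  have h6 : |A.e (1 + 1) x - z * A.e 1 x| ≤ (1 + |z|) * K := by
    refine (abs_sub _ _).trans ?_
    rw [abs_mul]
    nlinarith [abs_nonneg z]
  have h7 : (z ^ j * A.En x) ^ 2 ≤ ((2 * √(A.F x)) * ((1 + |z|) * K)) ^ 2 := by
    rw [← sq_abs (z ^ j * A.En x)]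
    refine pow_le_pow_left₀ (abs_nonneg _) ?_ 2
    rw [← h4, ← mul_assoc, ← h1, abs_mul]
    exact mul_le_mul h5 h6 (abs_nonneg _) (by positivity)
  calc |z| ^ (2 * (j + 2 - 2)) * A.En x ^ 2 = (z ^ j * A.En x) ^ 2 := by
        rw [Nat.add_sub_cancel, pow_mul, sq_abs]; ring
    _ ≤ _ := h7
    _ = 4 * (1 + |z|) ^ 2 * K ^ 2 * √(A.F x) ^ 2 := by ring
    _ = _ := by rw [Real.sq_sqrt hF0]

end Arr

theorem abs_sub_le_of_add_inv {ξ ξ' z z' : ℝ} (hz : 1 ≤ |z|) (hz' : 1 ≤ |z'|)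
    (h : z + z⁻¹ = 2 * ξ) (h' : z' + z'⁻¹ = 2 * ξ') (hs : 0 < ξ * ξ') :
    |2 * ξ - 2 * ξ'| ≤ |(|z| - |z'|)| := by
  have h0 : z ≠ 0 := by rintro rfl; simp at hz; linarith
  have h0' : z' ≠ 0 := by rintro rfl; simp at hz'; linarith
  have e : z * ξ = (z ^ 2 + 1) / 2 := by
    have : ξ = (z + z⁻¹) / 2 := by linarith
    rw [this]; field_simp
  have e' : z' * ξ' = (z' ^ 2 + 1) / 2 := by
    have : ξ' = (z' + z'⁻¹) / 2 := by linarith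
    rw [this]; field_simp
  have hzz : 0 < z * z' := by
    have h1 : 0 < (z * ξ) * (z' * ξ') := by rw [e, e']; positivity
    have h2 : (z * ξ) * (z' * ξ') = (z * z') * (ξ * ξ') := by ring
    rw [h2] at h1
    exact pos_of_mul_pos_left h1 hs.le
  have hzz1 : 1 ≤ z * z' := by
    rw [← abs_of_pos hzz, abs_mul]; exact one_le_mul_of_one_le_of_one_le hz hz'
  have hsub : |z - z'| = |(|z| - |z'|)| := by
    rcases mul_pos_iff.1 hzz with ⟨h1, h2⟩ | ⟨h1, h2⟩
    · rw [abs_of_pos h1, abs_of_pos h2]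
    · rw [abs_of_neg h1, abs_of_neg h2, ← abs_neg]; congr 1; ring
  have h3 : 2 * ξ - 2 * ξ' = (z - z') * (1 - (z * z')⁻¹) := by
    rw [← h, ← h']; field_simp; ring
  have h4 : |1 - (z * z')⁻¹| ≤ 1 := by
    have h5 := inv_le_one_of_one_le₀ hzz1
    have h6 := inv_pos.2 hzz
    rw [abs_le]; constructor <;> linarith
  rw [h3, abs_mul, hsub]
  exact mul_le_of_le_one_right (abs_nonneg _) h4

theorem exists_band_nhds {k b c' b' : ℕ} (hb : 2 ≤ b) (hbk : 1 + b ≤ k) (hc' : 1 ≤ c')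
    (hb' : 1 ≤ b') (hbb : b' ≤ b) (h1 : ¬ (c' = 1 ∧ b' = b)) (h2 : ¬ (c' = b ∧ b' = 1)) :
    ∃ x σ δ κ E : ℝ, 0 < δ ∧ 0 < κ ∧ 0 < E ∧
      |x - ((k : ℝ) - b' - c')| < 2 * √((b' * c' : ℕ) : ℝ) ∧
      ∀ y, |y - x| ≤ δ → E < (((k : ℝ) - y) * (k + (k - b) * y) / (k * b)) ^ 2 ∧
        1 < |(y - (k - 1 - b)) / (2 * √(b : ℝ))| ∧ 0 < σ * ((y - (k - 1 - b)) / (2 * √(b : ℝ))) ∧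
        κ < 1 - ((y - ((k : ℝ) - b' - c')) / (2 * √((b' * c' : ℕ) : ℝ))) ^ 2 := by
  have hbR : (2 : ℝ) ≤ b := by exact_mod_cast hb
  have hB : 1 < √(b : ℝ) := Real.lt_sqrt_of_sq_lt (by linarith)
  have hp : 1 ≤ √(b' : ℝ) := Real.one_le_sqrt.2 (by exact_mod_cast hb')
  have hq : 1 ≤ √(c' : ℝ) := Real.one_le_sqrt.2 (by exact_mod_cast hc')
  have hinj : ∀ m n : ℕ, √(m : ℝ) = √(n : ℝ) → m = n := fun m n h => by
    rw [Real.sqrt_inj (by positivity) (by positivity)] at h; exact_mod_cast h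
  have hsB := Real.sq_sqrt (show (0 : ℝ) ≤ b by positivity)
  have hsp := Real.sq_sqrt (show (0 : ℝ) ≤ b' by positivity)
  have hsq := Real.sq_sqrt (show (0 : ℝ) ≤ c' by positivity)
  have hkb : (1 : ℝ) + b ≤ k := by exact_mod_cast hbk
  obtain ⟨x, hx1, hx2, hx3, hx4⟩ := exists_in_band (k := k) hB hp hq
    (Real.sqrt_le_sqrt (by exact_mod_cast hbb))
    (fun h => h1 ⟨hinj _ _ (by rw [h.1]; simp), hinj _ _ h.2⟩)
    (fun h => h2 ⟨hinj _ _ h.1, hinj _ _ (by rw [h.2]; simp)⟩) (by rw [hsB]; exact hkb)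
  rw [hsp, hsq] at hx1
  rw [hsB] at hx2 hx4
  have hpq : √((b' * c' : ℕ) : ℝ) = √(b' : ℝ) * √(c' : ℝ) := by
    rw [Nat.cast_mul, Real.sqrt_mul (by positivity)]
  rw [← hpq] at hx1
  have hr0 : 0 < 2 * √((b' * c' : ℕ) : ℝ) := (abs_nonneg _).trans_lt hx1
  have hB0 : 0 < 2 * √(b : ℝ) := by linarith
  have p1 : 0 < (((k : ℝ) - x) * (k + (k - b) * x) / (k * b)) ^ 2 := by
    refine sq_pos_of_ne_zero (div_ne_zero (mul_ne_zero (by linarith) hx4) ?_)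
    have : (0 : ℝ) < k := by linarith
    positivity
  have p2 : 1 < |(x - (k - 1 - b)) / (2 * √(b : ℝ))| := by
    rwa [abs_div, abs_of_pos hB0, one_lt_div hB0]
  have p3 : 0 < ((x - (k - 1 - b)) / (2 * √(b : ℝ))) * ((x - (k - 1 - b)) / (2 * √(b : ℝ))) := by
    rw [← abs_mul_abs_self]; positivity
  have p4 : 0 < 1 - ((x - ((k : ℝ) - b' - c')) / (2 * √((b' * c' : ℕ) : ℝ))) ^ 2 := by
    rw [sub_pos, sq_lt_one_iff_abs_lt_one, abs_div, abs_of_pos hr0, div_lt_one hr0]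
    exact hx1
  obtain ⟨E, hE0, hE⟩ := exists_between p1
  obtain ⟨κ, hκ0, hκ⟩ := exists_between p4
  have c1 : Continuous fun y : ℝ => (((k : ℝ) - y) * (k + (k - b) * y) / (k * b)) ^ 2 := by fun_prop
  have c2 : Continuous fun y : ℝ => |(y - (k - 1 - b)) / (2 * √(b : ℝ))| := by fun_prop
  have c3 : Continuous fun y : ℝ => ((x - (k - 1 - b)) / (2 * √(b : ℝ))) *
    ((y - (k - 1 - b)) / (2 * √(b : ℝ))) := by fun_prop
  have c4 : Continuous fun y : ℝ => 1 - ((y - ((k : ℝ) - b' - c')) /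
    (2 * √((b' * c' : ℕ) : ℝ))) ^ 2 := by fun_prop
  have hev := ((c1.tendsto x).eventually_const_lt hE).and (((c2.tendsto x).eventually_const_lt p2).and
    (((c3.tendsto x).eventually_const_lt p3).and ((c4.tendsto x).eventually_const_lt hκ)))
  obtain ⟨δ, hδ, hball⟩ := Metric.nhds_basis_closedBall.eventually_iff.1 hev
  exact ⟨x, _, δ, κ, E, hδ, hκ0, hE0, hx1, fun y hy => hball (by
    rwa [Metric.mem_closedBall, Real.dist_eq])⟩

namespace Arr

variable {A : Arr} {h : ℕ}

/-- In the band of a piece of constant intersection numbers a solution is bounded by its initial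
values. -/
theorem Reg.piece_le (hA : A.Reg) {s ℓ a β : ℕ} (hℓ : 2 ≤ ℓ) (hD : s + ℓ ≤ A.D) (hβ : 1 ≤ β)
    (ha : ∀ i, s ≤ i → i < s + ℓ → A.a i = a)
    (hbet : ∀ i, s ≤ i → i + 1 < s + ℓ → A.bet i = β) {x κ : ℝ} (hκ0 : 0 < κ)
    (hκ : κ < 1 - ((x - a) / (2 * √(β : ℝ))) ^ 2) {i : ℕ} (hi : s ≤ i) (hi' : i < s + ℓ) :
    A.e i x ^ 2 ≤ 2 / κ * (A.e s x ^ 2 + A.e (s + 1) x ^ 2) := by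
  have hβ0 : 0 < √(β : ℝ) := Real.sqrt_pos.2 (by exact_mod_cast hβ)
  have h1 := rec_sq_le (f := fun i => A.e i x) (ξ := (x - a) / (2 * √(β : ℝ))) (p := s)
    (q := s + ℓ - 1) (fun i h1 h2 => by
      have := hA.e_rec (i := i) (by omega) (ha (i + 1) (by omega) (by omega))
        (hbet i h1 (by omega)) (hbet (i + 1) (by omega) (by omega)) x
      field_simp
      linarith) (by omega) hi (by omega)
  set ξ := (x - a) / (2 * √(β : ℝ))
  have h2 : A.e s x ^ 2 + A.e (s + 1) x ^ 2 - 2 * ξ * A.e s x * A.e (s + 1) x ≤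
      2 * (A.e s x ^ 2 + A.e (s + 1) x ^ 2) := by
    have hξ : |ξ| ≤ 1 := by
      rw [← sq_le_one_iff_abs_le_one]; linarith
    rw [_root_.abs_le] at hξ
    nlinarith [mul_nonneg (by linarith [hξ.1] : 0 ≤ 1 + ξ) (sq_nonneg (A.e s x + A.e (s + 1) x)),
      mul_nonneg (by linarith [hξ.2] : 0 ≤ 1 - ξ) (sq_nonneg (A.e s x - A.e (s + 1) x))]
  rw [div_mul_eq_mul_div, le_div_iff₀ hκ0]
  nlinarith [sq_nonneg (A.e i x)]

theorem Head.D_succ_le (hh : A.Head h) (hA : A.Reg) :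
    (A.D + 1 : ℝ) ≤ 2 ^ (2 * A.b 0 + 2) * h := by
  have h1 := hh.D_lt hA
  have h2 := hh.one_le
  have h3 : 2 ^ (2 * A.b 0 + 1) * (h + 1) ≤ 2 ^ (2 * A.b 0 + 1) * (2 * h) := by gcongr; omega
  have h4 : A.D + 1 ≤ 2 ^ (2 * A.b 0 + 2) * h := by rw [pow_succ]; linarith
  exact_mod_cast h4

theorem Head.F_le_of_piece (hh : A.Head h) (hA : A.Reg) (h2 : 2 ≤ h) {s ℓ a β : ℕ} (hs : h < s)
    (hℓ : 2 ≤ ℓ) (hD : s + ℓ ≤ A.D) (hβ : 1 ≤ β)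
    (ha : ∀ i, s ≤ i → i < s + ℓ → A.a i = a)
    (hbet : ∀ i, s ≤ i → i + 1 < s + ℓ → A.bet i = β) {x κ : ℝ} (hκ0 : 0 < κ)
    (hκ : κ < 1 - ((x - a) / (2 * √(β : ℝ))) ^ 2) {m W : ℕ} (hm : 1 ≤ m) (hmW : m * W ≤ ℓ - 2)
    (hF : m * A.F x ≤ 4 * (A.D + 1) * ∑ i ∈ Finset.range (m * W), A.e (s + 1 + i) x ^ 2)
    (hx : |x| ≤ A.b 0) {z : ℝ} (hz1 : 1 ≤ |z|) (hzx : z + z⁻¹ = 2 * A.xi x) :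
    A.F x ≤ 64 * 2 ^ (2 * A.b 0 + 2) * W / κ * (8 * (A.b 0 : ℝ) ^ 2 + 1) ^ 2 * |z| ^ 2 *
      (h ^ 3 * (8 * (A.b 0 : ℝ) ^ 2 + 1) ^ (s - h + 1) * |z| ^ (2 * (h - 2))) := by
  have e1 := hh.pair_le hA h2 hx hz1 hzx
  have e2 := hA.pair_add_le hx (i := h - 1) (s - h + 1) (by omega)
  have e3 := hh.D_succ_le hA
  rw [show h - 1 + (s - h + 1) = s by omega] at e2
  set K := 8 * (A.b 0 : ℝ) ^ 2 + 1
  have hK : 0 ≤ K := by positivity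
  set P := A.e s x ^ 2 + A.e (s + 1) x ^ 2
  have hP : 0 ≤ P := by positivity
  have hsum : ∑ i ∈ Finset.range (m * W), A.e (s + 1 + i) x ^ 2 ≤ m * W * (2 / κ * P) := by
    refine (Finset.sum_le_sum fun i hi => hA.piece_le hℓ hD hβ ha hbet hκ0 hκ
      (i := s + 1 + i) (by omega) (by rw [Finset.mem_range] at hi; omega)).trans ?_
    rw [Finset.sum_const, Finset.card_range, nsmul_eq_mul, Nat.cast_mul]
  have hm0 : (0 : ℝ) < m := by exact_mod_cast hm
  have h3 : m * A.F x ≤ m * (4 * (2 ^ (2 * A.b 0 + 2) * h) * (W * (2 / κ * P))) := by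
    calc _ ≤ _ := hF
      _ ≤ 4 * (2 ^ (2 * A.b 0 + 2) * h) * (m * W * (2 / κ * P)) := by gcongr
      _ = _ := by ring
  have h4 := le_of_mul_le_mul_left h3 hm0
  have h5 : P ≤ K ^ (s - h + 1) * (8 * h ^ 2 * K ^ 2 * |z| ^ 2 * |z| ^ (2 * (h - 2))) :=
    e2.trans (by gcongr)
  calc A.F x ≤ 4 * (2 ^ (2 * A.b 0 + 2) * h) * (W * (2 / κ * P)) := h4
    _ ≤ 4 * (2 ^ (2 * A.b 0 + 2) * h) * (W * (2 / κ *
        (K ^ (s - h + 1) * (8 * h ^ 2 * K ^ 2 * |z| ^ 2 * |z| ^ (2 * (h - 2)))))) := by gcongr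
    _ = _ := by ring

end Arr

namespace Arr

set_option maxHeartbeats 2000000 in
/-- A long constant piece close to the head whose band differs from the band of the head. -/
theorem long_piece {k b c' b' : ℕ} (hb : 2 ≤ b) (hbk : 1 + b ≤ k) (hc' : 1 ≤ c') (hb' : 1 ≤ b')
    (hbb : b' ≤ b) (h1 : ¬ (c' = 1 ∧ b' = b)) (h2 : ¬ (c' = b ∧ b' = 1)) {η : ℝ} (hη : 0 < η) :
    ∃ N : ℕ, ∀ (A : Arr) (h s ℓ : ℕ), A.Reg → A.b 0 = k → A.b 1 = b → A.Head h → N ≤ h → h < s →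
      N * (s - h) ≤ h → s + ℓ ≤ A.D → η * h ≤ ℓ →
      (∀ i, s ≤ i → i < s + ℓ → A.c i = c' ∧ A.b i = b') → False := by
  classical
  obtain ⟨x₀, σ, δ, κ, E, hδ, hκ0, hE0, hx₀, hnb⟩ := exists_band_nhds hb hbk hc' hb' hbb h1 h2
  have hk1 : (3 : ℝ) ≤ k := by exact_mod_cast (by omega : 3 ≤ k)
  obtain ⟨W, hW⟩ := exists_nat_ge (16 * ((b' * c' : ℕ) : ℝ) / δ ^ 2)
  rw [div_le_iff₀ (by positivity), mul_comm (W : ℝ)] at hW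
  have hβ : 1 ≤ b' * c' := Nat.one_le_iff_ne_zero.2 (by positivity)
  have hW0 : 0 < W := by
    rcases Nat.eq_zero_or_pos W with rfl | h
    · rw [Nat.cast_zero, mul_zero] at hW
      have : (1 : ℝ) ≤ ((b' * c' : ℕ) : ℝ) := by exact_mod_cast hβ
      linarith
    · exact h
  have hWR : (1 : ℝ) ≤ W := by exact_mod_cast hW0
  set c : ℝ := η / (16 * W * 2 ^ (2 * k + 2)) with hc
  have hc0 : 0 < c := by positivity
  obtain ⟨n₀, hn₀⟩ := exists_nat_ge (2 / c)
  rw [div_le_iff₀ hc0] at hn₀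
  set Z := (ConjSet.finite_of_card_le n₀ k).toFinset with hZ
  obtain ⟨ε, hε⟩ : ∃ ε : ℝ, ε = Real.exp (-(5 * Real.log (2 * k) / c ^ 2)) := ⟨_, rfl⟩
  have hε0 : 0 < ε := hε ▸ Real.exp_pos _
  obtain ⟨K, hK⟩ : ∃ K : ℝ, K = 8 * (k : ℝ) ^ 2 + 1 := ⟨_, rfl⟩
  have hK1 : 1 ≤ K := by rw [hK]; nlinarith
  obtain ⟨C, hC⟩ : ∃ C : ℝ, C = 4 * (1 + 2 * (k : ℝ)) ^ 2 * K ^ 2 *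
    (64 * 2 ^ (2 * k + 2) * W / κ * K ^ 2 * (2 * (k : ℝ)) ^ 2) / E := ⟨_, rfl⟩
  obtain ⟨N1, hN1⟩ := exists_pow_lt_pow (C := C) (K := K) (r := 1 + ε / (2 * (k : ℝ) ^ 2)) hK1
    (by have : 0 < ε / (2 * (k : ℝ) ^ 2) := by positivity
        linarith)
  obtain ⟨N2, hN2⟩ := exists_nat_gt ((2 * (2 + W) + 16 * W * (Z.card + 1)) / η)
  refine ⟨max (max N1 N2) 2, fun A h s ℓ hA hAk hAb hh hN hhs hNs hsD hℓ hpc => ?_⟩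
  have hlt := hN1 h (s - h) (by omega) (le_trans (Nat.mul_le_mul_right _ (by omega)) hNs)
  have hηh : 2 * (2 + W) + 16 * W * (Z.card + 1) < η * h := by
    rw [div_lt_iff₀ hη] at hN2
    have : (N2 : ℝ) ≤ h := by exact_mod_cast (by omega : N2 ≤ h)
    nlinarith
  have hh0 : (0 : ℝ) < h := by exact_mod_cast (by omega : 0 < h)
  have hℓ2 : W + 2 ≤ ℓ := by
    have : ((W + 2 : ℕ) : ℝ) ≤ ℓ := by
      push_cast
      have : (0 : ℝ) ≤ 16 * W * (Z.card + 1) := by positivity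
      linarith
    exact_mod_cast this
  set m := (ℓ - 2) / W with hm
  have hmW : m * W ≤ ℓ - 2 := Nat.div_mul_le_self _ _
  have hm1 : 1 ≤ m := (Nat.one_le_div_iff hW0).2 (by omega)
  have hmlow : η * h / (2 * W) ≤ m := by
    have h3 : ℓ ≤ m * W + W + 1 := by
      have := Nat.lt_div_mul_add (a := ℓ - 2) hW0
      rw [← hm] at this
      omega
    have h4 : (ℓ : ℝ) ≤ m * W + W + 1 := by exact_mod_cast h3
    rw [div_le_iff₀ (by positivity)]
    have : (0 : ℝ) ≤ 16 * W * (Z.card + 1) := by positivity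
    nlinarith
  have ha : ∀ i, s ≤ i → i < s + ℓ → A.a i = A.a s := by
    intro i hi hi'
    have h3 := hA.sum i (by omega)
    have h4 := hA.sum s (by omega)
    have h5 := hpc i hi hi'
    have h6 := hpc s le_rfl (by omega)
    omega
  have haR : (A.a s : ℝ) = (k : ℝ) - b' - c' := by
    have h4 := hA.sum s (by omega)
    have h6 := hpc s le_rfl (by omega)
    rw [h6.1, h6.2, hAk] at h4
    have : (c' + A.a s + b' : ℝ) = k := by exact_mod_cast h4
    linarith
  have hbet : ∀ i, s ≤ i → i + 1 < s + ℓ → A.bet i = b' * c' := by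
    intro i hi hi'
    rw [bet, (hpc i hi (by omega)).2, (hpc (i + 1) (by omega) hi').1]
  have hs1 := hA.sum_one
  rw [hAk, hAb] at hs1
  have ha1 : (A.a 1 : ℝ) = k - 1 - b := by
    have : (1 + A.a 1 + b : ℝ) = k := by exact_mod_cast hs1
    linarith
  have hb0 : 0 < √(b : ℝ) := Real.sqrt_pos.2 (by exact_mod_cast (by omega : 0 < b))
  have hr0 : 0 < 2 * √((b' * c' : ℕ) : ℝ) := (abs_nonneg _).trans_lt hx₀
  have hcos : (A.a s : ℝ) + 2 * √((b' * c' : ℕ) : ℝ) *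
      Real.cos (Real.arccos ((x₀ - A.a s) / (2 * √((b' * c' : ℕ) : ℝ)))) = x₀ := by
    rw [← haR, _root_.abs_lt] at hx₀
    rw [Real.cos_arccos (by rw [le_div_iff₀ hr0]; linarith) (by rw [div_le_iff₀ hr0]; linarith)]
    field_simp
    ring
  have hgc := hA.good_count (a := A.a s) (β := b' * c') (u := s) (m := m) (W := W)
    (α := Real.arccos ((x₀ - A.a s) / (2 * √((b' * c' : ℕ) : ℝ)))) hδ (by omega) hW hW0
    (fun i hi hi' => ha i (by omega) (by omega)) (fun i hi hi' => hbet i hi (by omega))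
  rw [hcos] at hgc
  set G : Finset ℝ := A.nodes.filter fun x => |x - x₀| ≤ δ ∧
    m * A.F x ≤ 4 * (A.D + 1) * ∑ i ∈ Finset.range (m * W), A.e (s + 1 + i) x ^ 2 with hG
  have hDs := hh.D_succ_le hA
  rw [hAk] at hDs
  have hcard : c * A.nodes.card + Z.card < G.card := by
    rw [hA.nodes_spec.1, Nat.cast_add, Nat.cast_one]
    have e1 : c * (A.D + 1) ≤ η * h / (16 * W) := by
      calc c * (A.D + 1) ≤ c * (2 ^ (2 * k + 2) * h) := by gcongr
        _ = _ := by rw [hc]; field_simp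
    have e2 : (Z.card : ℝ) < η * h / (16 * W) := by
      rw [lt_div_iff₀ (by positivity)]; linarith
    have e3 : η * h / (2 * W) / 4 = η * h / (16 * W) + η * h / (16 * W) := by
      field_simp; norm_num
    linarith
  obtain ⟨x, hx, hn, hcx⟩ := exists_dense_class (Finset.filter_subset _ _) (Z := Z) (n₀ := n₀)
    (fun x hx hn => by
      rw [hZ, Set.Finite.mem_toFinset]
      exact ⟨A.cls x, hA.conjSet hx, mem_cls_self hx, hn, fun y hy => by
        rw [← hAk]; exact hA.abs_le (mem_nodes.1 (cls_subset A x hy))⟩) hc0.le hcard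
  have habs : ∀ y ∈ A.nodes, |y| ≤ A.b 0 := fun y hy => hA.abs_le (mem_nodes.1 hy)
  have hxi : ∀ y, A.xi y = (y - (k - 1 - b)) / (2 * √(b : ℝ)) := fun y => by rw [xi, ha1, hAb]
  have hEn : ∀ y, A.En y = ((k : ℝ) - y) * (k + (k - b) * y) / (k * b) := fun y => by
    rw [En, ha1, hAb, hAk]; congr 2; ring
  have hFb : ∀ y ∈ G, ∀ z : ℝ, 1 ≤ |z| → |z| ≤ 2 * k → z + z⁻¹ = 2 * A.xi y →
      A.F y ≤ 64 * 2 ^ (2 * k + 2) * W / κ * K ^ 2 * (2 * k) ^ 2 *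
        (h ^ 3 * K ^ (s - h + 1) * |z| ^ (2 * (h - 2))) := by
    intro y hy z hz hzk hzy
    obtain ⟨hy1, hy2, hy3⟩ := Finset.mem_filter.1 hy
    have := hh.F_le_of_piece hA (by omega) hhs (by omega) hsD hβ ha hbet hκ0
      (by rw [haR]; exact (hnb y hy2).2.2.2) hm1 hmW hy3 (habs y hy1) hz hzy
    rw [hAk, ← hK] at this
    refine this.trans ?_
    gcongr
  have hlow : ∀ y ∈ G, ∀ z : ℝ, 1 ≤ |z| → |z| ≤ 2 * k → z + z⁻¹ = 2 * A.xi y →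
      |z| ^ (2 * (h - 2)) * E ≤ 4 * (1 + 2 * k) ^ 2 * K ^ 2 * A.F y := by
    intro y hy z hz hzk hzy
    obtain ⟨hy1, hy2, -⟩ := Finset.mem_filter.1 hy
    have h3 := hh.sq_pow_mul_En_le hA (by omega) (habs y hy1) hz hzy
    rw [hAk, ← hK] at h3
    have h4 := (hnb y hy2).1
    rw [← hEn] at h4
    have hF0 : 0 ≤ A.F y := zero_le_one.trans (A.one_le_F y)
    calc _ ≤ |z| ^ (2 * (h - 2)) * A.En y ^ 2 := by gcongr
      _ ≤ _ := h3
      _ ≤ _ := by gcongr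
  have hclose1 : ∀ y ∈ G, ∀ y' ∈ G, A.F y = A.F y' → ∀ z z' : ℝ, 1 ≤ |z| → |z| ≤ 2 * k →
      z + z⁻¹ = 2 * A.xi y → 1 ≤ |z'| → |z'| ≤ 2 * k → z' + z'⁻¹ = 2 * A.xi y' →
      |z| ≤ (1 + ε / (2 * (k : ℝ) ^ 2)) * |z'| := by
    intro y hy y' hy' hF z z' hz hzk hzy hz' hzk' hzy'
    by_contra! hcon
    have e1 := hlow y hy z hz hzk hzy
    have e2 := hFb y' hy' z' hz' hzk' hzy'
    rw [hF] at e1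
    have e3 : |z| ^ (2 * (h - 2)) ≤
        C * h ^ 3 * K ^ (s - h + 1) * |z'| ^ (2 * (h - 2)) := by
      rw [← le_div_iff₀ hE0] at e1
      refine e1.trans ?_
      rw [div_le_iff₀ hE0]
      calc _ ≤ 4 * (1 + 2 * (k : ℝ)) ^ 2 * K ^ 2 * (64 * 2 ^ (2 * k + 2) * W / κ * K ^ 2 *
            (2 * k) ^ 2 * (h ^ 3 * K ^ (s - h + 1) * |z'| ^ (2 * (h - 2)))) := by gcongr
        _ = _ := by rw [hC]; field_simp
    have e4 : ((1 + ε / (2 * (k : ℝ) ^ 2)) * |z'|) ^ (2 * (h - 2)) ≤ |z| ^ (2 * (h - 2)) :=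
      pow_le_pow_left₀ (by positivity) hcon.le _
    rw [mul_pow] at e4
    have e5 : 0 < |z'| ^ (2 * (h - 2)) := by positivity
    exact absurd hlt (not_lt.2 (le_of_mul_le_mul_right (e4.trans e3) e5))
  have hclose : ∀ y ∈ G, ∀ y' ∈ G, A.F y = A.F y' → |y - y'| ≤ ε := by
    intro y hy y' hy' hF
    have hzex : ∀ y ∈ G, ∃ z : ℝ, 1 ≤ |z| ∧ |z| ≤ 2 * k ∧ z + z⁻¹ = 2 * A.xi y := by
      intro y hy
      obtain ⟨hy1, hy2, -⟩ := Finset.mem_filter.1 hy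
      have h3 := (hnb y hy2).2.1
      rw [← hxi] at h3
      obtain ⟨z, -, hz2, hz3, hz4⟩ := exists_add_inv_eq h3.le
      refine ⟨z, h3.le.trans hz3, hz4.trans ?_, hz2⟩
      have hyk := habs y hy1
      rw [hAk] at hyk
      have hB1 : 1 ≤ √(b : ℝ) := Real.one_le_sqrt.2 (by exact_mod_cast (by omega : 1 ≤ b))
      have : |A.xi y| ≤ k := by
        rw [xi, hAb, abs_div, abs_of_pos (by positivity : (0 : ℝ) < 2 * √(b : ℝ)),
          div_le_iff₀ (by positivity)]
        refine (abs_sub _ _).trans ?_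
        rw [Nat.abs_cast]
        have : (A.a 1 : ℝ) ≤ k := by exact_mod_cast (by omega : A.a 1 ≤ k)
        nlinarith
      linarith
    obtain ⟨z, hz1, hz2, hz3⟩ := hzex y hy
    obtain ⟨z', hz1', hz2', hz3'⟩ := hzex y' hy'
    have c1 := hclose1 y hy y' hy' hF z z' hz1 hz2 hz3 hz1' hz2' hz3'
    have c2 := hclose1 y' hy' y hy hF.symm z' z hz1' hz2' hz3' hz1 hz2 hz3
    have hσ := (hnb y (Finset.mem_filter.1 hy).2.1).2.2.1
    have hσ' := (hnb y' (Finset.mem_filter.1 hy').2.1).2.2.1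
    rw [← hxi] at hσ hσ'
    have hsgn : 0 < A.xi y * A.xi y' := by
      have := mul_pos hσ hσ'
      have hσ2 : 0 ≤ σ ^ 2 := sq_nonneg _
      rw [show σ * A.xi y * (σ * A.xi y') = σ ^ 2 * (A.xi y * A.xi y') by ring] at this
      exact pos_of_mul_pos_right this hσ2
    have hd := abs_sub_le_of_add_inv hz1 hz1' hz3 hz3' hsgn
    have hd2 : |(|z| - |z'|)| ≤ ε / (2 * (k : ℝ) ^ 2) * (2 * k) := by
      have hε' : 0 ≤ ε / (2 * (k : ℝ) ^ 2) := by positivity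
      have m1 := mul_le_mul_of_nonneg_left hz2 hε'
      have m2 := mul_le_mul_of_nonneg_left hz2' hε'
      rw [add_mul, one_mul] at c1 c2
      rw [_root_.abs_le]
      constructor <;> linarith
    have hyy : y - y' = √(b : ℝ) * (2 * A.xi y - 2 * A.xi y') := by
      rw [hxi, hxi]; field_simp; ring
    have hbk' : √(b : ℝ) ≤ k := by
      rw [Real.sqrt_le_left (by positivity)]
      have : (b : ℝ) ≤ k := by exact_mod_cast (by omega : b ≤ k)
      nlinarith
    rw [hyy, abs_mul, abs_of_pos hb0]
    calc _ ≤ (k : ℝ) * (ε / (2 * (k : ℝ) ^ 2) * (2 * k)) := by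
          exact mul_le_mul hbk' (hd.trans hd2) (abs_nonneg _) (Nat.cast_nonneg _)
      _ = ε := by field_simp
  have hn' : (n₀ : ℝ) ≤ (A.cls x).card := by exact_mod_cast hn.le
  have hg2 : 2 ≤ (A.cls x ∩ G).card := by
    have : (2 : ℝ) ≤ (A.cls x ∩ G).card := by nlinarith
    exact_mod_cast this
  have hdisc := ((hA.conjSet hx).one_le_abs_disc).trans (abs_disc_split
    (S := A.cls x) (G := A.cls x ∩ G) Finset.inter_subset_left (M := 2 * k) (by linarith)
    (fun y hy y' hy' => by
      have e1 := habs y (cls_subset A x hy)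
      have e2 := habs y' (cls_subset A x hy')
      rw [hAk] at e1 e2
      exact (abs_sub _ _).trans (by linarith)))
  have hsm : |∏ y ∈ A.cls x ∩ G, ∏ y' ∈ (A.cls x ∩ G).erase y, (y - y')| ≤
      ε ^ ((A.cls x ∩ G).card * ((A.cls x ∩ G).card - 1)) := by
    simp only [Finset.abs_prod]
    rw [mul_comm, pow_mul, ← Finset.prod_const]
    refine Finset.prod_le_prod (fun _ _ => Finset.prod_nonneg fun _ _ => abs_nonneg _)
      fun y hy => ?_
    rw [← Finset.card_erase_of_mem hy, ← Finset.prod_const]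
    refine Finset.prod_le_prod (fun _ _ => abs_nonneg _) fun y' hy' => ?_
    have g1 := Finset.mem_inter.1 hy
    have g2 := Finset.mem_inter.1 (Finset.mem_of_mem_erase hy')
    exact hclose y g1.2 y' g2.2 ((hA.F_eq_of_mem_cls hx g1.1).trans
      (hA.F_eq_of_mem_cls hx g2.1).symm)
  have hfin := disc_lt_one (n := (A.cls x).card) (g := (A.cls x ∩ G).card) hc0
    (by linarith : (1 : ℝ) < 2 * k) hε hg2 hcx (by omega)
  refine absurd hfin (not_lt.2 (hdisc.trans ?_))
  have hM : (1 : ℝ) ≤ 2 * k := by linarith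
  have hsd : (A.cls x \ (A.cls x ∩ G)).card ≤ (A.cls x).card :=
    Finset.card_le_card Finset.sdiff_subset
  refine mul_le_mul hsm (pow_le_pow_right₀ hM (Nat.mul_le_mul_left _ hsd)) (by positivity)
    (by positivity)

end Arr

namespace Arr

theorem end_near_head {k b : ℕ} (hb : 2 ≤ b) (hbk : 1 + b ≤ k) (ψ : ℕ) :
    ∃ N : ℕ, ∀ (A : Arr) (h s : ℕ), A.Reg → A.b 0 = k → A.b 1 = b → A.Head h → N ≤ h → h < s →
      s ≤ A.D → N * (s - h) ≤ h → k + A.b s ≤ ψ + A.c s → False := by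
  obtain ⟨Ne, hNe⟩ := end_far hb hbk
  induction ψ with
  | zero =>
    refine ⟨Ne, fun A h s hA hAk hAb hh hN hhs hsD hNs hψ => ?_⟩
    obtain rfl : s = A.D := by
      by_contra hne
      have h1 := hA.b_pos s (by omega)
      have h2 := hA.sum s hsD
      omega
    exact hNe A h hA hAk hAb hh hN hNs
  | succ ψ ih =>
    obtain ⟨N', hN'⟩ := ih
    have hη : (0 : ℝ) < 1 / (2 * N' + 1) := by positivity
    obtain ⟨Nt, hNt⟩ := tail_far hb hbk hη
    have hpiece : ∀ c' b' : ℕ, ∃ N : ℕ, 1 ≤ c' → 1 ≤ b' → b' ≤ b → ¬ (c' = 1 ∧ b' = b) →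
        ¬ (c' = b ∧ b' = 1) → ∀ (A : Arr) (h s ℓ : ℕ), A.Reg → A.b 0 = k → A.b 1 = b → A.Head h →
        N ≤ h → h < s → N * (s - h) ≤ h → s + ℓ ≤ A.D → 1 / (2 * (N' : ℝ) + 1) * h ≤ ℓ →
        (∀ i, s ≤ i → i < s + ℓ → A.c i = c' ∧ A.b i = b') → False := by
      intro c' b'
      by_cases hP : 1 ≤ c' ∧ 1 ≤ b' ∧ b' ≤ b ∧ ¬ (c' = 1 ∧ b' = b) ∧ ¬ (c' = b ∧ b' = 1)
      · obtain ⟨p1, p2, p3, p4, p5⟩ := hP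
        obtain ⟨N, hN⟩ := long_piece hb hbk p1 p2 p3 p4 p5 hη
        exact ⟨N, fun _ _ _ _ _ => hN⟩
      · exact ⟨0, fun p1 p2 p3 p4 p5 => absurd ⟨p1, p2, p3, p4, p5⟩ hP⟩
    choose Np hNp using hpiece
    set M := (Finset.range (k + 1) ×ˢ Finset.range (k + 1)).sup fun p => Np p.1 p.2 with hM
    refine ⟨Ne + 2 * N' + Nt + M, fun A h s hA hAk hAb hh hN hhs hsD hNs hψ => ?_⟩
    have hmul : ∀ n ≤ Ne + 2 * N' + Nt + M, n * (s - h) ≤ h := fun n hn =>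
      (Nat.mul_le_mul_right _ hn).trans hNs
    rcases hsD.eq_or_lt with rfl | hsD
    · exact hNe A h hA hAk hAb hh (by omega) (hmul _ (by omega))
    have hex : ∃ t, s < t ∧ ¬ (A.c t = A.c s ∧ A.b t = A.b s) :=
      ⟨A.D, hsD, fun h1 => by
        have := hA.b_pos s hsD
        have := hA.b_last
        omega⟩
    classical
    obtain ⟨t, ht⟩ : ∃ t, t = Nat.find hex := ⟨_, rfl⟩
    have htD : t ≤ A.D := ht ▸ Nat.find_min' hex ⟨hsD, fun h1 => by
      have := hA.b_pos s hsD
      have := hA.b_last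
      omega⟩
    obtain ⟨hst, hne⟩ : s < t ∧ ¬ (A.c t = A.c s ∧ A.b t = A.b s) := ht ▸ Nat.find_spec hex
    have hconst : ∀ i, s ≤ i → i < s + (t - s) → A.c i = A.c s ∧ A.b i = A.b s := by
      intro i hi hit
      rcases hi.eq_or_lt with rfl | hi
      · exact ⟨rfl, rfl⟩
      · have := Nat.find_min hex (m := i) (by omega)
        exact not_not.1 fun h1 => this ⟨hi, h1⟩
    have m1 := hA.c_mono s t hst.le htD
    have m2 := hA.b_anti s t hst.le htD
    by_cases hnear : N' * (t - h) ≤ h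
    · exact hN' A h t hA hAk hAb hh (by omega) (by omega) htD hnear (by omega)
    · have hlong : h ≤ (2 * N' + 1) * (t - s) := by
        have h1 := hmul (2 * N') (by omega)
        have h2 : t - h = (s - h) + (t - s) := by omega
        rw [h2, mul_add] at hnear
        have h3 : (2 * N' + 1) * (t - s) = 2 * (N' * (t - s)) + (t - s) := by ring
        have h4 : 2 * N' * (s - h) = 2 * (N' * (s - h)) := by ring
        omega
      have hlongR : 1 / (2 * (N' : ℝ) + 1) * h ≤ ((t - s : ℕ) : ℝ) := by
        rw [div_mul_eq_mul_div, one_mul, div_le_iff₀ (by positivity), mul_comm]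
        exact_mod_cast hlong
      have hs1 := hA.sum s hsD.le
      have hc1 := hA.c_pos s (by omega) hsD.le
      have hb1 := hA.b_pos s hsD
      have hbb := hA.b_anti 1 s (by omega) hsD.le
      by_cases hend : A.c s = b ∧ A.b s = 1
      · refine hNt A h s hA hAk hAb hh (by omega) hhs.le (hmul _ (by omega))
          (hlongR.trans (by exact_mod_cast (by omega : t - s ≤ A.D - s))) fun i hi hiD => ?_
        have n1 := hA.c_mono s i hi hiD.le
        have n2 := hA.b_anti s i hi hiD.le
        have n3 := hA.b_pos i hiD
        have n4 := hA.tail i (by omega) hiD (by omega)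
        have n5 := hA.sum_one
        have n6 := hA.sum i hiD.le
        omega
      · have hMle : Np (A.c s) (A.b s) ≤ M :=
          Finset.le_sup (f := fun p : ℕ × ℕ => Np p.1 p.2) (b := (A.c s, A.b s))
            (Finset.mem_product.2 ⟨Finset.mem_range.2 (show A.c s < k + 1 by omega),
              Finset.mem_range.2 (show A.b s < k + 1 by omega)⟩)
        refine hNp (A.c s) (A.b s) hc1 hb1 (by omega) (fun h1 => hh.ne ?_) hend A h s (t - s) hA hAk
          hAb hh (by omega) hhs (hmul _ (by omega)) (by omega) hlongR hconst
        have n1 := hA.c_mono (h + 1) s hhs hsD.le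
        have n2 := hA.b_anti (h + 1) s hhs hsD.le
        have n3 := hA.c_pos (h + 1) (by omega) (by omega)
        have n4 := hA.b_anti 1 (h + 1) (by omega) (by omega)
        omega

/-- For fixed valency the diameter is bounded. -/
theorem exists_D_lt (k : ℕ) : ∃ N : ℕ, ∀ A : Arr, A.Reg → A.b 0 = k → A.D < N := by
  have hex : ∀ b : ℕ, ∃ N : ℕ, 2 ≤ b → 1 + b ≤ k → ∀ (A : Arr) (h s : ℕ), A.Reg → A.b 0 = k →
      A.b 1 = b → A.Head h → N ≤ h → h < s → s ≤ A.D → N * (s - h) ≤ h →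
      k + A.b s ≤ 2 * k + A.c s → False := by
    intro b
    by_cases hP : 2 ≤ b ∧ 1 + b ≤ k
    · obtain ⟨N, hN⟩ := end_near_head hP.1 hP.2 (2 * k)
      exact ⟨N, fun _ _ => hN⟩
    · exact ⟨0, fun p1 p2 => absurd ⟨p1, p2⟩ hP⟩
  choose Nb hNb using hex
  refine ⟨2 ^ (2 * k + 1) * ((Finset.range (k + 1)).sup Nb + 3), fun A hA hAk => ?_⟩
  obtain ⟨h, hh⟩ := hA.exists_head
  have h1 := hh.D_lt hA
  rw [hAk] at h1
  refine h1.trans_le (Nat.mul_le_mul_left _ ?_)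
  by_contra! hcon
  have h2 := hh.two_le_b hA (by omega)
  have h3 := hA.sum_one
  have h4 : Nb (A.b 1) ≤ (Finset.range (k + 1)).sup Nb :=
    Finset.le_sup (Finset.mem_range.2 (by omega))
  have h5 := hh.lt
  have h6 := hA.sum (h + 1) (by omega)
  refine hNb (A.b 1) h2 (by omega) A h (h + 1) hA hAk rfl hh (by omega) (by omega) (by omega) ?_
    (by omega)
  rw [Nat.add_sub_cancel_left, mul_one]
  omega

end Arr

/-- For a net of distance-regular graphs with `d → ∞`, every accumulation point of
the net `λ ↦ 1/k(λ)` is `0` or `1/2`. -/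
theorem stmt8 {Λ : Type*} [Preorder Λ] [IsDirected Λ (· ≤ ·)] [Nonempty Λ] [Infinite Λ]
    (Γ : Λ → DRG)
    (hd : Tendsto (fun l : Λ => (Γ l).d) atTop atTop)
    (ξ : ℝ) (hξ : MapClusterPt ξ atTop (fun l : Λ => 1 / ((Γ l).b 0 : ℝ))) :
    ξ = 0 ∨ ξ = 1 / 2 := by
  by_contra! hne
  obtain ⟨h0, h2⟩ := hne
  choose Nk hNk using Arr.exists_D_lt
  have hpos : 0 < ξ := by
    by_contra! hle
    obtain ⟨l, hl⟩ := (hξ.frequently (Iio_mem_nhds (lt_of_le_of_ne hle h0))).exists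
    have : (0 : ℝ) ≤ 1 / ((Γ l).b 0 : ℝ) := by positivity
    exact absurd hl (not_lt.2 this)
  obtain ⟨K, hK⟩ := exists_nat_gt (2 / ξ)
  have hU : Set.Ioi (ξ / 2) ∩ {1 / 2}ᶜ ∈ nhds ξ :=
    inter_mem (Ioi_mem_nhds (by linarith)) (isOpen_compl_singleton.mem_nhds h2)
  obtain ⟨l, ⟨hl1, hl2⟩, hld⟩ := ((hξ.frequently hU).and_eventually
    (hd.eventually_ge_atTop ((Finset.range (K + 1)).sup Nk + 2))).exists
  rw [Set.mem_Ioi] at hl1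
  have hk0 : 0 < (Γ l).b 0 := by
    rcases Nat.eq_zero_or_pos ((Γ l).b 0) with h | h
    · rw [h, Nat.cast_zero, div_zero] at hl1
      linarith
    · exact h
  have hk2 : (Γ l).b 0 ≠ 2 := fun h => hl2 (by rw [h]; norm_num)
  have hkK : (Γ l).b 0 < K + 1 := by
    have hk0' : (0 : ℝ) < (Γ l).b 0 := by exact_mod_cast hk0
    rw [lt_div_iff₀ hk0'] at hl1
    rw [div_lt_iff₀ hpos] at hK
    have : ((Γ l).b 0 : ℝ) < K := by nlinarith
    have : (Γ l).b 0 < K := by exact_mod_cast this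
    omega
  have hk1 : (Γ l).b 0 ≠ 1 := by
    have e1 := (Γ l).c_one (by omega)
    have e2 := (Γ l).b_pos (i := 1) (by omega)
    have e3 := (Γ l).sum_eq (i := 1) (by omega)
    omega
  have hN := hNk ((Γ l).b 0) (Γ l).arr ((Γ l).reg (by omega) (by omega)) rfl
  have hsup : Nk ((Γ l).b 0) ≤ (Finset.range (K + 1)).sup Nk :=
    Finset.le_sup (Finset.mem_range.2 hkK)
  have : (Γ l).arr.D = (Γ l).d := rfl
  omega
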